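/- Let ρ := εB^{-3} r(τκ sin θ − κ′ cos θ) (which equals −div h₀ and has ∫ρ dV = 0), and let ψ be the corresponding zero-mean Neumann solution of Δψ = ρ. Define φ₀ := (ε³(r³ − 3r)/8)(τκ sin θ − κ′ cos θ) and φ₁ := (13ε⁴(r⁴ − 2r²)/96)(τκ² sin 2θ − κκ′ cos 2θ). Then ψ = O(ε²), D_y ψ = D_y φ₀ + O(ε⁴), and ∂_θ ψ = ∂_θ φ₀ + ∂_θ φ₁ + O(ε⁵), where O(ε^n) denotes a function on 𝕊¹_ℓ×𝔻² whose C^k norm is bounded by C_k ε^n for every k, with constants independent of ε, for all sufficiently small ε. -/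

import Mathlib

open Filter Topology MeasureTheory Real
open scoped RealInnerProductSpace

set_option linter.unusedVariables false
noncomputable section

/-- Euclidean three-space `ℝ³`. -/
abbrev E3 := EuclideanSpace ℝ (Fin 3)

/-- Partial derivative of a scalar function on `ℝ³` in the `i`-th coordinate direction. -/
def pd (i : Fin 3) (f : E3 → ℝ) (x : E3) : ℝ :=
  fderiv ℝ f x (EuclideanSpace.single i 1)

/-- The curl of a vector field on `ℝ³`. -/
def curl3 (v : E3 → E3) (x : E3) : E3 :=
  (EuclideanSpace.equiv (Fin 3) ℝ).symm
    ![pd 1 (fun z => v z 2) x - pd 2 (fun z => v z 1) x,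
      pd 2 (fun z => v z 0) x - pd 0 (fun z => v z 2) x,
      pd 0 (fun z => v z 1) x - pd 1 (fun z => v z 0) x]

/-- The divergence of a vector field on `ℝ³`. -/
def div3 (v : E3 → E3) (x : E3) : ℝ := ∑ i, pd i (fun z => v z i) x

/-- The gradient of a scalar function on `ℝ³`. -/
def grad3 (f : E3 → ℝ) (x : E3) : E3 :=
  (EuclideanSpace.equiv (Fin 3) ℝ).symm ![pd 0 f x, pd 1 f x, pd 2 f x]

/-- The (Euclidean) Laplacian of a scalar function on `ℝ³`. -/
def lap3 (f : E3 → ℝ) (x : E3) : ℝ := ∑ i, pd i (pd i f) x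

/-- A closed analytic curve in `ℝ³`, parametrized by arc length with period `ℓ`,
with nowhere vanishing curvature `κ`, torsion `τ`, and Frenet normal and binormal
`e₁`, `e₂`. -/
structure FramedCurve where
  ℓ : ℝ
  hℓ : 0 < ℓ
  γ : ℝ → E3
  e₁ : ℝ → E3
  e₂ : ℝ → E3
  κ : ℝ → ℝ
  τ : ℝ → ℝ
  analytic_γ : ∀ t : ℝ, AnalyticAt ℝ γ t
  smooth_e₁ : ContDiff ℝ (⊤ : ℕ∞) e₁
  smooth_e₂ : ContDiff ℝ (⊤ : ℕ∞) e₂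
  smooth_κ : ContDiff ℝ (⊤ : ℕ∞) κ
  smooth_τ : ContDiff ℝ (⊤ : ℕ∞) τ
  periodic_γ : Function.Periodic γ ℓ
  periodic_e₁ : Function.Periodic e₁ ℓ
  periodic_e₂ : Function.Periodic e₂ ℓ
  periodic_κ : Function.Periodic κ ℓ
  periodic_τ : Function.Periodic τ ℓ
  injOn : Set.InjOn γ (Set.Ico 0 ℓ)
  unit_speed : ∀ t, ‖deriv γ t‖ = 1
  κ_pos : ∀ t, 0 < κ t
  frenet₁ : ∀ t, deriv (deriv γ) t = κ t • e₁ t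
  frenet₂ : ∀ t, deriv e₁ t = τ t • e₂ t - κ t • deriv γ t
  frenet₃ : ∀ t, deriv e₂ t = -(τ t) • e₁ t
  unit_e₁ : ∀ t, ‖e₁ t‖ = 1
  unit_e₂ : ∀ t, ‖e₂ t‖ = 1
  orth₁₂ : ∀ t, ⟪e₁ t, e₂ t⟫ = 0
  orth₀₁ : ∀ t, ⟪deriv γ t, e₁ t⟫ = 0
  orth₀₂ : ∀ t, ⟪deriv γ t, e₂ t⟫ = 0

/-- The point of the tube with coordinates `(α, y)`:
`γ(α) + ε y₁ e₁(α) + ε y₂ e₂(α)`. -/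
def tubeCoord (Γ : FramedCurve) (ε : ℝ) (α : ℝ) (y : ℝ × ℝ) : E3 :=
  Γ.γ α + (ε * y.1) • Γ.e₁ α + (ε * y.2) • Γ.e₂ α

/-- The open tube `𝒯_ε(γ) = {x : dist (x, γ) < ε}` of core `γ` and thickness `ε`. -/
def TubeSet (Γ : FramedCurve) (ε : ℝ) : Set E3 :=
  Metric.thickening ε (Set.range Γ.γ)

/-- A vector field is tangent to the boundary torus `∂𝒯_ε`: at every boundary point it
lies in the tangent plane of the torus, spanned by the `α`- and `θ`-coordinate vectors. -/
def TangentToBoundary (Γ : FramedCurve) (ε : ℝ) (v : E3 → E3) : Prop :=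
  ∀ α θ : ℝ, v (tubeCoord Γ ε α (cos θ, sin θ)) ∈
    Submodule.span ℝ
      ({deriv (fun t => tubeCoord Γ ε t (cos θ, sin θ)) α,
        deriv (fun t => tubeCoord Γ ε α (cos t, sin t)) θ} : Set E3)

/-- The reference field `h₀ = B⁻²(∂_α + τ ∂_θ)` of the tube, written in ambient terms;
here `B = 1 - εκy₁` and `∂_α`, `∂_θ` are coordinate vector fields of `(α, y)`. -/
def h0At (Γ : FramedCurve) (ε : ℝ) (α : ℝ) (y : ℝ × ℝ) : E3 :=
  ((1 - ε * Γ.κ α * y.1) ^ 2)⁻¹ •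
    (deriv (fun t => tubeCoord Γ ε t y) α +
      (ε * Γ.τ α) • (y.1 • Γ.e₂ α - y.2 • Γ.e₁ α))

/-- `h` is the harmonic field of the tube `𝒯_ε`: a divergence-free, irrotational field
tangent to the boundary, normalized by `h = h₀ + ∇ψ` for a scalar function `ψ`. -/
def IsTubeHarmonic (Γ : FramedCurve) (ε : ℝ) (h : E3 → E3) : Prop :=
  (∃ Ω : Set E3, IsOpen Ω ∧ closure (TubeSet Γ ε) ⊆ Ω ∧ ContDiffOn ℝ (⊤ : ℕ∞) h Ω ∧
    ∀ x ∈ Ω, div3 h x = 0 ∧ curl3 h x = 0) ∧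
  TangentToBoundary Γ ε h ∧
  ∃ ψ : E3 → ℝ, ∀ (α : ℝ) (y : ℝ × ℝ), y.1 ^ 2 + y.2 ^ 2 ≤ 1 →
    h (tubeCoord Γ ε α y) = h0At Γ ε α y + grad3 ψ (tubeCoord Γ ε α y)

/-- `v` is the local Beltrami field of the tube `𝒯_ε`: it solves `curl v = ε³ v` in a
neighborhood of the closed tube, is tangent to the boundary, and its harmonic part
(`L²` projection onto the harmonic fields) is the harmonic field `h`. -/
def IsLocalBeltrami (Γ : FramedCurve) (ε : ℝ) (v : E3 → E3) : Prop :=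
  (∃ Ω : Set E3, IsOpen Ω ∧ closure (TubeSet Γ ε) ⊆ Ω ∧ ContDiffOn ℝ (⊤ : ℕ∞) v Ω ∧
    ∀ x ∈ Ω, curl3 v x = (ε ^ 3) • v x) ∧
  TangentToBoundary Γ ε v ∧
  ∃ h : E3 → E3, IsTubeHarmonic Γ ε h ∧
    ∫ x in TubeSet Γ ε, ⟪h x, v x - h x⟫ = 0

/-- The components `(u_α, u₁, u₂)` of a vector field `u` in the coordinates `(α, y)`,
i.e. `u = u_α ∂_α + u₁ ∂_{y₁} + u₂ ∂_{y₂}`, as functions of `(α, y₁, y₂)`. -/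
def ComponentsOn (Γ : FramedCurve) (ε : ℝ) (u : E3 → E3)
    (cα c₁ c₂ : ℝ × ℝ × ℝ → ℝ) : Prop :=
  ∀ (α : ℝ) (y : ℝ × ℝ), y.1 ^ 2 + y.2 ^ 2 ≤ 1 →
    u (tubeCoord Γ ε α y) =
      cα (α, y.1, y.2) • deriv (fun t => tubeCoord Γ ε t y) α +
      (ε * c₁ (α, y.1, y.2)) • Γ.e₁ α + (ε * c₂ (α, y.1, y.2)) • Γ.e₂ α

/-- Coordinates `(α, y₁, y₂)` on `𝕊¹_ℓ × 𝔻²`. -/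
abbrev P3 := ℝ × ℝ × ℝ

/-- Partial derivative in the slow variable `α`. -/
def pA (f : P3 → ℝ) (p : P3) : ℝ := fderiv ℝ f p (1, 0, 0)
/-- Partial derivative in the fast variable `y₁`. -/
def p1 (f : P3 → ℝ) (p : P3) : ℝ := fderiv ℝ f p (0, 1, 0)
/-- Partial derivative in the fast variable `y₂`. -/
def p2 (f : P3 → ℝ) (p : P3) : ℝ := fderiv ℝ f p (0, 0, 1)

/-- The fundamental domain `(0, ℓ] × 𝔻²` of `𝕊¹_ℓ × 𝔻²`. -/
def domP (ℓ : ℝ) : Set P3 := (Set.Ioc 0 ℓ) ×ˢ {y : ℝ × ℝ | y.1 ^ 2 + y.2 ^ 2 ≤ 1}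

/-- The closed solid torus `𝕊¹_ℓ × 𝔻²` in the coordinates `(α, y)` (all `α`). -/
def domC : Set P3 := {p : P3 | p.2.1 ^ 2 + p.2.2 ^ 2 ≤ 1}

/-- Squared `L²` norm on `𝕊¹_ℓ × 𝔻²`. -/
def L2sq (ℓ : ℝ) (f : P3 → ℝ) : ℝ := ∫ p in domP ℓ, (f p) ^ 2

/-- Squared Sobolev `H^k` norm on `𝕊¹_ℓ × 𝔻²`. -/
def SobSq (ℓ : ℝ) (k : ℕ) (f : P3 → ℝ) : ℝ :=
  ∑ j ∈ Finset.range (k + 1), ∫ p in domP ℓ, ‖iteratedFDeriv ℝ j f p‖ ^ 2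

/-- `ℓ`-periodicity in the angular variable `α`. -/
def PerA (ℓ : ℝ) (f : P3 → ℝ) : Prop := ∀ p : P3, f (p.1 + ℓ, p.2.1, p.2.2) = f p

/-- Pullback of a scalar function on the tube to the coordinates `(α, y₁, y₂)`. -/
def pullT (Γ : FramedCurve) (ε : ℝ) (f : E3 → ℝ) : P3 → ℝ :=
  fun p => f (tubeCoord Γ ε p.1 (p.2.1, p.2.2))

/-- `Ψ` solves the Neumann problem `ΔΨ = Ρ` in `𝒯_ε`, `∂_ν Ψ = 0` on `∂𝒯_ε`,
with zero mean `∫ ψ dα dy = 0` in the coordinates `(α, y)`.  (Since the coordinates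
are Euclidean, the Laplace–Beltrami operator of the tube metric corresponds to the
Euclidean Laplacian on the tube, and the outward normal at the boundary point of
coordinates `(α, θ)` is `cos θ e₁(α) + sin θ e₂(α)`.) -/
def NeumannSol (Γ : FramedCurve) (ε : ℝ) (Ψ Ρ : E3 → ℝ) : Prop :=
  (∃ Ω : Set E3, IsOpen Ω ∧ closure (TubeSet Γ ε) ⊆ Ω ∧ ContDiffOn ℝ (⊤ : ℕ∞) Ψ Ω ∧
    ContDiffOn ℝ (⊤ : ℕ∞) Ρ Ω) ∧
  (∀ x ∈ TubeSet Γ ε, lap3 Ψ x = Ρ x) ∧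
  (∀ α θ : ℝ, fderiv ℝ Ψ (tubeCoord Γ ε α (cos θ, sin θ))
      ((cos θ) • Γ.e₁ α + (sin θ) • Γ.e₂ α) = 0) ∧
  (∫ p in domP Γ.ℓ, pullT Γ ε Ψ p = 0)

/-- The source term `ρ = ε B⁻³ r (τκ sin θ − κ′ cos θ)` (which equals `−div h₀`),
in the Cartesian coordinates `y = (r cos θ, r sin θ)`. -/
def rhoSrc (Γ : FramedCurve) (ε : ℝ) : P3 → ℝ := fun p =>
  ε * ((1 - ε * Γ.κ p.1 * p.2.1) ^ 3)⁻¹ *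
    (Γ.τ p.1 * Γ.κ p.1 * p.2.2 - deriv Γ.κ p.1 * p.2.1)

/-- `φ₀ = (ε³(r³ − 3r)/8)(τκ sin θ − κ′ cos θ)` in Cartesian coordinates. -/
def phi0 (Γ : FramedCurve) (ε : ℝ) : P3 → ℝ := fun p =>
  ε ^ 3 * (p.2.1 ^ 2 + p.2.2 ^ 2 - 3) / 8 *
    (Γ.τ p.1 * Γ.κ p.1 * p.2.2 - deriv Γ.κ p.1 * p.2.1)

/-- `φ₁ = (13ε⁴(r⁴ − 2r²)/96)(τκ² sin 2θ − κκ′ cos 2θ)` in Cartesian coordinates. -/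
def phi1 (Γ : FramedCurve) (ε : ℝ) : P3 → ℝ := fun p =>
  13 * ε ^ 4 * (p.2.1 ^ 2 + p.2.2 ^ 2 - 2) / 96 *
    (Γ.τ p.1 * (Γ.κ p.1) ^ 2 * (2 * p.2.1 * p.2.2) -
      Γ.κ p.1 * deriv Γ.κ p.1 * (p.2.1 ^ 2 - p.2.2 ^ 2))

/-- The angular derivative `∂_θ = y₁ ∂_{y₂} − y₂ ∂_{y₁}`. -/
def thetaD (f : P3 → ℝ) (p : P3) : ℝ :=
  p.2.1 * fderiv ℝ f p (0, 0, 1) - p.2.2 * fderiv ℝ f p (0, 1, 0)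

/-- The `y`-derivatives `D_y f = (∂_{y₁} f, ∂_{y₂} f)`. -/
def pd1 (f : P3 → ℝ) (p : P3) : ℝ := fderiv ℝ f p (0, 1, 0)
def pd2 (f : P3 → ℝ) (p : P3) : ℝ := fderiv ℝ f p (0, 0, 1)

set_option linter.all false

section


/-- Smooth functions periodic in the first variable. -/
def SmP (ℓ : ℝ) : Subalgebra ℝ (P3 → ℝ) where
  carrier := {f | ContDiff ℝ (⊤ : ℕ∞) f ∧ PerA ℓ f}
  mul_mem' := fun {a b} ha hb => ⟨ha.1.mul hb.1, fun p => by
    simp only [Pi.mul_apply]; rw [ha.2 p, hb.2 p]⟩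
  add_mem' := fun {a b} ha hb => ⟨ha.1.add hb.1, fun p => by
    simp only [Pi.add_apply]; rw [ha.2 p, hb.2 p]⟩
  algebraMap_mem' := fun r => ⟨contDiff_const, fun p => rfl⟩

def Fn (ℓ : ℝ) : Type := ↥(SmP ℓ)
instance (ℓ : ℝ) : CommRing (Fn ℓ) := inferInstanceAs (CommRing ↥(SmP ℓ))
instance (ℓ : ℝ) : Algebra ℝ (Fn ℓ) := inferInstanceAs (Algebra ℝ ↥(SmP ℓ))

variable {ℓ : ℝ}

/-- Evaluation at a point. -/
def ev (p : P3) : Fn ℓ →ₐ[ℝ] ℝ := (Pi.evalAlgHom ℝ (fun _ : P3 => ℝ) p).comp (SmP ℓ).val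

lemma ev_def (p : P3) (u : Fn ℓ) : ev p u = u.1 p := rfl

lemma Fn.ext' {u v : Fn ℓ} (h : ∀ p, ev p u = ev p v) : u = v := Subtype.ext (funext h)

lemma Fn.smooth (u : Fn ℓ) : ContDiff ℝ (⊤ : ℕ∞) u.1 := u.2.1

lemma Fn.diff (u : Fn ℓ) : Differentiable ℝ u.1 := u.2.1.differentiable (by simp)

lemma Fn.cont (u : Fn ℓ) : Continuous u.1 := u.2.1.continuous

lemma Fn.per (u : Fn ℓ) (α a b : ℝ) : ev (α + ℓ, a, b) u = ev (α, a, b) u := u.2.2 (α, a, b)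

lemma perA_fderiv {f : P3 → ℝ} (h : PerA ℓ f) (e : P3) : PerA ℓ (fun p => fderiv ℝ f p e) := by
  intro p
  have h1 : (fun q : P3 => f (q + (ℓ, 0, 0))) = f := by
    funext q
    have h3 : q + ((ℓ, 0, 0) : P3) = (q.1 + ℓ, q.2.1, q.2.2) := by
      ext <;> simp
    rw [h3]; exact h q
  have h2 : fderiv ℝ f (p + (ℓ, 0, 0)) = fderiv ℝ f p := by
    conv_rhs => rw [← h1]
    rw [fderiv_comp_add_right]
  have h3 : p + ((ℓ, 0, 0) : P3) = (p.1 + ℓ, p.2.1, p.2.2) := by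
    ext <;> simp
  rw [h3] at h2
  simp only [h2]

/-- Directional derivative as a derivation. -/
def dv (e : P3) : Derivation ℝ (Fn ℓ) (Fn ℓ) where
  toFun u := ⟨fun p => fderiv ℝ u.1 p e, by
    refine ⟨?_, perA_fderiv u.2.2 e⟩
    exact (u.2.1.fderiv_right (m := (⊤ : ℕ∞)) (by simp)).clm_apply contDiff_const⟩
  map_add' u v := by
    apply Subtype.ext; funext p
    change fderiv ℝ (u.1 + v.1) p e = fderiv ℝ u.1 p e + fderiv ℝ v.1 p e
    rw [fderiv_add (u.diff p) (v.diff p)]; rfl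
  map_smul' c u := by
    apply Subtype.ext; funext p
    change fderiv ℝ (c • u.1) p e = c • fderiv ℝ u.1 p e
    rw [fderiv_const_smul (u.diff p)]; rfl
  map_one_eq_zero' := by
    apply Subtype.ext; funext p
    change fderiv ℝ (fun _ => (1 : ℝ)) p e = 0
    simp
  leibniz' u v := by
    apply Subtype.ext; funext p
    change fderiv ℝ (u.1 * v.1) p e = u.1 p * fderiv ℝ v.1 p e + v.1 p * fderiv ℝ u.1 p e
    rw [fderiv_mul (u.diff p) (v.diff p)]; simp

lemma ev_dv (e p : P3) (u : Fn ℓ) : ev p (dv e u) = fderiv ℝ u.1 p e := rfl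

lemma dv_comm (e e' : P3) (u : Fn ℓ) : dv e (dv e' u) = dv e' (dv e u) := by
  apply Fn.ext'
  intro p
  have hd : DifferentiableAt ℝ (fderiv ℝ u.1) p :=
    ((u.2.1.fderiv_right (m := (⊤ : ℕ∞)) (by simp)).differentiable (by simp)) p
  have key : ∀ a b : P3, ev p (dv a (dv b u)) = fderiv ℝ (fderiv ℝ u.1) p a b := by
    intro a b
    change fderiv ℝ (fun q => fderiv ℝ u.1 q b) p a = _
    rw [fderiv_clm_apply hd (differentiableAt_const _)]
    simp
  rw [key, key]
  have hs : IsSymmSndFDerivAt ℝ u.1 p :=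
    u.2.1.contDiffAt.isSymmSndFDerivAt (by
      rw [minSmoothness_of_isRCLikeNormedField]
      exact WithTop.coe_le_coe.2 (le_top : (2 : ℕ∞) ≤ ⊤))
  exact hs e e'

def d0 : Derivation ℝ (Fn ℓ) (Fn ℓ) := dv (1, 0, 0)
def d1 : Derivation ℝ (Fn ℓ) (Fn ℓ) := dv (0, 1, 0)
def d2 : Derivation ℝ (Fn ℓ) (Fn ℓ) := dv (0, 0, 1)

lemma d10 (u : Fn ℓ) : d1 (d0 u) = d0 (d1 u) := dv_comm _ _ u
lemma d20 (u : Fn ℓ) : d2 (d0 u) = d0 (d2 u) := dv_comm _ _ u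
lemma d21 (u : Fn ℓ) : d2 (d1 u) = d1 (d2 u) := dv_comm _ _ u

def y1 : Fn ℓ := ⟨fun p => p.2.1, by
  constructor
  · fun_prop
  · intro p; rfl⟩
def y2 : Fn ℓ := ⟨fun p => p.2.2, by
  constructor
  · fun_prop
  · intro p; rfl⟩

@[simp] lemma ev_y1 (p : P3) : ev p (y1 : Fn ℓ) = p.2.1 := rfl
@[simp] lemma ev_y2 (p : P3) : ev p (y2 : Fn ℓ) = p.2.2 := rfl

/-- a periodic function of `α` -/
def ofA (f : ℝ → ℝ) (hf : ContDiff ℝ (⊤ : ℕ∞) f) (hp : Function.Periodic f ℓ) : Fn ℓ :=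
  ⟨fun p => f p.1, hf.comp contDiff_fst, fun p => hp p.1⟩

@[simp] lemma ev_ofA (f : ℝ → ℝ) (hf) (hp : Function.Periodic f ℓ) (p : P3) :
    ev p (ofA f hf hp) = f p.1 := rfl

lemma fderiv_p21 (p e : P3) : fderiv ℝ (fun p : P3 => p.2.1) p e = e.2.1 := by
  have : HasFDerivAt (fun p : P3 => p.2.1)
    ((ContinuousLinearMap.fst ℝ ℝ ℝ).comp (ContinuousLinearMap.snd ℝ ℝ (ℝ × ℝ))) p :=
    hasFDerivAt_fst.comp p hasFDerivAt_snd
  rw [this.fderiv]; rfl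
lemma fderiv_p22 (p e : P3) : fderiv ℝ (fun p : P3 => p.2.2) p e = e.2.2 := by
  have : HasFDerivAt (fun p : P3 => p.2.2)
    ((ContinuousLinearMap.snd ℝ ℝ ℝ).comp (ContinuousLinearMap.snd ℝ ℝ (ℝ × ℝ))) p :=
    hasFDerivAt_snd.comp p hasFDerivAt_snd
  rw [this.fderiv]; rfl

lemma fderiv_ofA (f : ℝ → ℝ) (hf : Differentiable ℝ f) (p e : P3) :
    fderiv ℝ (fun p : P3 => f p.1) p e = deriv f p.1 * e.1 := by
  have h1 : HasFDerivAt (fun p : P3 => p.1) (ContinuousLinearMap.fst ℝ ℝ (ℝ × ℝ)) p :=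
    hasFDerivAt_fst
  have := (hf p.1).hasDerivAt.comp_hasFDerivAt p h1
  have h2 : fderiv ℝ (fun p : P3 => f p.1) p = _ := HasFDerivAt.fderiv this
  rw [h2]; simp

@[simp] lemma d0_y1 : d0 (y1 : Fn ℓ) = 0 := Fn.ext' fun p => fderiv_p21 p _
@[simp] lemma d0_y2 : d0 (y2 : Fn ℓ) = 0 := Fn.ext' fun p => fderiv_p22 p _
@[simp] lemma d1_y1 : d1 (y1 : Fn ℓ) = 1 := Fn.ext' fun p => fderiv_p21 p _
@[simp] lemma d1_y2 : d1 (y2 : Fn ℓ) = 0 := Fn.ext' fun p => fderiv_p22 p _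
@[simp] lemma d2_y1 : d2 (y1 : Fn ℓ) = 0 := Fn.ext' fun p => fderiv_p21 p _
@[simp] lemma d2_y2 : d2 (y2 : Fn ℓ) = 1 := Fn.ext' fun p => fderiv_p22 p _
@[simp] lemma d1_ofA (f : ℝ → ℝ) (hf) (hp : Function.Periodic f ℓ) : d1 (ofA f hf hp) = 0 :=
  Fn.ext' fun p => (fderiv_ofA f (hf.differentiable (by simp)) p _).trans (by simp)
@[simp] lemma d2_ofA (f : ℝ → ℝ) (hf) (hp : Function.Periodic f ℓ) : d2 (ofA f hf hp) = 0 :=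
  Fn.ext' fun p => (fderiv_ofA f (hf.differentiable (by simp)) p _).trans (by simp)
lemma ev_d0_ofA (f : ℝ → ℝ) (hf) (hp : Function.Periodic f ℓ) (p : P3) :
    ev p (d0 (ofA f hf hp)) = deriv f p.1 :=
  (fderiv_ofA f (hf.differentiable (by simp)) p _).trans (by simp)

/-- rotation and Euler derivations -/
def dT : Derivation ℝ (Fn ℓ) (Fn ℓ) := (y1 : Fn ℓ) • d2 - (y2 : Fn ℓ) • d1
def dS : Derivation ℝ (Fn ℓ) (Fn ℓ) := (y1 : Fn ℓ) • d1 + (y2 : Fn ℓ) • d2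
lemma dT_def (u : Fn ℓ) : dT u = y1 * d2 u - y2 * d1 u := by simp [dT]
lemma dS_def (u : Fn ℓ) : dS u = y1 * d1 u + y2 * d2 u := by simp [dS]

def Lap (u : Fn ℓ) : Fn ℓ := d1 (d1 u) + d2 (d2 u)

lemma dmul (d : Derivation ℝ (Fn ℓ) (Fn ℓ)) (u v : Fn ℓ) : d (u * v) = u * d v + v * d u := by
  simp

lemma Lap_dT (u : Fn ℓ) : Lap (dT u) = dT (Lap u) := by
  simp only [Lap, dT_def, dmul, map_add, map_sub, d21, d1_y1, d1_y2, d2_y1, d2_y2, map_zero, map_one, Derivation.map_one_eq_zero]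
  ring
lemma Lap_dS (u : Fn ℓ) : Lap (dS u) = dS (Lap u) + 2 * Lap u := by
  simp only [Lap, dS_def, dmul, map_add, map_sub, d21, d1_y1, d1_y2, d2_y1, d2_y2, map_zero, map_one, Derivation.map_one_eq_zero]
  ring
lemma dSS (u : Fn ℓ) : dS (dS u) = (y1 ^ 2 + y2 ^ 2) * Lap u - dT (dT u) := by
  simp only [Lap, dS_def, dT_def, dmul, map_add, map_sub, d21, d1_y1, d1_y2, d2_y1, d2_y2, map_zero, map_one, Derivation.map_one_eq_zero]
  ring
lemma dST (u : Fn ℓ) : dS (dT u) = dT (dS u) := by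
  simp only [Lap, dS_def, dT_def, dmul, map_add, map_sub, d21, d1_y1, d1_y2, d2_y1, d2_y2, map_zero, map_one, Derivation.map_one_eq_zero]
  ring
lemma r2d1 (u : Fn ℓ) : (y1 ^ 2 + y2 ^ 2) * d1 u = y1 * dS u - y2 * dT u := by
  simp only [dS_def, dT_def]; ring
lemma r2d2 (u : Fn ℓ) : (y1 ^ 2 + y2 ^ 2) * d2 u = y2 * dS u + y1 * dT u := by
  simp only [dS_def, dT_def]; ring
lemma d0_Lap (u : Fn ℓ) : d0 (Lap u) = Lap (d0 u) := by
  simp only [Lap, map_add, d10, d20]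
lemma d0_dT (u : Fn ℓ) : d0 (dT u) = dT (d0 u) := by
  simp only [dT_def, dmul, map_sub, d10, d20, d0_y1, d0_y2]; ring
lemma d0_dS (u : Fn ℓ) : d0 (dS u) = dS (d0 u) := by
  simp only [dS_def, dmul, map_add, d10, d20, d0_y1, d0_y2]; ring
lemma Lap_mul (u v : Fn ℓ) : Lap (u * v) = u * Lap v + v * Lap u + 2 * (d1 u * d1 v + d2 u * d2 v) := by
  simp only [Lap, dmul, map_add]; ring
lemma Lap_add (u v : Fn ℓ) : Lap (u + v) = Lap u + Lap v := by
  simp only [Lap, map_add]; ring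
lemma Lap_sub (u v : Fn ℓ) : Lap (u - v) = Lap u - Lap v := by
  simp only [Lap, map_sub]; ring
lemma Lap_smul (c : ℝ) (u : Fn ℓ) : Lap (c • u) = c • Lap u := by
  simp only [Lap, Derivation.map_smul, smul_add]

end

section

variable {ℓ : ℝ}

lemma hasDerivAt_ev (u : Fn ℓ) {a b c : ℝ → ℝ} {a' b' c' t : ℝ}
    (ha : HasDerivAt a a' t) (hb : HasDerivAt b b' t) (hc : HasDerivAt c c' t) :
    HasDerivAt (fun t => ev (a t, b t, c t) u)
      (a' * ev (a t, b t, c t) (d0 u) + b' * ev (a t, b t, c t) (d1 u)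
        + c' * ev (a t, b t, c t) (d2 u)) t := by
  have h1 : HasDerivAt (fun t => ((a t, b t, c t) : P3)) (a', b', c') t :=
    ha.prodMk (hb.prodMk hc)
  have h2 := (u.diff (a t, b t, c t)).hasFDerivAt.comp_hasDerivAt t h1
  have : ((a', b', c') : P3) = a' • ((1, 0, 0) : P3) + b' • ((0, 1, 0) : P3)
      + c' • ((0, 0, 1) : P3) := by
    ext <;> simp
  rw [this, map_add, map_add, map_smul, map_smul, map_smul] at h2
  exact h2

lemma hasDerivAt_ev_r (u : Fn ℓ) (α r θ : ℝ) :
    HasDerivAt (fun r => ev (α, r * cos θ, r * sin θ) u)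
      (cos θ * ev (α, r * cos θ, r * sin θ) (d1 u)
        + sin θ * ev (α, r * cos θ, r * sin θ) (d2 u)) r := by
  have := hasDerivAt_ev u (hasDerivAt_const r α) ((hasDerivAt_id r).mul_const (cos θ))
    ((hasDerivAt_id r).mul_const (sin θ))
  simpa using this

lemma hasDerivAt_ev_θ (u : Fn ℓ) (α r θ : ℝ) :
    HasDerivAt (fun θ => ev (α, r * cos θ, r * sin θ) u)
      (ev (α, r * cos θ, r * sin θ) (dT u)) θ := by
  have := hasDerivAt_ev u (hasDerivAt_const θ α) ((hasDerivAt_cos θ).const_mul r)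
    ((hasDerivAt_sin θ).const_mul r)
  convert this using 1
  rw [dT_def]; simp; ring

lemma hasDerivAt_ev_α (u : Fn ℓ) (α a b : ℝ) :
    HasDerivAt (fun α => ev (α, a, b) u) (ev (α, a, b) (d0 u)) α := by
  have := hasDerivAt_ev u (hasDerivAt_id α) (hasDerivAt_const α a) (hasDerivAt_const α b)
  simpa using this

lemma hasDerivAt_ev_1 (u : Fn ℓ) (α a b : ℝ) :
    HasDerivAt (fun a => ev (α, a, b) u) (ev (α, a, b) (d1 u)) a := by
  have := hasDerivAt_ev u (hasDerivAt_const a α) (hasDerivAt_id a) (hasDerivAt_const a b)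
  simpa using this
lemma hasDerivAt_ev_2 (u : Fn ℓ) (α a b : ℝ) :
    HasDerivAt (fun b => ev (α, a, b) u) (ev (α, a, b) (d2 u)) b := by
  have := hasDerivAt_ev u (hasDerivAt_const b α) (hasDerivAt_const b a) (hasDerivAt_id b)
  simpa using this

/-- closed unit disk -/
def dsk : Set (ℝ × ℝ) := {y : ℝ × ℝ | y.1 ^ 2 + y.2 ^ 2 ≤ 1}

lemma dsk_compact : IsCompact dsk := by
  apply (isCompact_Icc (a := (-1 : ℝ)) (b := 1)).prod (isCompact_Icc (a := (-1 : ℝ)) (b := 1)) |>.of_isClosed_subset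
  · exact isClosed_le (by fun_prop) (by fun_prop)
  · rintro ⟨a, b⟩ h
    simp only [dsk, Set.mem_setOf_eq] at h
    refine ⟨⟨?_, ?_⟩, ⟨?_, ?_⟩⟩ <;> simp <;> nlinarith

lemma ev_cont (u : Fn ℓ) : Continuous (fun p => ev p u) := u.cont

lemma ev_cont_comp {X : Type*} [TopologicalSpace X] (u : Fn ℓ) {f : X → P3} (hf : Continuous f) :
    Continuous (fun x => ev (f x) u) := u.cont.comp hf

lemma J_int (α : ℝ) (f : Fn ℓ) : IntegrableOn (fun y : ℝ × ℝ => ev (α, y.1, y.2) f) dsk :=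
  (ev_cont_comp f (by fun_prop)).continuousOn.integrableOn_compact dsk_compact

/-- integral over a disk slice -/
def J (α : ℝ) : Fn ℓ →ₗ[ℝ] ℝ where
  toFun f := ∫ y in dsk, ev (α, y.1, y.2) f
  map_add' f g := by
    simp only [map_add]
    exact integral_add (J_int α f) (J_int α g)
  map_smul' c f := by
    simp only [map_smul]
    exact integral_smul c _

lemma J_def (α : ℝ) (f : Fn ℓ) : J α f = ∫ y in dsk, ev (α, y.1, y.2) f := rfl

lemma dsk_meas : MeasurableSet dsk := dsk_compact.measurableSet

lemma J_mono (α : ℝ) (f g : Fn ℓ)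
    (h : ∀ a b : ℝ, a ^ 2 + b ^ 2 ≤ 1 → ev (α, a, b) f ≤ ev (α, a, b) g) : J α f ≤ J α g :=
  setIntegral_mono_on (J_int α f) (J_int α g) dsk_meas (fun y hy => h y.1 y.2 hy)

lemma J_congr (α : ℝ) (f g : Fn ℓ)
    (h : ∀ a b : ℝ, a ^ 2 + b ^ 2 ≤ 1 → ev (α, a, b) f = ev (α, a, b) g) : J α f = J α g :=
  le_antisymm (J_mono α f g fun a b hab => (h a b hab).le)
    (J_mono α g f fun a b hab => (h a b hab).ge)

lemma J_polar (α : ℝ) (f : Fn ℓ) :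
    J α f = ∫ r in (0:ℝ)..1, ∫ θ in (-π)..π, r * ev (α, r * cos θ, r * sin θ) f := by
  rw [J_def, ← integral_indicator dsk_meas, ← integral_comp_polarCoord_symm]
  have h1 : ∀ p ∈ polarCoord.target, p.1 • dsk.indicator (fun y => ev (α, y.1, y.2) f) (polarCoord.symm p)
      = (Set.Ioc (0:ℝ) 1 ×ˢ Set.Ioo (-π) π).indicator
        (fun p : ℝ × ℝ => p.1 * ev (α, p.1 * cos p.2, p.1 * sin p.2) f) p := by
    rintro ⟨r, θ⟩ h
    simp only [polarCoord_target, Set.mem_prod, Set.mem_Ioi] at h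
    by_cases hr : r ≤ 1
    · rw [Set.indicator_of_mem, Set.indicator_of_mem]
      · simp [polarCoord_symm_apply]
      · exact ⟨⟨h.1, hr⟩, h.2⟩
      · simp only [polarCoord_symm_apply, dsk, Set.mem_setOf_eq]
        have := sin_sq_add_cos_sq θ
        have : (r * cos θ) ^ 2 + (r * sin θ) ^ 2 = r ^ 2 := by
          linear_combination r ^ 2 * this
        nlinarith
    · rw [Set.indicator_of_notMem, Set.indicator_of_notMem]
      · simp
      · intro h'; exact hr h'.1.2
      · simp only [polarCoord_symm_apply, dsk, Set.mem_setOf_eq]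
        have := sin_sq_add_cos_sq θ
        intro h'
        have : (r * cos θ) ^ 2 + (r * sin θ) ^ 2 = r ^ 2 := by
          linear_combination r ^ 2 * this
        nlinarith
  rw [setIntegral_congr_fun (by rw [polarCoord_target]; measurability) h1]
  rw [setIntegral_indicator (by measurability)]
  have h2 : polarCoord.target ∩ Set.Ioc (0:ℝ) 1 ×ˢ Set.Ioo (-π) π
      = Set.Ioc (0:ℝ) 1 ×ˢ Set.Ioo (-π) π := by
    apply Set.inter_eq_right.2
    rintro ⟨r, θ⟩ h
    exact ⟨h.1.1, h.2⟩
  rw [h2, Measure.volume_eq_prod, setIntegral_prod]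
  · rw [intervalIntegral.integral_of_le zero_le_one]
    congr 1
    funext r
    rw [intervalIntegral.integral_of_le (by linarith [pi_pos]), integral_Ioc_eq_integral_Ioo]
  · have hc : Continuous (fun p : ℝ × ℝ => p.1 * ev (α, p.1 * cos p.2, p.1 * sin p.2) f) :=
      continuous_fst.mul (ev_cont_comp f (by fun_prop))
    have := hc.continuousOn.integrableOn_compact (μ := volume)
      ((isCompact_Icc (a := (0 : ℝ)) (b := 1)).prod (isCompact_Icc (a := -π) (b := π)))
    exact this.mono_set (Set.prod_mono Set.Ioc_subset_Icc_self Set.Ioo_subset_Icc_self)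

/-- integral over a boundary circle -/
def Ci (α : ℝ) : Fn ℓ →ₗ[ℝ] ℝ where
  toFun f := ∫ θ in (-π)..π, ev (α, cos θ, sin θ) f
  map_add' f g := by
    simp only [map_add]
    exact intervalIntegral.integral_add
      ((ev_cont_comp f (by fun_prop)).intervalIntegrable _ _)
      ((ev_cont_comp g (by fun_prop)).intervalIntegrable _ _)
  map_smul' c f := by
    simp only [map_smul]
    exact intervalIntegral.integral_smul c _

lemma Ci_def (α : ℝ) (f : Fn ℓ) : Ci α f = ∫ θ in (-π)..π, ev (α, cos θ, sin θ) f := rfl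

lemma Ci_mono (α : ℝ) (f g : Fn ℓ)
    (h : ∀ θ, ev (α, cos θ, sin θ) f ≤ ev (α, cos θ, sin θ) g) : Ci α f ≤ Ci α g :=
  intervalIntegral.integral_mono_on (by linarith [pi_pos])
      ((ev_cont_comp f (by fun_prop)).intervalIntegrable _ _)
      ((ev_cont_comp g (by fun_prop)).intervalIntegrable _ _) (fun θ _ => h θ)

lemma Ci_congr (α : ℝ) (f g : Fn ℓ)
    (h : ∀ θ, ev (α, cos θ, sin θ) f = ev (α, cos θ, sin θ) g) : Ci α f = Ci α g :=
  le_antisymm (Ci_mono α f g fun θ => (h θ).le) (Ci_mono α g f fun θ => (h θ).ge)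

lemma fderiv_line1 {f : ℝ × ℝ → ℝ} (hf : Differentiable ℝ f) (r θ c : ℝ)
    (h : HasDerivAt (fun t => f (t, θ)) c r) : fderiv ℝ f (r, θ) (1, 0) = c := by
  have h1 : HasDerivAt (fun t : ℝ => (t, θ)) ((1 : ℝ), (0 : ℝ)) r :=
    (hasDerivAt_id r).prodMk (hasDerivAt_const r θ)
  exact ((hf (r, θ)).hasFDerivAt.comp_hasDerivAt r h1).unique h
lemma fderiv_line2 {f : ℝ × ℝ → ℝ} (hf : Differentiable ℝ f) (r θ c : ℝ)
    (h : HasDerivAt (fun t => f (r, t)) c θ) : fderiv ℝ f (r, θ) (0, 1) = c := by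
  have h1 : HasDerivAt (fun t : ℝ => (r, t)) ((0 : ℝ), (1 : ℝ)) θ :=
    (hasDerivAt_const θ r).prodMk (hasDerivAt_id θ)
  exact ((hf (r, θ)).hasFDerivAt.comp_hasDerivAt θ h1).unique h

lemma ev_polar_smooth (u : Fn ℓ) (α : ℝ) :
    ContDiff ℝ (⊤ : ℕ∞) (fun p : ℝ × ℝ => ev (α, p.1 * cos p.2, p.1 * sin p.2) u) := by
  have : ContDiff ℝ (⊤ : ℕ∞) (fun p : ℝ × ℝ => ((α, p.1 * cos p.2, p.1 * sin p.2) : P3)) := by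
    apply contDiff_const.prodMk
    apply ContDiff.prodMk
    · exact contDiff_fst.mul (contDiff_cos.comp contDiff_snd)
    · exact contDiff_fst.mul (contDiff_sin.comp contDiff_snd)
  exact u.smooth.comp this

lemma J_div (α : ℝ) (V W : Fn ℓ) :
    J α (d1 V + d2 W) = Ci α (y1 * V + y2 * W) := by
  set f : ℝ × ℝ → ℝ := fun p => p.1 * (cos p.2 * ev (α, p.1 * cos p.2, p.1 * sin p.2) V
    + sin p.2 * ev (α, p.1 * cos p.2, p.1 * sin p.2) W) with hf
  set g : ℝ × ℝ → ℝ := fun p => (cos p.2 * ev (α, p.1 * cos p.2, p.1 * sin p.2) W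
    - sin p.2 * ev (α, p.1 * cos p.2, p.1 * sin p.2) V) with hg
  have hfs : ContDiff ℝ (⊤ : ℕ∞) f := by
    apply contDiff_fst.mul
    apply ContDiff.add
    · exact (contDiff_cos.comp contDiff_snd).mul (ev_polar_smooth V α)
    · exact (contDiff_sin.comp contDiff_snd).mul (ev_polar_smooth W α)
  have hgs : ContDiff ℝ (⊤ : ℕ∞) g := by
    apply ContDiff.sub
    · exact (contDiff_cos.comp contDiff_snd).mul (ev_polar_smooth W α)
    · exact (contDiff_sin.comp contDiff_snd).mul (ev_polar_smooth V α)
  have hfd : Differentiable ℝ f := hfs.differentiable (by simp)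
  have hgd : Differentiable ℝ g := hgs.differentiable (by simp)
  have hkey : ∀ r θ, fderiv ℝ f (r, θ) (1, 0) + fderiv ℝ g (r, θ) (0, 1)
      = r * ev (α, r * cos θ, r * sin θ) (d1 V + d2 W) := by
    intro r θ
    have e1 : HasDerivAt (fun t => f (t, θ)) _ r :=
      (hasDerivAt_id r).mul (((hasDerivAt_ev_r V α r θ).const_mul (cos θ)).add
        ((hasDerivAt_ev_r W α r θ).const_mul (sin θ)))
    have e2 : HasDerivAt (fun t => g (r, t)) _ θ :=
      (((hasDerivAt_cos θ).mul (hasDerivAt_ev_θ W α r θ)).sub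
        ((hasDerivAt_sin θ).mul (hasDerivAt_ev_θ V α r θ)))
    rw [fderiv_line1 hfd r θ _ e1, fderiv_line2 hgd r θ _ e2]
    simp only [dT_def, map_add, map_sub, map_mul, ev_y1, ev_y2, id, Pi.add_apply]
    have := sin_sq_add_cos_sq θ
    linear_combination (r * (ev (α, r * cos θ, r * sin θ) (d1 V) + ev (α, r * cos θ, r * sin θ) (d2 W))) * this
  have hD := integral2_divergence_prod_of_hasFDerivAt f g (fderiv ℝ f) (fderiv ℝ g) 0 (-π) 1 π
    hfs.continuous.continuousOn hgs.continuous.continuousOn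
    (fun x _ => (hfd x).hasFDerivAt) (fun x _ => (hgd x).hasFDerivAt)
    (by
      apply ContinuousOn.integrableOn_compact (isCompact_uIcc.prod isCompact_uIcc)
      apply Continuous.continuousOn
      have a1 := (hfs.continuous_fderiv (by simp)).clm_apply (continuous_const (y := ((1:ℝ),(0:ℝ))))
      have a2 := (hgs.continuous_fderiv (by simp)).clm_apply (continuous_const (y := ((0:ℝ),(1:ℝ))))
      exact a1.add a2)
  rw [J_polar]
  simp only [hkey] at hD
  rw [hD]
  simp [hf, hg, Ci_def]

lemma J_dS (α : ℝ) (f : Fn ℓ) : J α (dS f + 2 * f) = Ci α f := by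
  have := J_div α (y1 * f) (y2 * f)
  have e1 : d1 (y1 * f) + d2 (y2 * f) = dS f + 2 * f := by
    simp only [dmul, dS_def, d1_y1, d2_y2]; ring
  rw [e1] at this
  rw [this]
  apply Ci_congr
  intro θ
  simp
  linear_combination (ev (α, cos θ, sin θ) f) * (sin_sq_add_cos_sq θ)

lemma J_dT (α : ℝ) (f : Fn ℓ) : J α (dT f) = 0 := by
  have := J_div α (- y2 * f) (y1 * f)
  have e1 : d1 (-y2 * f) + d2 (y1 * f) = dT f := by
    simp only [dmul, dT_def, map_neg, d1_y2, d2_y1]; ring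
  rw [e1] at this
  rw [this, show Ci α (y1 * (-y2 * f) + y2 * (y1 * f)) = Ci α (0 : Fn ℓ) by congr 1; ring]
  simp

lemma exists_bound (f : Fn ℓ) (a b : ℝ) :
    ∃ C, ∀ α ∈ Set.Icc a b, ∀ y ∈ dsk, |ev (α, y.1, y.2) f| ≤ C := by
  have hK : IsCompact (Set.Icc a b ×ˢ dsk) := isCompact_Icc.prod dsk_compact
  obtain ⟨C, hC⟩ := hK.exists_bound_of_continuousOn (f := fun p => ev p f) (ev_cont f).continuousOn
  exact ⟨C, fun α hα y hy => hC (α, y) ⟨hα, hy⟩⟩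

lemma J_deriv (f : Fn ℓ) (α : ℝ) : HasDerivAt (fun α => J α f) (J α (d0 f)) α := by
  obtain ⟨C, hC⟩ := exists_bound (d0 f) (α - 1) (α + 1)
  have := hasDerivAt_integral_of_dominated_loc_of_deriv_le (μ := volume.restrict dsk)
    (F := fun α y => ev (α, y.1, y.2) f) (F' := fun α y => ev (α, y.1, y.2) (d0 f))
    (x₀ := α) (s := Set.Icc (α - 1) (α + 1)) (bound := fun _ => C)
    (Icc_mem_nhds (by linarith) (by linarith))
    (Eventually.of_forall fun x => (J_int x f).aestronglyMeasurable)
    (J_int α f) (J_int α (d0 f)).aestronglyMeasurable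
    ((ae_restrict_iff' dsk_meas).2 (Eventually.of_forall fun y hy x hx => hC x hx y hy))
    (by
      have : IsFiniteMeasure (volume.restrict dsk) := ⟨by
        rw [Measure.restrict_apply_univ]; exact dsk_compact.measure_lt_top⟩
      exact integrable_const _)
    (Eventually.of_forall fun y x hx => hasDerivAt_ev_α f x y.1 y.2)
  exact this.2

lemma J_cont (f : Fn ℓ) : Continuous (fun α => J α f) :=
  continuous_iff_continuousAt.2 fun α => (J_deriv f α).continuousAt

lemma J_per (f : Fn ℓ) (α : ℝ) : J (α + ℓ) f = J α f := by
  simp only [J_def, Fn.per]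

/-- integral over the solid torus -/
def II : Fn ℓ →ₗ[ℝ] ℝ where
  toFun f := ∫ α in (0:ℝ)..ℓ, J α f
  map_add' f g := by
    simp only [map_add]
    exact intervalIntegral.integral_add ((J_cont f).intervalIntegrable _ _)
      ((J_cont g).intervalIntegrable _ _)
  map_smul' c f := by
    simp only [map_smul]
    exact intervalIntegral.integral_smul c _
lemma II_def (f : Fn ℓ) : II f = ∫ α in (0:ℝ)..ℓ, J α f := rfl

lemma II_mono' (hℓ : 0 ≤ ℓ) (f g : Fn ℓ) (h : ∀ α, J α f ≤ J α g) : II f ≤ II g :=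
  intervalIntegral.integral_mono_on hℓ ((J_cont f).intervalIntegrable _ _)
      ((J_cont g).intervalIntegrable _ _) (fun α _ => h α)

lemma II_d0 (f : Fn ℓ) : II (d0 f) = 0 := by
  rw [II_def, intervalIntegral.integral_eq_sub_of_hasDerivAt (fun α _ => J_deriv f α)
    ((J_cont _).intervalIntegrable _ _)]
  have := J_per f 0
  rw [zero_add] at this
  rw [this, sub_self]

end

section

variable {ℓ : ℝ}

/-- squared Sobolev norms on disk slices -/
def NN : ℕ → ℝ → Fn ℓ → ℝ
  | 0, α, u => J α (u ^ 2)
  | (m + 1), α, u => NN m α u + NN m α (d1 u) + NN m α (d2 u)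

lemma NN_zero (α : ℝ) (u : Fn ℓ) : NN 0 α u = J α (u ^ 2) := rfl
lemma NN_succ (m : ℕ) (α : ℝ) (u : Fn ℓ) :
    NN (m + 1) α u = NN m α u + NN m α (d1 u) + NN m α (d2 u) := rfl

lemma J_nonneg (α : ℝ) (f : Fn ℓ) (h : ∀ a b : ℝ, a ^ 2 + b ^ 2 ≤ 1 → 0 ≤ ev (α, a, b) f) :
    0 ≤ J α f := by
  have := J_mono α 0 f (by simpa using h)
  simpa using this

lemma J_sq_nonneg (α : ℝ) (f : Fn ℓ) : 0 ≤ J α (f ^ 2) :=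
  J_nonneg _ _ fun a b _ => by rw [map_pow]; positivity

lemma NN_nonneg (m : ℕ) : ∀ (α : ℝ) (u : Fn ℓ), 0 ≤ NN m α u := by
  induction m with
  | zero => intro α u; exact J_sq_nonneg α u
  | succ m ih => intro α u; rw [NN_succ]; linarith [ih α u, ih α (d1 u), ih α (d2 u)]

lemma NN_le_succ (m : ℕ) (α : ℝ) (u : Fn ℓ) : NN m α u ≤ NN (m + 1) α u := by
  rw [NN_succ]; linarith [NN_nonneg m α (d1 u), NN_nonneg m α (d2 u)]
lemma NN_mono {m n : ℕ} (h : m ≤ n) (α : ℝ) (u : Fn ℓ) : NN m α u ≤ NN n α u := by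
  induction n, h using Nat.le_induction with
  | base => exact le_rfl
  | succ n _ ih => exact ih.trans (NN_le_succ n α u)
lemma NN_d1 (m : ℕ) (α : ℝ) (u : Fn ℓ) : NN m α (d1 u) ≤ NN (m + 1) α u := by
  rw [NN_succ]; linarith [NN_nonneg m α (d2 u), NN_nonneg m α u]
lemma NN_d2 (m : ℕ) (α : ℝ) (u : Fn ℓ) : NN m α (d2 u) ≤ NN (m + 1) α u := by
  rw [NN_succ]; linarith [NN_nonneg m α (d1 u), NN_nonneg m α u]

lemma NN_add (m : ℕ) : ∀ (α : ℝ) (u v : Fn ℓ), NN m α (u + v) ≤ 2 * NN m α u + 2 * NN m α v := by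
  induction m with
  | zero =>
    intro α u v
    have := J_mono α ((u + v) ^ 2) ((2 : ℝ) • u ^ 2 + (2 : ℝ) • v ^ 2) (fun a b _ => by
      simp only [map_add, map_pow, map_smul, smul_eq_mul]
      nlinarith [sq_nonneg (ev (α, a, b) u - ev (α, a, b) v)])
    simpa [NN_zero] using this
  | succ m ih =>
    intro α u v
    simp only [NN_succ, map_add]
    linarith [ih α u v, ih α (d1 u) (d1 v), ih α (d2 u) (d2 v)]

lemma NN_smul (m : ℕ) : ∀ (α : ℝ) (c : ℝ) (u : Fn ℓ), NN m α (c • u) = c ^ 2 * NN m α u := by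
  induction m with
  | zero =>
    intro α c u
    rw [NN_zero, NN_zero, smul_pow, map_smul, smul_eq_mul]
  | succ m ih =>
    intro α c u
    simp only [NN_succ, Derivation.map_smul, ih]; ring

lemma NN_neg (m : ℕ) (α : ℝ) (u : Fn ℓ) : NN m α (-u) = NN m α u := by
  rw [← neg_one_smul ℝ u, NN_smul]; ring

lemma NN_sub (m : ℕ) (α : ℝ) (u v : Fn ℓ) : NN m α (u - v) ≤ 2 * NN m α u + 2 * NN m α v := by
  rw [sub_eq_add_neg]
  have := NN_add m α u (-v)
  rwa [NN_neg] at this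

/-- vanishing on a closed disk slice -/
def ZS (α : ℝ) (u : Fn ℓ) : Prop := ∀ a b : ℝ, a ^ 2 + b ^ 2 ≤ 1 → ev (α, a, b) u = 0

lemma ZS_of_open {α : ℝ} {u : Fn ℓ} (h : ∀ a b : ℝ, a ^ 2 + b ^ 2 < 1 → ev (α, a, b) u = 0) :
    ZS α u := by
  intro a b hab
  have hc : Continuous (fun s : ℝ => ev (α, s * a, s * b) u) := ev_cont_comp u (by fun_prop)
  have h1 : Tendsto (fun s : ℝ => ev (α, s * a, s * b) u) (𝓝[<] 1) (𝓝 (ev (α, 1 * a, 1 * b) u)) :=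
    (hc.tendsto 1).mono_left nhdsWithin_le_nhds
  have h2 : Tendsto (fun s : ℝ => ev (α, s * a, s * b) u) (𝓝[<] 1) (𝓝 0) := by
    apply tendsto_const_nhds.congr'
    filter_upwards [Ioo_mem_nhdsLT (show (0:ℝ) < 1 by norm_num)] with s hs
    rw [h]
    have : (s * a) ^ 2 + (s * b) ^ 2 = s ^ 2 * (a ^ 2 + b ^ 2) := by ring
    rw [this]
    nlinarith [hs.1, hs.2]
  simpa using tendsto_nhds_unique h1 h2

lemma ZS_d1 {α : ℝ} {u : Fn ℓ} (h : ZS α u) : ZS α (d1 u) := by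
  apply ZS_of_open
  intro a b hab
  have h0 : (fun a => ev (α, a, b) u) =ᶠ[𝓝 a] fun _ => 0 := by
    have hc : Continuous (fun a : ℝ => a ^ 2 + b ^ 2) := by fun_prop
    filter_upwards [hc.continuousAt.eventually_lt continuousAt_const hab] with x hx
    exact h x b hx.le
  exact (hasDerivAt_ev_1 u α a b).unique ((hasDerivAt_const a (0:ℝ)).congr_of_eventuallyEq h0)
lemma ZS_d2 {α : ℝ} {u : Fn ℓ} (h : ZS α u) : ZS α (d2 u) := by
  apply ZS_of_open
  intro a b hab
  have h0 : (fun b => ev (α, a, b) u) =ᶠ[𝓝 b] fun _ => 0 := by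
    have hc : Continuous (fun b : ℝ => a ^ 2 + b ^ 2) := by fun_prop
    filter_upwards [hc.continuousAt.eventually_lt continuousAt_const hab] with x hx
    exact h a x hx.le
  exact (hasDerivAt_ev_2 u α a b).unique ((hasDerivAt_const b (0:ℝ)).congr_of_eventuallyEq h0)

lemma NN_ZS (m : ℕ) : ∀ {α : ℝ} {u : Fn ℓ}, ZS α u → NN m α u = 0 := by
  induction m with
  | zero =>
    intro α u h
    rw [NN_zero, J_congr α (u ^ 2) 0 (fun a b hab => by rw [map_pow, h a b hab]; simp)]
    simp
  | succ m ih => intro α u h; rw [NN_succ, ih h, ih (ZS_d1 h), ih (ZS_d2 h)]; simp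

/-- coefficient bounds -/
def Bd : ℕ → ℝ → ℝ → Fn ℓ → Prop
  | 0, M, α, q => ∀ a b : ℝ, a ^ 2 + b ^ 2 ≤ 1 → |ev (α, a, b) q| ≤ M
  | (m + 1), M, α, q => Bd m M α q ∧ Bd m M α (d1 q) ∧ Bd m M α (d2 q)

lemma NN_mul (m : ℕ) : ∃ C : ℝ, 0 ≤ C ∧ ∀ (M α : ℝ) (q u : Fn ℓ), Bd m M α q →
    NN m α (q * u) ≤ C * M ^ 2 * NN m α u := by
  induction m with
  | zero =>
    refine ⟨1, by norm_num, fun M α q u h => ?_⟩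
    have := J_mono α ((q * u) ^ 2) ((M ^ 2) • u ^ 2) (fun a b hab => by
      simp only [map_mul, map_pow, map_smul, smul_eq_mul, mul_pow]
      have h1 := h a b hab
      have h2 : (ev (α, a, b) q) ^ 2 ≤ M ^ 2 := sq_le_sq' (by linarith [neg_abs_le (ev (α, a, b) q)]) (by linarith [le_abs_self (ev (α, a, b) q)])
      nlinarith [sq_nonneg (ev (α, a, b) u)])
    simpa [NN_zero] using this
  | succ m ih =>
    obtain ⟨C, hC, ih⟩ := ih
    refine ⟨5 * C, by positivity, fun M α q u h => ?_⟩
    obtain ⟨h0, h1, h2⟩ := h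
    simp only [NN_succ, dmul]
    have a0 := ih M α q u h0
    have a1 := ih M α q (d1 u) h0
    have a2 := ih M α q (d2 u) h0
    have a3 := ih M α (d1 q) u h1
    have a4 := ih M α (d2 q) u h2
    have b1 := NN_add m α (q * d1 u) (u * d1 q)
    have b2 := NN_add m α (q * d2 u) (u * d2 q)
    rw [mul_comm u] at b1 b2
    have n0 := NN_nonneg m α (d1 u)
    have n1 := NN_nonneg m α (d2 u)
    have hCM : 0 ≤ C * M ^ 2 := by positivity
    rw [mul_comm u, mul_comm u]
    nlinarith [mul_nonneg hCM n0, mul_nonneg hCM n1]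

lemma Bd_const (m : ℕ) : ∀ (α c : ℝ), |c| ≤ 1 → Bd m 1 α (algebraMap ℝ (Fn ℓ) c) := by
  induction m with
  | zero => intro α c hc a b _; rw [AlgHom.commutes]; exact hc
  | succ m ih =>
    intro α c hc
    refine ⟨ih α c hc, ?_, ?_⟩
    · rw [Derivation.map_algebraMap]; simpa using ih α 0 (by simp)
    · rw [Derivation.map_algebraMap]; simpa using ih α 0 (by simp)

lemma Bd_y1 (m : ℕ) (α : ℝ) : Bd m 1 α (y1 : Fn ℓ) := by
  induction m with
  | zero => intro a b h; rw [ev_y1]; simp; apply abs_le_one_iff_mul_self_le_one.2; nlinarith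
  | succ m ih =>
    refine ⟨ih, ?_, ?_⟩
    · rw [d1_y1]; simpa using Bd_const (ℓ := ℓ) m α 1 (by simp)
    · rw [d2_y1]; simpa using Bd_const (ℓ := ℓ) m α 0 (by simp)
lemma Bd_y2 (m : ℕ) (α : ℝ) : Bd m 1 α (y2 : Fn ℓ) := by
  induction m with
  | zero => intro a b h; rw [ev_y2]; simp; apply abs_le_one_iff_mul_self_le_one.2; nlinarith
  | succ m ih =>
    refine ⟨ih, ?_, ?_⟩
    · rw [d1_y2]; simpa using Bd_const (ℓ := ℓ) m α 0 (by simp)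
    · rw [d2_y2]; simpa using Bd_const (ℓ := ℓ) m α 1 (by simp)

/-- families with bounded Sobolev norms -/
def NB {ι : Type*} (F : Filter ι) (a E : ι → ℝ) (m : ℕ) (w : ι → Fn ℓ) : Prop :=
  ∃ C : ℝ, ∀ᶠ i in F, NN m (a i) (w i) ≤ C * E i

section NB
variable {ι : Type*} {F : Filter ι} {a E : ι → ℝ} {m : ℕ} {w v : ι → Fn ℓ}

lemma NB.add (h : NB F a E m w) (h' : NB F a E m v) : NB F a E m (fun i => w i + v i) := by
  obtain ⟨C, h⟩ := h; obtain ⟨C', h'⟩ := h'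
  refine ⟨2 * C + 2 * C', ?_⟩
  filter_upwards [h, h'] with i h1 h2
  linarith [NN_add m (a i) (w i) (v i)]
lemma NB.sub (h : NB F a E m w) (h' : NB F a E m v) : NB F a E m (fun i => w i - v i) := by
  obtain ⟨C, h⟩ := h; obtain ⟨C', h'⟩ := h'
  refine ⟨2 * C + 2 * C', ?_⟩
  filter_upwards [h, h'] with i h1 h2
  linarith [NN_sub m (a i) (w i) (v i)]
lemma NB.mul_of_bd {q : ι → Fn ℓ} {M : ℝ} (hq : ∀ᶠ i in F, Bd m M (a i) (q i))
    (h : NB F a E m w) : NB F a E m (fun i => q i * w i) := by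
  obtain ⟨C, h⟩ := h
  obtain ⟨K, hK, hK'⟩ := NN_mul (ℓ := ℓ) m
  refine ⟨K * M ^ 2 * C, ?_⟩
  filter_upwards [h, hq] with i h1 h2
  have := hK' M (a i) (q i) (w i) h2
  have h3 : 0 ≤ K * M ^ 2 := by positivity
  nlinarith [mul_le_mul_of_nonneg_left h1 h3]
lemma NB.y1 (h : NB F a E m w) : NB F a E m (fun i => y1 * w i) :=
  NB.mul_of_bd (M := 1) (Eventually.of_forall fun i => Bd_y1 m (a i)) h
lemma NB.y2 (h : NB F a E m w) : NB F a E m (fun i => y2 * w i) :=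
  NB.mul_of_bd (M := 1) (Eventually.of_forall fun i => Bd_y2 m (a i)) h
lemma NB.smul (c : ℝ) (h : NB F a E m w) : NB F a E m (fun i => c • w i) := by
  obtain ⟨C, h⟩ := h
  refine ⟨c ^ 2 * C, ?_⟩
  filter_upwards [h] with i h1
  rw [NN_smul]; nlinarith [sq_nonneg c]
lemma NB.d1 (h : NB F a E (m + 1) w) : NB F a E m (fun i => d1 (w i)) := by
  obtain ⟨C, h⟩ := h
  exact ⟨C, h.mono fun i hi => (NN_d1 m _ _).trans hi⟩
lemma NB.d2 (h : NB F a E (m + 1) w) : NB F a E m (fun i => d2 (w i)) := by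
  obtain ⟨C, h⟩ := h
  exact ⟨C, h.mono fun i hi => (NN_d2 m _ _).trans hi⟩
lemma NB.mono {n : ℕ} (hmn : n ≤ m) (h : NB F a E m w) : NB F a E n w := by
  obtain ⟨C, h⟩ := h
  exact ⟨C, h.mono fun i hi => (NN_mono hmn _ _).trans hi⟩
lemma NB.succ (h : NB F a E m w) (h1 : NB F a E m (fun i => _root_.d1 (w i)))
    (h2 : NB F a E m (fun i => _root_.d2 (w i))) : NB F a E (m + 1) w := by
  obtain ⟨C, h⟩ := h; obtain ⟨C1, h1⟩ := h1; obtain ⟨C2, h2⟩ := h2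
  refine ⟨C + C1 + C2, ?_⟩
  filter_upwards [h, h1, h2] with i h h1 h2
  rw [NN_succ]; linarith
lemma NB.congr (h : NB F a E m w) (e : ∀ i, w i = v i) : NB F a E m v := by
  have : w = v := funext e
  rwa [← this]
lemma NB.dT (h : NB F a E (m + 1) w) : NB F a E m (fun i => dT (w i)) :=
  (h.d2.y1.sub h.d1.y2).congr fun i => (dT_def _).symm
lemma NB.dS (h : NB F a E (m + 1) w) : NB F a E m (fun i => dS (w i)) :=
  (h.d1.y1.add h.d2.y2).congr fun i => (dS_def _).symm
lemma NB.r2 (h : NB F a E m w) : NB F a E m (fun i => (_root_.y1 ^ 2 + _root_.y2 ^ 2) * w i) :=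
  (h.y1.y1.add h.y2.y2).congr fun i => by ring
end NB

/-- vanishing on the boundary circle -/
def CZ (α : ℝ) (u : Fn ℓ) : Prop := ∀ θ : ℝ, ev (α, cos θ, sin θ) u = 0

lemma CZ.dT {α : ℝ} {u : Fn ℓ} (h : CZ α u) : CZ α (dT u) := by
  intro θ
  have h1 := hasDerivAt_ev_θ u α 1 θ
  simp only [one_mul] at h1
  have : (fun θ => ev (α, cos θ, sin θ) u) = fun _ => 0 := funext h
  rw [this] at h1
  exact h1.unique (hasDerivAt_const θ 0)

/-- boundary condition (Dirichlet or Neumann) -/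
def BC (α : ℝ) (u : Fn ℓ) : Prop := CZ α u ∨ CZ α (dS u)

lemma BC.dT {α : ℝ} {u : Fn ℓ} (h : BC α u) : BC α (dT u) := by
  rcases h with h | h
  · exact Or.inl h.dT
  · right; rw [dST]; exact h.dT

lemma energy_id (α : ℝ) (u v : Fn ℓ) :
    J α (d1 v * d1 u + d2 v * d2 u) + J α (v * Lap u) = Ci α (v * dS u) := by
  have := J_div α (v * d1 u) (v * d2 u)
  have e1 : d1 (v * d1 u) + d2 (v * d2 u) = (d1 v * d1 u + d2 v * d2 u) + v * Lap u := by
    simp only [dmul, Lap]; ring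
  rw [e1, map_add] at this
  rw [this, dS_def]; congr 1; ring

lemma Ci_CZ {α : ℝ} {u : Fn ℓ} (h : CZ α u) : Ci α u = 0 := by
  rw [Ci_congr α u 0 (fun θ => by rw [h θ]; simp)]; simp

lemma CZ.mul_left {α : ℝ} {u : Fn ℓ} (h : CZ α u) (v : Fn ℓ) : CZ α (v * u) := fun θ => by
  rw [map_mul, h θ, mul_zero]
lemma CZ.mul_right {α : ℝ} {u : Fn ℓ} (h : CZ α u) (v : Fn ℓ) : CZ α (u * v) := fun θ => by
  rw [map_mul, h θ, zero_mul]

lemma energy_bc {α : ℝ} {u : Fn ℓ} (h : BC α u) :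
    J α (d1 u ^ 2) + J α (d2 u ^ 2) = - J α (u * Lap u) := by
  have := energy_id α u u
  have h0 : CZ α (u * dS u) := by
    rcases h with h | h
    · exact h.mul_right _
    · exact h.mul_left _
  rw [Ci_CZ h0, map_add] at this
  rw [sq, sq]; linarith

lemma reilly_id (α : ℝ) (u : Fn ℓ) :
    J α (Lap u ^ 2) = J α (d1 (d1 u) ^ 2) + 2 * J α (d1 (d2 u) ^ 2) + J α (d2 (d2 u) ^ 2)
      + Ci α (d1 u * dT (d2 u) - d2 u * dT (d1 u)) := by
  have := J_div α (d1 u * d2 (d2 u) - d2 u * d1 (d2 u)) (d2 u * d1 (d1 u) - d1 u * d1 (d2 u))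
  have e1 : d1 (d1 u * d2 (d2 u) - d2 u * d1 (d2 u)) + d2 (d2 u * d1 (d1 u) - d1 u * d1 (d2 u))
      = Lap u ^ 2 - (d1 (d1 u) ^ 2 + (2:ℝ) • d1 (d2 u) ^ 2 + d2 (d2 u) ^ 2) := by
    have : (2:ℝ) • d1 (d2 u) ^ 2 = 2 * d1 (d2 u) ^ 2 := by rw [two_smul, two_mul]
    rw [this]
    simp only [map_sub, dmul, Lap, d21]; ring
  rw [e1, map_sub, map_add, map_add, map_smul, smul_eq_mul] at this
  have e2 : y1 * (d1 u * d2 (d2 u) - d2 u * d1 (d2 u)) + y2 * (d2 u * d1 (d1 u) - d1 u * d1 (d2 u))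
     = d1 u * dT (d2 u) - d2 u * dT (d1 u) := by
    simp only [dT_def, d21]; ring
  rw [e2] at this
  linarith

lemma reilly_bdry {α : ℝ} {u : Fn ℓ} (h : BC α u) :
    0 ≤ Ci α (d1 u * dT (d2 u) - d2 u * dT (d1 u)) := by
  have key : (y1 ^ 2 + y2 ^ 2) * (d1 u * dT (d2 u) - d2 u * dT (d1 u)) =
      dS u ^ 2 + dT u ^ 2 + dS u * dT (dT u) - dT u * dT (dS u) := by
    simp only [dT_def, dS_def, map_add, map_sub, dmul, d21, d1_y1, d1_y2, d2_y1, d2_y2]; ring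
  have : Ci α (0 : Fn ℓ) ≤ Ci α (d1 u * dT (d2 u) - d2 u * dT (d1 u)) := by
    apply Ci_mono
    intro θ
    have k := congrArg (ev (α, cos θ, sin θ)) key
    simp only [map_mul, map_add, map_pow, ev_y1, ev_y2, cos_sq_add_sin_sq, one_mul] at k
    rw [k, map_zero]
    simp only [map_sub, map_add, map_mul, map_pow]
    rcases h with h | h
    · rw [h.dT θ, h.dT.dT θ]; nlinarith [sq_nonneg (ev (α, cos θ, sin θ) (dS u))]
    · rw [h θ, h.dT θ]; nlinarith [sq_nonneg (ev (α, cos θ, sin θ) (dT u))]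
  simpa using this

lemma hess_le {α : ℝ} {u : Fn ℓ} (h : BC α u) :
    J α (d1 (d1 u) ^ 2) + 2 * J α (d1 (d2 u) ^ 2) + J α (d2 (d2 u) ^ 2) ≤ J α (Lap u ^ 2) := by
  linarith [reilly_id α u, reilly_bdry h]

lemma J_amgm (α t : ℝ) (ht : 0 < t) (u v : Fn ℓ) : |J α (u * v)| ≤ t * J α (u ^ 2) + t⁻¹ * J α (v ^ 2) := by
  have h1 := J_mono α (u * v) (t • u ^ 2 + t⁻¹ • v ^ 2) (fun a b hab => by
    simp only [map_mul, map_add, map_pow, map_smul, smul_eq_mul]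
    set x := ev (α, a, b) u
    set y := ev (α, a, b) v
    have : 0 ≤ t⁻¹ * ((t * x - y) ^ 2 + (t * x) ^ 2 + y ^ 2) / 2 := by positivity
    have e : t⁻¹ * ((t * x - y) ^ 2 + (t * x) ^ 2 + y ^ 2) / 2 = t * x ^ 2 + t⁻¹ * y ^ 2 - x * y := by
      field_simp; ring
    linarith)
  have h2 := J_mono α (-(t • u ^ 2 + t⁻¹ • v ^ 2)) (u * v) (fun a b hab => by
    simp only [map_neg, map_mul, map_add, map_pow, map_smul, smul_eq_mul]
    set x := ev (α, a, b) u
    set y := ev (α, a, b) v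
    have : 0 ≤ t⁻¹ * ((t * x + y) ^ 2 + (t * x) ^ 2 + y ^ 2) / 2 := by positivity
    have e : t⁻¹ * ((t * x + y) ^ 2 + (t * x) ^ 2 + y ^ 2) / 2 = t * x ^ 2 + t⁻¹ * y ^ 2 + x * y := by
      field_simp; ring
    linarith)
  simp only [map_neg, map_add, map_smul, smul_eq_mul] at h1 h2
  exact abs_le.2 ⟨by linarith, by linarith⟩

lemma NN_two (α : ℝ) (u : Fn ℓ) : NN 2 α u = J α (u ^ 2) + 2 * (J α (d1 u ^ 2) + J α (d2 u ^ 2))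
    + (J α (d1 (d1 u) ^ 2) + 2 * J α (d1 (d2 u) ^ 2) + J α (d2 (d2 u) ^ 2)) := by
  simp only [NN_succ, NN_zero, d21]; ring

lemma reg0 {α : ℝ} {u : Fn ℓ} (h : BC α u) : NN 2 α u ≤ 3 * (NN 0 α (Lap u) + NN 0 α u) := by
  rw [NN_two, NN_zero, NN_zero]
  have h1 := hess_le h
  have h2 := energy_bc h
  have h3 := J_amgm α 1 one_pos u (Lap u)
  have h4 := neg_abs_le (J α (u * Lap u))
  norm_num at h3
  linarith

lemma reg (m : ℕ) : ∃ C : ℝ, ∀ (α : ℝ) (u : Fn ℓ), BC α u →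
    NN (m + 2) α u ≤ C * (NN m α (Lap u) + NN 0 α u) := by
  induction m with
  | zero => exact ⟨3, fun α u h => reg0 h⟩
  | succ m ih =>
    obtain ⟨C, hC⟩ := ih
    let ι := {x : ℝ × Fn ℓ // BC x.1 x.2}
    let a : ι → ℝ := fun i => i.1.1
    let U : ι → Fn ℓ := fun i => i.1.2
    let E : ι → ℝ := fun i => NN (m + 1) (a i) (Lap (U i)) + NN 0 (a i) (U i)
    have P : ∀ w : ι → Fn ℓ, (∀ i, BC (a i) (w i)) → NB ⊤ a E m (fun i => Lap (w i)) →
        NB ⊤ a E 0 w → NB ⊤ a E (m + 2) w := by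
      rintro w hw ⟨C1, h1⟩ ⟨C2, h2⟩
      refine ⟨|C| * (C1 + C2), ?_⟩
      filter_upwards [h1, h2] with i h1 h2
      have := hC (a i) (w i) (hw i)
      have h0 : 0 ≤ NN m (a i) (Lap (w i)) + NN 0 (a i) (w i) := by
        linarith [NN_nonneg m (a i) (Lap (w i)), NN_nonneg 0 (a i) (w i)]
      calc _ ≤ _ := this
        _ ≤ |C| * (NN m (a i) (Lap (w i)) + NN 0 (a i) (w i)) := by
          gcongr; exact le_abs_self C
        _ ≤ |C| * (C1 * E i + C2 * E i) := by gcongr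
        _ = _ := by ring
    have hf : NB ⊤ a E (m + 1) (fun i => Lap (U i)) := ⟨1, Eventually.of_forall fun i => by
      simp only [E]; linarith [NN_nonneg 0 (a i) (U i)]⟩
    have hu0 : NB ⊤ a E 0 U := ⟨1, Eventually.of_forall fun i => by
      simp only [E]; linarith [NN_nonneg (m+1) (a i) (Lap (U i))]⟩
    have hu : NB ⊤ a E (m + 2) U := P U (fun i => i.2) (hf.mono (by omega)) hu0
    have hT : NB ⊤ a E (m + 2) (fun i => dT (U i)) :=
      P _ (fun i => i.2.dT) (hf.dT.congr fun i => (Lap_dT _).symm) ((hu.mono (by omega : 1 ≤ m + 2)).dT)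
    have cz : ∀ (α : ℝ) (v : Fn ℓ), CZ α ((1 - (y1 ^ 2 + y2 ^ 2)) * v) := fun α v θ => by
      simp
    have hv1 : NB ⊤ a E (m + 2) (fun i => (1 - (y1 ^ 2 + y2 ^ 2)) * d1 (U i)) := by
      refine P _ (fun i => Or.inl (cz _ _)) ?_ ?_
      · refine (((hf.d1.sub hf.d1.r2).sub ((hu.d1.dS.smul 4))).sub ((hu.mono (by omega : m + 1 ≤ m + 2)).d1.smul 4)).congr fun i => ?_
        simp only [Lap, dS_def, map_sub, map_add, dmul, pow_two, d21, d1_y1, d1_y2, d2_y1, d2_y2, Derivation.map_one_eq_zero, map_zero, show (4:ℝ) = 1 + 1 + 1 + 1 by norm_num, add_smul, one_smul]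
        ring
      · have := (hu.mono (by omega : 1 ≤ m + 2)).d1
        exact (this.sub this.r2).congr fun i => by ring
    have hv2 : NB ⊤ a E (m + 2) (fun i => (1 - (y1 ^ 2 + y2 ^ 2)) * d2 (U i)) := by
      refine P _ (fun i => Or.inl (cz _ _)) ?_ ?_
      · refine (((hf.d2.sub hf.d2.r2).sub ((hu.d2.dS.smul 4))).sub ((hu.mono (by omega : m + 1 ≤ m + 2)).d2.smul 4)).congr fun i => ?_
        simp only [Lap, dS_def, map_sub, map_add, dmul, pow_two, d21, d1_y1, d1_y2, d2_y1, d2_y2, Derivation.map_one_eq_zero, map_zero, show (4:ℝ) = 1 + 1 + 1 + 1 by norm_num, add_smul, one_smul]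
        ring
      · have := (hu.mono (by omega : 1 ≤ m + 2)).d2
        exact (this.sub this.r2).congr fun i => by ring
    have hSS : NB ⊤ a E (m + 1) (fun i => dS (dS (U i))) :=
      (hf.r2.sub hT.dT).congr fun i => (dSS _).symm
    have hTS : NB ⊤ a E (m + 1) (fun i => dT (dS (U i))) :=
      hT.dS.congr fun i => dST _
    have hu1 := hu.d1
    have hu2 := hu.d2
    have hS : NB ⊤ a E (m + 2) (fun i => dS (U i)) := by
      refine NB.succ hu.dS ?_ ?_
      · refine (((hv1.mono (by omega : m + 1 ≤ m + 2)).add (hv1.dS.add (hu1.r2.smul 2))).add (hSS.y1.sub hTS.y2)).congr fun i => ?_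
        simp only [← r2d1]
        simp only [Lap, dS_def, map_sub, map_add, dmul, pow_two, d21, d1_y1, d1_y2, d2_y1, d2_y2, Derivation.map_one_eq_zero, map_zero, two_smul]
        ring
      · refine (((hv2.mono (by omega : m + 1 ≤ m + 2)).add (hv2.dS.add (hu2.r2.smul 2))).add (hSS.y2.add hTS.y1)).congr fun i => ?_
        simp only [← r2d2]
        simp only [Lap, dS_def, map_sub, map_add, dmul, pow_two, d21, d1_y1, d1_y2, d2_y1, d2_y2, Derivation.map_one_eq_zero, map_zero, two_smul]
        ring
    have hd1 : NB ⊤ a E (m + 2) (fun i => d1 (U i)) :=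
      (hv1.add (hS.y1.sub hT.y2)).congr fun i => by
        simp only [← r2d1]; ring
    have hd2 : NB ⊤ a E (m + 2) (fun i => d2 (U i)) :=
      (hv2.add (hS.y2.add hT.y1)).congr fun i => by
        simp only [← r2d2]; ring
    obtain ⟨C', hC'⟩ := NB.succ hu hd1 hd2
    rw [Filter.eventually_top] at hC'
    exact ⟨C', fun α u h => hC' ⟨(α, u), h⟩⟩

end

section

variable {ℓ : ℝ}

lemma cs_int {h : ℝ → ℝ} (hc : Continuous h) {s t : ℝ} (hst : s ≤ t) :
    (∫ x in s..t, h x) ^ 2 ≤ (t - s) * ∫ x in s..t, (h x) ^ 2 := by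
  rcases hst.eq_or_lt with rfl | hlt
  · simp
  set A := ∫ x in s..t, h x
  have hpos : 0 < t - s := by linarith
  set c := A / (t - s) with hcdef
  have h0 : 0 ≤ ∫ x in s..t, (h x - c) ^ 2 :=
    intervalIntegral.integral_nonneg hst (fun x _ => sq_nonneg _)
  have h1 : ∫ x in s..t, (h x - c) ^ 2 = (∫ x in s..t, (h x) ^ 2) - 2 * c * A + c ^ 2 * (t - s) := by
    have e : ∀ x, (h x - c) ^ 2 = (h x) ^ 2 - (2 * c) * h x + c ^ 2 := fun x => by ring
    simp only [e]
    rw [intervalIntegral.integral_add, intervalIntegral.integral_sub, intervalIntegral.integral_const_mul]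
    · simp; ring
    all_goals apply Continuous.intervalIntegrable; fun_prop
  have h2 : A = c * (t - s) := by rw [hcdef]; field_simp
  rw [h1] at h0
  have h3 : 0 ≤ (∫ x in s..t, (h x) ^ 2) - c ^ 2 * (t - s) := by
    calc 0 ≤ _ := h0
      _ = _ := by rw [h2]; ring
  calc A ^ 2 = (t - s) * (c ^ 2 * (t - s)) := by rw [h2]; ring
    _ ≤ _ := by gcongr; linarith

lemma oneD {g g' : ℝ → ℝ} (hg : ∀ x, HasDerivAt g (g' x) x) (hc : Continuous g') {a b s t : ℝ}
    (hs : s ∈ Set.Icc a b) (ht : t ∈ Set.Icc a b) :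
    (g t - g s) ^ 2 ≤ (b - a) * ∫ x in a..b, (g' x) ^ 2 := by
  wlog hst : s ≤ t generalizing s t
  · have := this ht hs (le_of_not_ge hst)
    calc _ = (g s - g t) ^ 2 := by ring
      _ ≤ _ := this
  have h1 : ∫ x in s..t, g' x = g t - g s :=
    intervalIntegral.integral_eq_sub_of_hasDerivAt (fun x _ => hg x) (hc.intervalIntegrable _ _)
  rw [← h1]
  have h2 := cs_int hc hst
  have h3 : ∫ x in s..t, (g' x) ^ 2 ≤ ∫ x in a..b, (g' x) ^ 2 :=
    intervalIntegral.integral_mono_interval hs.1 hst ht.2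
      (Eventually.of_forall fun x => sq_nonneg _) ((hc.pow 2).intervalIntegrable _ _)
  have h4 : 0 ≤ ∫ x in s..t, (g' x) ^ 2 := intervalIntegral.integral_nonneg hst (fun x _ => sq_nonneg _)
  calc _ ≤ _ := h2
    _ ≤ (b - a) * ∫ x in a..b, (g' x) ^ 2 := by
      apply mul_le_mul _ h3 h4 _ <;> linarith [hs.1, ht.2, hs.2]

lemma oneD_sob {g g' : ℝ → ℝ} (hg : ∀ x, HasDerivAt g (g' x) x) (hc : Continuous g') {a b t : ℝ}
    (hab : a < b) (ht : t ∈ Set.Icc a b) :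
    (g t) ^ 2 ≤ (2 / (b - a) + 2 * (b - a)) * ∫ x in a..b, ((g x) ^ 2 + (g' x) ^ 2) := by
  have hgc : Continuous g := continuous_iff_continuousAt.2 fun x => (hg x).continuousAt
  set D := ∫ x in a..b, (g' x) ^ 2 with hD
  set G := ∫ x in a..b, (g x) ^ 2 with hG
  have hpos : 0 < b - a := by linarith
  have hD0 : 0 ≤ D := intervalIntegral.integral_nonneg hab.le (fun x _ => sq_nonneg _)
  have hG0 : 0 ≤ G := intervalIntegral.integral_nonneg hab.le (fun x _ => sq_nonneg _)
  have h1 : ∫ x in a..b, (g t) ^ 2 ≤ ∫ x in a..b, (2 * (g x) ^ 2 + 2 * ((b - a) * D)) := by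
    apply intervalIntegral.integral_mono_on hab.le
    · simp
    · apply Continuous.intervalIntegrable; fun_prop
    · intro x hx
      have := oneD hg hc hx ht
      nlinarith [sq_nonneg (g t - 2 * g x)]
  rw [intervalIntegral.integral_add, intervalIntegral.integral_const_mul] at h1
  · rw [intervalIntegral.integral_add]
    · rw [← hD, ← hG] at *
      simp only [intervalIntegral.integral_const, smul_eq_mul] at h1
      have : (g t) ^ 2 ≤ 2 / (b - a) * G + 2 * (b - a) * D := by
        rw [← mul_le_mul_iff_right₀ hpos]
        calc _ ≤ _ := h1
          _ = _ := by field_simp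
      have h5 : 0 ≤ 2 / (b - a) * D := by positivity
      have h6 : 0 ≤ 2 * (b - a) * G := by positivity
      nlinarith
    all_goals apply Continuous.intervalIntegrable; fun_prop
  all_goals apply Continuous.intervalIntegrable; fun_prop

lemma rect_sob {g gx gy gxy : ℝ → ℝ → ℝ}
    (hx : ∀ s t, HasDerivAt (fun s => g s t) (gx s t) s)
    (hy : ∀ s t, HasDerivAt (fun t => g s t) (gy s t) t)
    (hxy : ∀ s t, HasDerivAt (fun t => gx s t) (gxy s t) t)
    (c0 : Continuous (fun p : ℝ × ℝ => g p.1 p.2)) (cx : Continuous (fun p : ℝ × ℝ => gx p.1 p.2))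
    (cy : Continuous (fun p : ℝ × ℝ => gy p.1 p.2)) (cxy : Continuous (fun p : ℝ × ℝ => gxy p.1 p.2))
    {a b c d : ℝ} (hab : a < b) (hcd : c < d) {x y : ℝ} (hx' : x ∈ Set.Icc a b) (hy' : y ∈ Set.Icc c d) :
    (g x y) ^ 2 ≤ (2 / (b - a) + 2 * (b - a)) * (2 / (d - c) + 2 * (d - c)) *
      ∫ s in a..b, ∫ t in c..d, ((g s t) ^ 2 + (gy s t) ^ 2 + ((gx s t) ^ 2 + (gxy s t) ^ 2)) := by
  have sl : ∀ {h : ℝ → ℝ → ℝ}, Continuous (fun p : ℝ × ℝ => h p.1 p.2) → ∀ s, Continuous (h s) :=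
    fun hh s => hh.comp (Continuous.prodMk_right s)
  have sl' : ∀ {h : ℝ → ℝ → ℝ}, Continuous (fun p : ℝ × ℝ => h p.1 p.2) → ∀ t, Continuous (fun s => h s t) :=
    fun hh t => hh.comp (Continuous.prodMk_left t)
  have h1 := oneD_sob (g := fun s => g s y) (g' := fun s => gx s y) (fun s => hx s y)
    (sl' cx y) hab hx'
  have hk1 : 0 ≤ 2 / (b - a) + 2 * (b - a) := by
    have : 0 < b - a := by linarith
    positivity
  have h2 : ∫ s in a..b, ((g s y) ^ 2 + (gx s y) ^ 2) ≤ ∫ s in a..b, (2 / (d - c) + 2 * (d - c)) *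
      ∫ t in c..d, ((g s t) ^ 2 + (gy s t) ^ 2 + ((gx s t) ^ 2 + (gxy s t) ^ 2)) := by
    apply intervalIntegral.integral_mono_on hab.le
    · apply Continuous.intervalIntegrable
      exact ((sl' c0 y).pow 2).add ((sl' cx y).pow 2)
    · apply Continuous.intervalIntegrable
      apply continuous_const.mul
      apply intervalIntegral.continuous_parametric_intervalIntegral_of_continuous'
      exact ((c0.pow 2).add (cy.pow 2)).add ((cx.pow 2).add (cxy.pow 2))
    · intro s hs
      have a1 := oneD_sob (g := fun t => g s t) (g' := fun t => gy s t) (fun t => hy s t)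
        (sl cy s) hcd hy'
      have a2 := oneD_sob (g := fun t => gx s t) (g' := fun t => gxy s t) (fun t => hxy s t)
        (sl cxy s) hcd hy'
      rw [intervalIntegral.integral_add (f := fun t => (g s t) ^ 2 + (gy s t) ^ 2)]
      · linarith
      · exact (((sl c0 s).pow 2).add ((sl cy s).pow 2)).intervalIntegrable _ _
      · exact (((sl cx s).pow 2).add ((sl cxy s).pow 2)).intervalIntegrable _ _
  rw [intervalIntegral.integral_const_mul] at h2
  calc _ ≤ _ := h1
    _ ≤ _ := mul_le_mul_of_nonneg_left h2 hk1
    _ = _ := by ring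

lemma J_one (α : ℝ) : J α (1 : Fn ℓ) = π := by
  have := J_dS α (1 : Fn ℓ)
  have e : dS (1 : Fn ℓ) + 2 * 1 = (2:ℝ) • (1 : Fn ℓ) := by
    simp [two_smul]; norm_num
  rw [e, map_smul, Ci_def] at this
  simp at this
  linarith

lemma J_cs (α : ℝ) (f : Fn ℓ) : (J α f) ^ 2 ≤ π * J α (f ^ 2) := by
  have h := J_sq_nonneg α (f - (J α f / π) • 1)
  have e : (f - (J α f / π) • 1) ^ 2 = f ^ 2 - (2 * (J α f / π)) • f + ((J α f / π) ^ 2) • (1 : Fn ℓ) := by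
    apply Fn.ext'
    intro p
    simp only [map_pow, map_sub, map_add, map_smul, smul_eq_mul, map_one]; ring
  rw [e, map_add, map_sub, map_smul, map_smul, J_one, smul_eq_mul, smul_eq_mul] at h
  have hp := pi_pos
  have : J α (f ^ 2) - 2 * (J α f / π) * J α f + (J α f / π) ^ 2 * π = J α (f ^ 2) - (J α f) ^ 2 / π := by
    field_simp; ring
  rw [this] at h
  have h2 : (J α f) ^ 2 / π ≤ J α (f ^ 2) := by linarith
  rw [div_le_iff₀ hp] at h2
  linarith

/-- gradient and hessian energy -/
def GH (α : ℝ) (u : Fn ℓ) : ℝ := J α (d1 u ^ 2) + J α (d2 u ^ 2) +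
  (J α (d1 (d1 u) ^ 2) + 2 * J α (d1 (d2 u) ^ 2) + J α (d2 (d2 u) ^ 2))

lemma GH_nonneg (α : ℝ) (u : Fn ℓ) : 0 ≤ GH α u := by
  have := J_sq_nonneg α (d1 u)
  have := J_sq_nonneg α (d2 u)
  have := J_sq_nonneg α (d1 (d1 u))
  have := J_sq_nonneg α (d1 (d2 u))
  have := J_sq_nonneg α (d2 (d2 u))
  unfold GH; linarith

lemma cs2 {x y a b : ℝ} (h : x ^ 2 + y ^ 2 ≤ 1) : (x * a + y * b) ^ 2 ≤ a ^ 2 + b ^ 2 := by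
  have h1 : (x * a + y * b) ^ 2 ≤ (x ^ 2 + y ^ 2) * (a ^ 2 + b ^ 2) := by
    nlinarith [sq_nonneg (x * b - y * a)]
  nlinarith [sq_nonneg a, sq_nonneg b]

lemma J_dS_sq (α : ℝ) (u : Fn ℓ) : J α (dS u ^ 2) ≤ J α (d1 u ^ 2) + J α (d2 u ^ 2) := by
  rw [← map_add]
  apply J_mono
  intro a b hab
  simp only [dS_def, map_pow, map_add, map_mul, ev_y1, ev_y2]
  exact cs2 hab
lemma J_dT_sq (α : ℝ) (u : Fn ℓ) : J α (dT u ^ 2) ≤ J α (d1 u ^ 2) + J α (d2 u ^ 2) := by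
  rw [← map_add]
  apply J_mono
  intro a b hab
  simp only [dT_def, map_pow, map_sub, map_add, map_mul, ev_y1, ev_y2]
  have := cs2 (x := -b) (y := a) (a := ev (α, a, b) (d1 u)) (b := ev (α, a, b) (d2 u)) (by nlinarith)
  nlinarith

lemma J_d1T_sq (α : ℝ) (u : Fn ℓ) : J α (d1 (dT u) ^ 2) ≤ 2 * GH α u := by
  have h : J α (d1 (dT u) ^ 2) ≤ J α ((2:ℝ) • d2 u ^ 2 + (2:ℝ) • (d1 (d1 u) ^ 2 + d1 (d2 u) ^ 2)) := by
    apply J_mono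
    intro a b hab
    simp only [dT_def, dmul, d21, d1_y1, d1_y2, map_smul, smul_eq_mul, map_pow, map_sub, map_add, map_mul, ev_y1, ev_y2, map_one, map_zero]
    have := cs2 (x := -b) (y := a) (a := ev (α, a, b) (d1 (d1 u))) (b := ev (α, a, b) (d1 (d2 u))) (by nlinarith)
    nlinarith [sq_nonneg (ev (α, a, b) (d2 u) - (-b * ev (α, a, b) (d1 (d1 u)) + a * ev (α, a, b) (d1 (d2 u))))]
  simp only [map_add, map_smul, smul_eq_mul] at h
  unfold GH
  linarith [J_sq_nonneg α (d1 u), J_sq_nonneg α (d2 (d2 u)), J_sq_nonneg α (d1 (d2 u))]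
lemma J_d2T_sq (α : ℝ) (u : Fn ℓ) : J α (d2 (dT u) ^ 2) ≤ 2 * GH α u := by
  have h : J α (d2 (dT u) ^ 2) ≤ J α ((2:ℝ) • d1 u ^ 2 + (2:ℝ) • (d1 (d2 u) ^ 2 + d2 (d2 u) ^ 2)) := by
    apply J_mono
    intro a b hab
    simp only [dT_def, dmul, d21, d2_y1, d2_y2, map_smul, smul_eq_mul, map_pow, map_sub, map_add, map_mul, ev_y1, ev_y2, map_one, map_zero]
    have := cs2 (x := -b) (y := a) (a := ev (α, a, b) (d1 (d2 u))) (b := ev (α, a, b) (d2 (d2 u))) (by nlinarith)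
    nlinarith [sq_nonneg (ev (α, a, b) (d1 u) + (-b * ev (α, a, b) (d1 (d2 u)) + a * ev (α, a, b) (d2 (d2 u))))]
  simp only [map_add, map_smul, smul_eq_mul] at h
  unfold GH
  linarith [J_sq_nonneg α (d2 u), J_sq_nonneg α (d1 (d1 u)), J_sq_nonneg α (d1 (d2 u))]

lemma Ci_dT_sq (α : ℝ) (u : Fn ℓ) : Ci α (dT u ^ 2) ≤ 7 * GH α u := by
  rw [← J_dS]
  have e : dS (dT u ^ 2) + 2 * dT u ^ 2 = (2:ℝ) • (dT u * dS (dT u)) + (2:ℝ) • dT u ^ 2 := by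
    rw [pow_two, dmul, two_smul, two_smul]; ring
  rw [e, map_add, map_smul, map_smul, smul_eq_mul, smul_eq_mul]
  have h1 := le_abs_self (J α (dT u * dS (dT u)))
  have h2 := J_mono α (dT u * dS (dT u)) ((1/2:ℝ) • dT u ^ 2 + (1/2:ℝ) • dS (dT u) ^ 2) (fun a b hab => by
    simp only [map_add, map_smul, map_pow, map_mul, smul_eq_mul]
    nlinarith [sq_nonneg (ev (α, a, b) (dT u) - ev (α, a, b) (dS (dT u)))])
  simp only [map_add, map_smul, smul_eq_mul] at h2
  have h3 := J_dS_sq α (dT u)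
  have h4 := J_d1T_sq α u
  have h5 := J_d2T_sq α u
  have h6 := J_dT_sq α u
  have h7 : J α (d1 u ^ 2) + J α (d2 u ^ 2) ≤ GH α u := by
    unfold GH
    linarith [J_sq_nonneg α (d1 (d1 u)), J_sq_nonneg α (d2 (d2 u)), J_sq_nonneg α (d1 (d2 u))]
  linarith

lemma poinc_w (α : ℝ) (u : Fn ℓ) :
    J α ((u - (ev (α, 1, 0) u) • 1) ^ 2) ≤ (28 * π ^ 2 + 1) * GH α u := by
  set w := u - (ev (α, 1, 0) u) • 1 with hw
  have hd : ∀ d : Derivation ℝ (Fn ℓ) (Fn ℓ), d w = d u := fun d => by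
    rw [hw, map_sub, Derivation.map_smul]; simp
  have h1 := J_dS α (w ^ 2)
  have e : dS (w ^ 2) + 2 * w ^ 2 = (2:ℝ) • (w * dS w) + (2:ℝ) • w ^ 2 := by
    rw [pow_two, dmul, two_smul, two_smul]; ring
  rw [e, map_add, map_smul, map_smul, smul_eq_mul, smul_eq_mul, hd] at h1
  have h2 := J_mono α (-((1/2:ℝ) • w ^ 2 + (1/2:ℝ) • dS u ^ 2)) (w * dS u) (fun a b hab => by
    simp only [map_neg, map_add, map_smul, map_pow, map_mul, smul_eq_mul]
    nlinarith [sq_nonneg (ev (α, a, b) w + ev (α, a, b) (dS u))])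
  simp only [map_neg, map_add, map_smul, smul_eq_mul] at h2
  have h3 := J_dS_sq α u
  have h7 : J α (d1 u ^ 2) + J α (d2 u ^ 2) ≤ GH α u := by
    unfold GH
    linarith [J_sq_nonneg α (d1 (d1 u)), J_sq_nonneg α (d2 (d2 u)), J_sq_nonneg α (d1 (d2 u))]
  have h8 : ∀ θ ∈ Set.Icc (-π) π, (ev (α, cos θ, sin θ) w) ^ 2 ≤ 2 * π * Ci α (dT u ^ 2) := by
    intro θ hθ
    have := oneD (g := fun θ => ev (α, 1 * cos θ, 1 * sin θ) w)
      (fun θ => hasDerivAt_ev_θ w α 1 θ) (ev_cont_comp _ (by fun_prop)) (a := -π) (b := π)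
      (s := 0) (t := θ) ⟨by linarith [pi_pos], by linarith [pi_pos]⟩ hθ
    have z : ev (α, 1, 0) w = 0 := by simp [hw]
    simp only [one_mul, cos_zero, sin_zero, z, sub_zero, hd] at this
    rw [Ci_def]
    simp only [map_pow]
    calc _ ≤ _ := this
      _ = _ := by ring
  have h9 : Ci α (w ^ 2) ≤ 2 * π * (2 * π * Ci α (dT u ^ 2)) := by
    rw [Ci_def]
    have : ∫ θ in (-π)..π, ev (α, cos θ, sin θ) (w ^ 2) ≤ ∫ θ in (-π)..π, 2 * π * Ci α (dT u ^ 2) := by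
      apply intervalIntegral.integral_mono_on (by linarith [pi_pos])
        ((ev_cont_comp _ (by fun_prop)).intervalIntegrable _ _) (by simp)
      intro θ hθ
      rw [map_pow]; exact h8 θ hθ
    simp only [intervalIntegral.integral_const, smul_eq_mul] at this
    linarith
  have h10 := Ci_dT_sq α u
  have h11 : 2 * π * (2 * π * Ci α (dT u ^ 2)) ≤ 2 * π * (2 * π * (7 * GH α u)) := by
    have := pi_pos
    gcongr
  linarith

lemma poinc : ∃ C : ℝ, 0 ≤ C ∧ ∀ (α : ℝ) (u : Fn ℓ), J α (u ^ 2) ≤ C * ((J α u) ^ 2 + GH α u) := by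
  have hp := pi_pos
  refine ⟨4 / π + 6 * (28 * π ^ 2 + 1), by positivity, fun α u => ?_⟩
  set c := ev (α, 1, 0) u
  set w := u - c • 1 with hw
  have h1 : J α (w ^ 2) ≤ (28 * π ^ 2 + 1) * GH α u := poinc_w α u
  have h2 := J_cs α w
  have h3 : J α w = J α u - c * π := by rw [hw, map_sub, map_smul, J_one, smul_eq_mul]
  have h4 : J α (u ^ 2) ≤ 2 * J α (w ^ 2) + 2 * c ^ 2 * π := by
    have := J_mono α (u ^ 2) ((2:ℝ) • w ^ 2 + (2 * c ^ 2) • 1) (fun a b _ => by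
      simp only [hw, map_add, map_sub, map_smul, map_pow, map_mul, map_one, smul_eq_mul]
      nlinarith [sq_nonneg (ev (α, a, b) u - 2 * c)])
    simpa [map_add, map_smul, smul_eq_mul, J_one] using this
  have h5 : (c * π) ^ 2 ≤ 2 * (J α u) ^ 2 + 2 * (π * J α (w ^ 2)) := by
    have : c * π = J α u - J α w := by linarith
    rw [this]
    nlinarith [sq_nonneg (J α u + J α w)]
  have h6 : 2 * c ^ 2 * π ≤ 4 / π * (J α u) ^ 2 + 4 * J α (w ^ 2) := by
    rw [← mul_le_mul_iff_right₀ hp]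
    have : π * (4 / π * (J α u) ^ 2 + 4 * J α (w ^ 2)) = 4 * (J α u) ^ 2 + 4 * (π * J α (w ^ 2)) := by
      field_simp
    rw [this]; nlinarith
  have h7 := GH_nonneg α u
  have h8 : 0 ≤ 4 / π * GH α u := by positivity
  have h9 : 0 ≤ 6 * (28 * π ^ 2 + 1) * (J α u) ^ 2 := by positivity
  nlinarith

lemma CZ_sub_const {α c : ℝ} {u : Fn ℓ} (h : CZ α (dS u)) : CZ α (dS (u - c • 1)) := by
  rw [map_sub, Derivation.map_smul]; simpa using h

lemma Lap_sub_const (c : ℝ) (u : Fn ℓ) : Lap (u - c • 1) = Lap u := by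
  simp [Lap, map_sub, Derivation.map_smul]

lemma neu_reg (m : ℕ) : ∃ C : ℝ, ∀ (α : ℝ) (u : Fn ℓ), CZ α (dS u) →
    NN (m + 2) α (u - (ev (α, 1, 0) u) • 1) ≤ C * NN m α (Lap u) := by
  obtain ⟨C, hC⟩ := reg (ℓ := ℓ) m
  set K := 28 * π ^ 2 + 1 with hK
  have hK0 : 0 < K := by positivity
  refine ⟨|C| * (1 + 2 * K * (1 + 2 * K)), fun α u h => ?_⟩
  set w := u - (ev (α, 1, 0) u) • 1 with hw
  have hb : BC α w := Or.inr (CZ_sub_const h)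
  have h1 := hC α w hb
  rw [Lap_sub_const] at h1
  have hd : ∀ d : Derivation ℝ (Fn ℓ) (Fn ℓ), d w = d u := fun d => by
    rw [hw, map_sub, Derivation.map_smul]; simp
  have hG : GH α w = GH α u := by simp only [GH, hd]
  have h2 : J α (w ^ 2) ≤ K * GH α u := poinc_w α u
  have h3 : GH α w ≤ |J α (w * Lap u)| + J α (Lap u ^ 2) := by
    unfold GH
    have a1 := energy_bc hb
    have a2 := hess_le hb
    rw [Lap_sub_const] at a1 a2
    linarith [neg_abs_le (J α (w * Lap u))]
  have h4 := J_amgm α (1 / (2 * K)) (by positivity) w (Lap u)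
  rw [hG] at h3
  have h5 : J α (w ^ 2) ≤ K * (1 / (2 * K) * J α (w ^ 2) + (1 / (2 * K))⁻¹ * J α (Lap u ^ 2) + J α (Lap u ^ 2)) := by
    calc _ ≤ _ := h2
      _ ≤ _ := by gcongr; linarith
  have h6 : K * (1 / (2 * K) * J α (w ^ 2) + (1 / (2 * K))⁻¹ * J α (Lap u ^ 2) + J α (Lap u ^ 2))
     = J α (w ^ 2) / 2 + K * (1 + 2 * K) * J α (Lap u ^ 2) := by field_simp; ring
  have h7 : NN 0 α w ≤ 2 * K * (1 + 2 * K) * NN m α (Lap u) := by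
    rw [NN_zero]
    have a0 : J α (Lap u ^ 2) ≤ NN m α (Lap u) := by
      rw [← NN_zero]; exact NN_mono (Nat.zero_le _) _ _
    have : 0 ≤ 2 * K * (1 + 2 * K) := by positivity
    have := mul_le_mul_of_nonneg_left a0 this
    linarith
  calc _ ≤ _ := h1
    _ ≤ |C| * (NN m α (Lap u) + NN 0 α w) := by
      gcongr
      · linarith [NN_nonneg m α (Lap u), NN_nonneg 0 α w]
      · exact le_abs_self C
    _ ≤ |C| * (NN m α (Lap u) + 2 * K * (1 + 2 * K) * NN m α (Lap u)) := by gcongr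
    _ = _ := by ring

lemma NN2_ge (α : ℝ) (u : Fn ℓ) : J α (u ^ 2) + GH α u ≤ NN 2 α u := by
  rw [NN_two]; unfold GH
  linarith [J_sq_nonneg α (d1 u), J_sq_nonneg α (d2 u)]

lemma sob_in (α : ℝ) (u : Fn ℓ) {a b : ℝ} (ha : |a| ≤ 1 / 2) (hb : |b| ≤ 1 / 2) :
    (ev (α, a, b) u) ^ 2 ≤ 16 * NN 2 α u := by
  have h := rect_sob (g := fun s t => ev (α, s, t) u) (gx := fun s t => ev (α, s, t) (d1 u))
    (gy := fun s t => ev (α, s, t) (d2 u)) (gxy := fun s t => ev (α, s, t) (d2 (d1 u)))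
    (fun s t => hasDerivAt_ev_1 u α s t) (fun s t => hasDerivAt_ev_2 u α s t)
    (fun s t => hasDerivAt_ev_2 (d1 u) α s t)
    (ev_cont_comp _ (by fun_prop)) (ev_cont_comp _ (by fun_prop))
    (ev_cont_comp _ (by fun_prop)) (ev_cont_comp _ (by fun_prop))
    (show (-(1/2) : ℝ) < 1/2 by norm_num) (show (-(1/2) : ℝ) < 1/2 by norm_num)
    (abs_le.1 ha) (abs_le.1 hb)
  set Q : Fn ℓ := u ^ 2 + (d2 u) ^ 2 + ((d1 u) ^ 2 + (d2 (d1 u)) ^ 2) with hQ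
  have e : ∀ s t, (ev (α, s, t) u) ^ 2 + (ev (α, s, t) (d2 u)) ^ 2 + ((ev (α, s, t) (d1 u)) ^ 2 +
      (ev (α, s, t) (d2 (d1 u))) ^ 2) = ev (α, s, t) Q := fun s t => by
    simp [hQ]
  simp only [e] at h
  have hQJ : J α Q ≤ NN 2 α u := by
    refine le_trans ?_ (NN2_ge α u)
    rw [hQ, map_add, map_add, map_add, d21]; unfold GH
    linarith [J_sq_nonneg α (d1 (d1 u)), J_sq_nonneg α (d2 (d2 u)), J_sq_nonneg α (d1 (d2 u))]
  have h2 : ∫ s in (-(1/2):ℝ)..(1/2), ∫ t in (-(1/2):ℝ)..(1/2), ev (α, s, t) Q ≤ J α Q := by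
    rw [intervalIntegral.integral_of_le (by norm_num)]
    have : ∀ s, ∫ t in (-(1/2):ℝ)..(1/2), ev (α, s, t) Q = ∫ t in Set.Ioc (-(1/2):ℝ) (1/2), ev (α, s, t) Q :=
      fun s => intervalIntegral.integral_of_le (by norm_num)
    simp only [this]
    have hsub : Set.Ioc (-(1/2):ℝ) (1/2) ×ˢ Set.Ioc (-(1/2):ℝ) (1/2) ⊆ dsk := by
      rintro ⟨x, y⟩ ⟨hx, hy⟩
      simp only [dsk, Set.mem_setOf_eq, Set.mem_Ioc] at *
      nlinarith
    have hi := J_int α Q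
    rw [← setIntegral_prod (fun p : ℝ × ℝ => ev (α, p.1, p.2) Q), J_def, ← Measure.volume_eq_prod]
    · apply setIntegral_mono_set hi
      · refine Eventually.of_forall fun p => ?_
        simp [hQ]; positivity
      · exact Eventually.of_forall hsub
    · rw [← Measure.volume_eq_prod]; exact hi.mono_set hsub
  norm_num at h h2
  linarith

lemma sob_out (α : ℝ) (u : Fn ℓ) {r θ : ℝ} (hr : r ∈ Set.Icc (1/2 : ℝ) 1) (hθ : θ ∈ Set.Icc (-π) π) :
    (ev (α, r * cos θ, r * sin θ) u) ^ 2 ≤ 60 * (2 / (2 * π) + 2 * (2 * π)) * NN 2 α u := by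
  have h := rect_sob (g := fun s t => ev (α, s * cos t, s * sin t) u)
    (gx := fun s t => cos t * ev (α, s * cos t, s * sin t) (d1 u) + sin t * ev (α, s * cos t, s * sin t) (d2 u))
    (gy := fun s t => ev (α, s * cos t, s * sin t) (dT u))
    (gxy := fun s t => -sin t * ev (α, s * cos t, s * sin t) (d1 u) + cos t * ev (α, s * cos t, s * sin t) (dT (d1 u))
      + (cos t * ev (α, s * cos t, s * sin t) (d2 u) + sin t * ev (α, s * cos t, s * sin t) (dT (d2 u))))
    (fun s t => hasDerivAt_ev_r u α s t) (fun s t => hasDerivAt_ev_θ u α s t)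
    (fun s t => ((hasDerivAt_cos t).mul (hasDerivAt_ev_θ (d1 u) α s t)).add
      ((hasDerivAt_sin t).mul (hasDerivAt_ev_θ (d2 u) α s t)))
    (ev_cont_comp _ (by fun_prop))
    (by
      have c1 := ev_cont_comp (d1 u) (f := fun p : ℝ × ℝ => (α, p.1 * cos p.2, p.1 * sin p.2)) (by fun_prop)
      have c2 := ev_cont_comp (d2 u) (f := fun p : ℝ × ℝ => (α, p.1 * cos p.2, p.1 * sin p.2)) (by fun_prop)
      fun_prop)
    (ev_cont_comp _ (by fun_prop))
    (by
      have c1 := ev_cont_comp (d1 u) (f := fun p : ℝ × ℝ => (α, p.1 * cos p.2, p.1 * sin p.2)) (by fun_prop)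
      have c2 := ev_cont_comp (d2 u) (f := fun p : ℝ × ℝ => (α, p.1 * cos p.2, p.1 * sin p.2)) (by fun_prop)
      have c3 := ev_cont_comp (dT (d1 u)) (f := fun p : ℝ × ℝ => (α, p.1 * cos p.2, p.1 * sin p.2)) (by fun_prop)
      have c4 := ev_cont_comp (dT (d2 u)) (f := fun p : ℝ × ℝ => (α, p.1 * cos p.2, p.1 * sin p.2)) (by fun_prop)
      fun_prop)
    (show (1/2 : ℝ) < 1 by norm_num) (show -π < π by linarith [pi_pos]) hr hθ
  set Q : Fn ℓ := u ^ 2 + (dT u) ^ 2 + (d1 u ^ 2 + d2 u ^ 2) + (d1 (dT u) ^ 2 + d2 (dT u) ^ 2) with hQ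
  have hQJ : J α Q ≤ 6 * NN 2 α u := by
    have h1 := NN2_ge α u
    have h4 := J_d1T_sq α u
    have h5 := J_d2T_sq α u
    have h6 := J_dT_sq α u
    have h7 : J α (d1 u ^ 2) + J α (d2 u ^ 2) ≤ GH α u := by
      unfold GH
      linarith [J_sq_nonneg α (d1 (d1 u)), J_sq_nonneg α (d2 (d2 u)), J_sq_nonneg α (d1 (d2 u))]
    simp only [hQ, map_add]
    linarith [J_sq_nonneg α u, GH_nonneg α u]
  have cQ := ev_cont_comp Q (f := fun p : ℝ × ℝ => (α, p.1 * cos p.2, p.1 * sin p.2)) (by fun_prop)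
  have Q0 : ∀ p, 0 ≤ ev p Q := fun p => by simp only [hQ, map_add, map_pow]; positivity
  have h2 : ∫ s in (1/2:ℝ)..1, ∫ t in (-π)..π, 2 * (s * ev (α, s * cos t, s * sin t) Q) ≤ 2 * J α Q := by
    rw [J_polar]
    simp only [intervalIntegral.integral_const_mul]
    have := intervalIntegral.integral_mono_interval (μ := volume) (a := (1/2:ℝ)) (b := 1) (c := 0) (d := 1)
      (f := fun s => s * ∫ t in (-π)..π, ev (α, s * cos t, s * sin t) Q) (by norm_num) (by norm_num) le_rfl
      (by
        rw [EventuallyLE, ae_restrict_iff' measurableSet_Ioc]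
        refine Eventually.of_forall fun s hs => ?_
        exact mul_nonneg hs.1.le (intervalIntegral.integral_nonneg (by linarith [pi_pos]) fun t _ => Q0 _))
      (by
        apply Continuous.intervalIntegrable
        apply continuous_id.mul
        exact intervalIntegral.continuous_parametric_intervalIntegral_of_continuous' (f := fun s t => ev (α, s * cos t, s * sin t) Q) cQ _ _)
    linarith
  have h3 : ∀ s ∈ Set.Icc (1/2:ℝ) 1, ∀ t,
      (ev (α, s * cos t, s * sin t) u) ^ 2 + (ev (α, s * cos t, s * sin t) (dT u)) ^ 2
        + ((cos t * ev (α, s * cos t, s * sin t) (d1 u) + sin t * ev (α, s * cos t, s * sin t) (d2 u)) ^ 2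
        + (-sin t * ev (α, s * cos t, s * sin t) (d1 u) + cos t * ev (α, s * cos t, s * sin t) (dT (d1 u))
      + (cos t * ev (α, s * cos t, s * sin t) (d2 u) + sin t * ev (α, s * cos t, s * sin t) (dT (d2 u)))) ^ 2)
      ≤ 2 * (s * ev (α, s * cos t, s * sin t) Q) := by
    intro s hs t
    have e1 : dT (d1 u) = d1 (dT u) - d2 u := by
      simp only [dT_def, map_sub, dmul, d21, d1_y1, d1_y2]; ring
    have e2 : dT (d2 u) = d2 (dT u) + d1 u := by
      simp only [dT_def, map_sub, dmul, d21, d2_y1, d2_y2]; ring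
    have e3 : -sin t * ev (α, s * cos t, s * sin t) (d1 u) + cos t * ev (α, s * cos t, s * sin t) (dT (d1 u))
      + (cos t * ev (α, s * cos t, s * sin t) (d2 u) + sin t * ev (α, s * cos t, s * sin t) (dT (d2 u)))
      = cos t * ev (α, s * cos t, s * sin t) (d1 (dT u)) + sin t * ev (α, s * cos t, s * sin t) (d2 (dT u)) := by
      rw [e1, e2, map_sub, map_add]; ring
    rw [e3]
    have hct : cos t ^ 2 + sin t ^ 2 ≤ 1 := (cos_sq_add_sin_sq t).le
    have f1 := cs2 hct (a := ev (α, s * cos t, s * sin t) (d1 u)) (b := ev (α, s * cos t, s * sin t) (d2 u))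
    have f2 := cs2 hct (a := ev (α, s * cos t, s * sin t) (d1 (dT u))) (b := ev (α, s * cos t, s * sin t) (d2 (dT u)))
    have f3 : ev (α, s * cos t, s * sin t) Q ≤ 2 * (s * ev (α, s * cos t, s * sin t) Q) := by
      nlinarith [Q0 (α, s * cos t, s * sin t), hs.1]
    refine le_trans ?_ f3
    simp only [hQ, map_add, map_pow]
    linarith
  have h4 : ∫ s in (1/2:ℝ)..1, ∫ t in (-π)..π, ((ev (α, s * cos t, s * sin t) u) ^ 2 + (ev (α, s * cos t, s * sin t) (dT u)) ^ 2
        + ((cos t * ev (α, s * cos t, s * sin t) (d1 u) + sin t * ev (α, s * cos t, s * sin t) (d2 u)) ^ 2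
        + (-sin t * ev (α, s * cos t, s * sin t) (d1 u) + cos t * ev (α, s * cos t, s * sin t) (dT (d1 u))
      + (cos t * ev (α, s * cos t, s * sin t) (d2 u) + sin t * ev (α, s * cos t, s * sin t) (dT (d2 u)))) ^ 2))
      ≤ 2 * J α Q := by
    refine le_trans ?_ h2
    have c0 := ev_cont_comp u (f := fun p : ℝ × ℝ => (α, p.1 * cos p.2, p.1 * sin p.2)) (by fun_prop)
    have c0' := ev_cont_comp (dT u) (f := fun p : ℝ × ℝ => (α, p.1 * cos p.2, p.1 * sin p.2)) (by fun_prop)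
    have c1 := ev_cont_comp (d1 u) (f := fun p : ℝ × ℝ => (α, p.1 * cos p.2, p.1 * sin p.2)) (by fun_prop)
    have c2 := ev_cont_comp (d2 u) (f := fun p : ℝ × ℝ => (α, p.1 * cos p.2, p.1 * sin p.2)) (by fun_prop)
    have c3 := ev_cont_comp (dT (d1 u)) (f := fun p : ℝ × ℝ => (α, p.1 * cos p.2, p.1 * sin p.2)) (by fun_prop)
    have c4 := ev_cont_comp (dT (d2 u)) (f := fun p : ℝ × ℝ => (α, p.1 * cos p.2, p.1 * sin p.2)) (by fun_prop)
    have cA : Continuous (fun p : ℝ × ℝ => ((ev (α, p.1 * cos p.2, p.1 * sin p.2) u) ^ 2 + (ev (α, p.1 * cos p.2, p.1 * sin p.2) (dT u)) ^ 2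
        + ((cos p.2 * ev (α, p.1 * cos p.2, p.1 * sin p.2) (d1 u) + sin p.2 * ev (α, p.1 * cos p.2, p.1 * sin p.2) (d2 u)) ^ 2
        + (-sin p.2 * ev (α, p.1 * cos p.2, p.1 * sin p.2) (d1 u) + cos p.2 * ev (α, p.1 * cos p.2, p.1 * sin p.2) (dT (d1 u))
      + (cos p.2 * ev (α, p.1 * cos p.2, p.1 * sin p.2) (d2 u) + sin p.2 * ev (α, p.1 * cos p.2, p.1 * sin p.2) (dT (d2 u)))) ^ 2))) := by
      fun_prop
    have cB : Continuous (fun p : ℝ × ℝ => 2 * (p.1 * ev (α, p.1 * cos p.2, p.1 * sin p.2) Q)) := by fun_prop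
    apply intervalIntegral.integral_mono_on (by norm_num)
    · exact (intervalIntegral.continuous_parametric_intervalIntegral_of_continuous' cA _ _).intervalIntegrable _ _
    · exact (intervalIntegral.continuous_parametric_intervalIntegral_of_continuous' cB _ _).intervalIntegrable _ _
    · intro s hs
      apply intervalIntegral.integral_mono_on (by linarith [pi_pos])
      · exact (cA.comp (Continuous.prodMk_right s)).intervalIntegrable _ _
      · exact (cB.comp (Continuous.prodMk_right s)).intervalIntegrable _ _
      · intro t _; exact h3 s hs t
  have hk : 0 ≤ (2 / (1 - 1/2 : ℝ) + 2 * (1 - 1/2)) * (2 / (π - -π) + 2 * (π - -π)) := by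
    have := pi_pos
    have : π - -π = 2 * π := by ring
    rw [this]; norm_num; positivity
  calc _ ≤ _ := h
    _ ≤ (2 / (1 - 1/2 : ℝ) + 2 * (1 - 1/2)) * (2 / (π - -π) + 2 * (π - -π)) * (2 * J α Q) :=
      mul_le_mul_of_nonneg_left h4 hk
    _ ≤ (2 / (1 - 1/2 : ℝ) + 2 * (1 - 1/2)) * (2 / (π - -π) + 2 * (π - -π)) * (2 * (6 * NN 2 α u)) :=
      mul_le_mul_of_nonneg_left (by linarith) hk
    _ = _ := by
      have : π - -π = 2 * π := by ring
      rw [this]; norm_num; ring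

lemma sob : ∃ C : ℝ, 0 ≤ C ∧ ∀ (α : ℝ) (u : Fn ℓ) (a b : ℝ), a ^ 2 + b ^ 2 ≤ 1 →
    (ev (α, a, b) u) ^ 2 ≤ C * NN 2 α u := by
  have hp := pi_pos
  refine ⟨16 + 60 * (2 / (2 * π) + 2 * (2 * π)), by positivity, fun α u a b hab => ?_⟩
  have hN := NN_nonneg 2 α u
  by_cases h : a ^ 2 + b ^ 2 ≤ 1 / 4
  · have := sob_in α u (a := a) (b := b) (abs_le.2 ⟨by nlinarith, by nlinarith⟩) (abs_le.2 ⟨by nlinarith, by nlinarith⟩)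
    have : 0 ≤ 60 * (2 / (2 * π) + 2 * (2 * π)) * NN 2 α u := by positivity
    linarith
  · push Not at h
    set z : ℂ := ⟨a, b⟩
    have hz : ‖z‖ ^ 2 = a ^ 2 + b ^ 2 := by rw [Complex.sq_norm, Complex.normSq_mk]; ring
    have h0 := norm_nonneg z
    have h1 : ‖z‖ * cos z.arg = a := Complex.norm_mul_cos_arg z
    have h2 : ‖z‖ * sin z.arg = b := Complex.norm_mul_sin_arg z
    have := sob_out α u (r := ‖z‖) (θ := z.arg) ⟨by nlinarith, by nlinarith⟩
      ⟨(Complex.neg_pi_lt_arg z).le, Complex.arg_le_pi z⟩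
    rw [h1, h2] at this
    linarith

end

section

variable {ℓ : ℝ}

/-- vanishing on the closed solid torus -/
def ZD (u : Fn ℓ) : Prop := ∀ α, ZS α u

lemma ZD.d1 {u : Fn ℓ} (h : ZD u) : ZD (d1 u) := fun α => ZS_d1 (h α)
lemma ZD.d2 {u : Fn ℓ} (h : ZD u) : ZD (d2 u) := fun α => ZS_d2 (h α)
lemma ZD.d0 {u : Fn ℓ} (h : ZD u) : ZD (d0 u) := by
  intro α a b hab
  have h1 := hasDerivAt_ev_α u α a b
  have h2 : (fun α => ev (α, a, b) u) = fun _ => 0 := funext fun α => h α a b hab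
  rw [h2] at h1
  exact h1.unique (hasDerivAt_const α 0)
lemma ZD.add {u v : Fn ℓ} (h : ZD u) (h' : ZD v) : ZD (u + v) := fun α a b hab => by
  rw [map_add, h α a b hab, h' α a b hab, add_zero]
lemma ZD.sub {u v : Fn ℓ} (h : ZD u) (h' : ZD v) : ZD (u - v) := fun α a b hab => by
  rw [map_sub, h α a b hab, h' α a b hab, sub_zero]
lemma ZD.mul {u : Fn ℓ} (v : Fn ℓ) (h : ZD u) : ZD (v * u) := fun α a b hab => by
  rw [map_mul, h α a b hab, mul_zero]
lemma ZD.smul {u : Fn ℓ} (c : ℝ) (h : ZD u) : ZD (c • u) := fun α a b hab => by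
  rw [map_smul, h α a b hab, smul_zero]
lemma ZD.dT {u : Fn ℓ} (h : ZD u) : ZD (dT u) := by
  rw [dT_def]; exact (h.d2.mul _).sub (h.d1.mul _)
lemma ZD.eq {u v : Fn ℓ} (h : ZD (u - v)) {α a b : ℝ} (hab : a ^ 2 + b ^ 2 ≤ 1) :
    ev (α, a, b) u = ev (α, a, b) v := by
  have := h α a b hab
  rw [map_sub] at this; linarith
lemma ZD.Jeq {u v : Fn ℓ} (h : ZD (u - v)) (α : ℝ) : J α u = J α v :=
  J_congr _ _ _ fun a b hab => h.eq hab
lemma II_congr {u v : Fn ℓ} (h : ∀ α, J α u = J α v) : II u = II v := by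
  simp only [II_def, h]

/-- composition with a smooth function of one variable -/
def cpo (G : ℝ → ℝ) (hG : ContDiff ℝ (⊤ : ℕ∞) G) (u : Fn ℓ) : Fn ℓ :=
  ⟨fun p => G (u.1 p), hG.comp u.2.1, fun p => by
    have := u.2.2 p
    simp only [this]⟩
lemma ev_cpo (G : ℝ → ℝ) (hG) (u : Fn ℓ) (p : P3) : ev p (cpo G hG u) = G (ev p u) := rfl
lemma smooth_deriv {G : ℝ → ℝ} (hG : ContDiff ℝ (⊤ : ℕ∞) G) : ContDiff ℝ (⊤ : ℕ∞) (deriv G) :=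
  (contDiff_infty_iff_deriv.1 hG).2
lemma dv_cpo (G : ℝ → ℝ) (hG) (u : Fn ℓ) (e : P3) :
    dv e (cpo G hG u) = cpo (deriv G) (smooth_deriv hG) u * dv e u := by
  apply Fn.ext'
  intro p
  rw [map_mul, ev_cpo]
  change fderiv ℝ (fun p => G (u.1 p)) p e = deriv G (u.1 p) * fderiv ℝ u.1 p e
  have h1 := ((hG.differentiable (by simp)) (u.1 p)).hasDerivAt.comp_hasFDerivAt p (u.diff p).hasFDerivAt
  have h2 : fderiv ℝ (fun p => G (u.1 p)) p = _ := HasFDerivAt.fderiv h1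
  rw [h2]; simp

section Gam
variable (Γ : FramedCurve)

def kp : Fn Γ.ℓ := ofA Γ.κ Γ.smooth_κ Γ.periodic_κ
def tt : Fn Γ.ℓ := ofA Γ.τ Γ.smooth_τ Γ.periodic_τ
lemma deriv_per {f : ℝ → ℝ} (h : Function.Periodic f ℓ) : Function.Periodic (deriv f) ℓ := by
  intro x
  have h1 : (fun y => f (y + ℓ)) = f := funext h
  conv_rhs => rw [← h1]
  rw [deriv_comp_add_const]
lemma d0_ofA (f : ℝ → ℝ) (hf) (hp : Function.Periodic f ℓ) :
    d0 (ofA f hf hp) = ofA (deriv f) (smooth_deriv hf) (deriv_per hp) :=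
  Fn.ext' fun p => ev_d0_ofA f hf hp p
def DD : Derivation ℝ (Fn Γ.ℓ) (Fn Γ.ℓ) := d0 - tt Γ • dT
variable {Γ}
lemma DD_def (u : Fn Γ.ℓ) : DD Γ u = d0 u - tt Γ * dT u := by simp [DD]
lemma d0_eq (u : Fn Γ.ℓ) : d0 u = DD Γ u + tt Γ * dT u := by rw [DD_def]; ring
@[simp] lemma d1_kp : d1 (kp Γ) = 0 := d1_ofA _ _ _
@[simp] lemma d2_kp : d2 (kp Γ) = 0 := d2_ofA _ _ _
@[simp] lemma d1_tt : d1 (tt Γ) = 0 := d1_ofA _ _ _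
@[simp] lemma d2_tt : d2 (tt Γ) = 0 := d2_ofA _ _ _
@[simp] lemma dT_tt : dT (tt Γ) = 0 := by simp [dT_def]
@[simp] lemma dS_tt : dS (tt Γ) = 0 := by simp [dS_def]
@[simp] lemma d1_dkp : d1 (d0 (kp Γ)) = 0 := by rw [d10]; simp
@[simp] lemma d2_dkp : d2 (d0 (kp Γ)) = 0 := by rw [d20]; simp
@[simp] lemma Lap_tt : Lap (tt Γ) = 0 := by simp [Lap]

lemma DD_Lap (u : Fn Γ.ℓ) : DD Γ (Lap u) = Lap (DD Γ u) := by
  rw [DD_def, DD_def, Lap_sub, Lap_mul, Lap_dT, d0_Lap]; simp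
lemma DD_dS (u : Fn Γ.ℓ) : DD Γ (dS u) = dS (DD Γ u) := by
  rw [DD_def, DD_def, map_sub, dmul, d0_dS, dST]; simp
lemma DD_dT (u : Fn Γ.ℓ) : DD Γ (dT u) = dT (DD Γ u) := by
  rw [DD_def, DD_def, map_sub, dmul, d0_dT]; simp
lemma DD_d1 (u : Fn Γ.ℓ) : DD Γ (d1 u) = d1 (DD Γ u) + tt Γ * d2 u := by
  simp only [DD_def, map_sub, dmul, dT_def, d10, d21, d1_tt, d1_y1, d1_y2]; ring
lemma DD_d2 (u : Fn Γ.ℓ) : DD Γ (d2 u) = d2 (DD Γ u) - tt Γ * d1 u := by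
  simp only [DD_def, map_sub, dmul, dT_def, d20, d21, d2_tt, d2_y1, d2_y2]; ring
lemma ZD.DD {u : Fn Γ.ℓ} (h : ZD u) : ZD (DD Γ u) := by
  rw [DD_def]; exact h.d0.sub (h.dT.mul _)

lemma J_ttmul (α : ℝ) (u : Fn Γ.ℓ) : J α (tt Γ * u) = Γ.τ α * J α u := by
  rw [J_congr α (tt Γ * u) (Γ.τ α • u)]
  · simp
  · intro a b _; simp [tt]
lemma J_DD (α : ℝ) (u : Fn Γ.ℓ) : J α (DD Γ u) = J α (d0 u) := by
  rw [DD_def, map_sub, J_ttmul, J_dT]; simp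
lemma II_DD (u : Fn Γ.ℓ) : II (DD Γ u) = 0 := by
  rw [II_congr (fun α => J_DD α u), II_d0]
lemma II_parts (u v : Fn Γ.ℓ) : II (u * DD Γ v) = - II (v * DD Γ u) := by
  have := II_DD (u * v)
  rw [dmul, map_add] at this
  linarith

/-- Neumann condition on all slices -/
def NC (u : Fn ℓ) : Prop := ∀ α, CZ α (dS u)
lemma NC.d0 {u : Fn ℓ} (h : NC u) : NC (d0 u) := by
  intro α θ
  rw [← d0_dS]
  have h1 := hasDerivAt_ev_α (dS u) α (cos θ) (sin θ)
  have h2 : (fun α => ev (α, cos θ, sin θ) (dS u)) = fun _ => 0 := funext fun α => h α θ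
  rw [h2] at h1
  exact h1.unique (hasDerivAt_const α 0)
lemma NC.dT {u : Fn ℓ} (h : NC u) : NC (dT u) := by
  intro α; rw [dST]; exact (h α).dT
lemma NC.DD {u : Fn Γ.ℓ} (h : NC u) : NC (DD Γ u) := by
  intro α
  rw [← DD_dS, DD_def]
  intro θ
  have h1 := h.d0 α θ
  have h2 := h.dT α θ
  rw [← d0_dS] at h1
  rw [dST] at h2
  rw [map_sub, map_mul, h1, h2]; simp
lemma NC.sub {u v : Fn ℓ} (h : NC u) (h' : NC v) : NC (u - v) := by
  intro α θ
  rw [map_sub, map_sub, h α θ, h' α θ, sub_zero]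

variable (Γ)
def Src : Fn Γ.ℓ := tt Γ * kp Γ * y2 - d0 (kp Γ) * y1
def BB (ε : ℝ) : Fn Γ.ℓ := 1 - ε • (kp Γ * y1)

/-- solution data in the straightened coordinates, with a marked slice -/
structure Dat where
  ε : ℝ
  hε : 0 < ε
  a : ℝ
  u : Fn Γ.ℓ
  eqn : ZD (BB Γ ε ^ 3 * Lap u - ε • (kp Γ * BB Γ ε ^ 2 * d1 u)
    + ε ^ 2 • (BB Γ ε * DD Γ (DD Γ u) - DD Γ (BB Γ ε) * DD Γ u) - ε ^ 3 • Src Γ)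
  neu : NC u
  mean : II u = 0

def FF : Filter (Dat Γ) := comap Dat.ε (𝓝 0)
variable {Γ}
lemma small {c : ℝ} (hc : 0 < c) : ∀ᶠ i in FF Γ, i.ε < c := by
  have : ∀ᶠ x in 𝓝 (0:ℝ), x < c := gt_mem_nhds hc
  exact this.comap Dat.ε

/-- sup bounds to order `n` -/
def SBk : ℕ → ℕ → (Dat Γ → Fn Γ.ℓ) → Prop
  | 0, s, w => ∃ C : ℝ, ∀ᶠ i in FF Γ, ∀ α a b : ℝ, a ^ 2 + b ^ 2 ≤ 1 → |ev (α, a, b) (w i)| ≤ C * i.ε ^ s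
  | (n + 1), s, w => SBk n s w ∧ SBk n s (fun i => d0 (w i)) ∧ SBk n s (fun i => d1 (w i))
      ∧ SBk n s (fun i => d2 (w i))
def SB (s : ℕ) (w : Dat Γ → Fn Γ.ℓ) : Prop := ∀ n, SBk n s w

variable {n s t : ℕ} {w v : Dat Γ → Fn Γ.ℓ}

lemma SBk.add : ∀ {w v : Dat Γ → Fn Γ.ℓ}, SBk n s w → SBk n s v → SBk n s (fun i => w i + v i) := by
  induction n with
  | zero =>
    rintro w v ⟨C, h⟩ ⟨C', h'⟩
    refine ⟨C + C', ?_⟩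
    filter_upwards [h, h'] with i h1 h2 α a b hab
    rw [map_add, add_mul]
    exact (abs_add_le _ _).trans (add_le_add (h1 α a b hab) (h2 α a b hab))
  | succ n ih =>
    rintro w v ⟨a0, a1, a2, a3⟩ ⟨b0, b1, b2, b3⟩
    refine ⟨ih a0 b0, ?_, ?_, ?_⟩ <;> simp only [map_add]
    · exact ih a1 b1
    · exact ih a2 b2
    · exact ih a3 b3
lemma SBk.pred (h : SBk (n + 1) s w) : SBk n s w := h.1
lemma SBk.mul : ∀ {w v : Dat Γ → Fn Γ.ℓ}, SBk n s w → SBk n t v → SBk n (s + t) (fun i => w i * v i) := by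
  induction n with
  | zero =>
    rintro w v ⟨C, h⟩ ⟨C', h'⟩
    refine ⟨C * C', ?_⟩
    filter_upwards [h, h'] with i h1 h2 α a b hab
    rw [map_mul, abs_mul, pow_add]
    calc _ ≤ (C * i.ε ^ s) * (C' * i.ε ^ t) :=
          mul_le_mul (h1 α a b hab) (h2 α a b hab) (abs_nonneg _) ((abs_nonneg _).trans (h1 α a b hab))
      _ = _ := by ring
  | succ n ih =>
    rintro w v ⟨a0, a1, a2, a3⟩ ⟨b0, b1, b2, b3⟩
    refine ⟨ih a0 b0, ?_, ?_, ?_⟩ <;> simp only [dmul]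
    · refine (ih a0 b1).add ?_
      have := ih a1 b0
      simpa only [mul_comm] using this
    · refine (ih a0 b2).add ?_
      have := ih a2 b0
      simpa only [mul_comm] using this
    · refine (ih a0 b3).add ?_
      have := ih a3 b0
      simpa only [mul_comm] using this
lemma SBk.epow (k : ℕ) : ∀ {w : Dat Γ → Fn Γ.ℓ}, SBk n s w → SBk n (s + k) (fun i => i.ε ^ k • w i) := by
  induction n with
  | zero =>
    rintro w ⟨C, h⟩
    refine ⟨C, ?_⟩
    filter_upwards [h] with i h1 α a b hab
    have := i.hε
    rw [map_smul, smul_eq_mul, abs_mul, abs_of_pos (by positivity), pow_add]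
    calc _ ≤ i.ε ^ k * (C * i.ε ^ s) := mul_le_mul_of_nonneg_left (h1 α a b hab) (by positivity)
      _ = _ := by ring
  | succ n ih =>
    rintro w ⟨a0, a1, a2, a3⟩
    refine ⟨ih a0, ?_, ?_, ?_⟩ <;> simp only [Derivation.map_smul]
    exacts [ih a1, ih a2, ih a3]
lemma SBk.csmul (c : ℝ) : ∀ {w : Dat Γ → Fn Γ.ℓ}, SBk n s w → SBk n s (fun i => c • w i) := by
  induction n with
  | zero =>
    rintro w ⟨C, h⟩
    refine ⟨|c| * C, ?_⟩
    filter_upwards [h] with i h1 α a b hab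
    rw [map_smul, smul_eq_mul, abs_mul, mul_assoc]
    exact mul_le_mul_of_nonneg_left (h1 α a b hab) (by positivity)
  | succ n ih =>
    rintro w ⟨a0, a1, a2, a3⟩
    refine ⟨ih a0, ?_, ?_, ?_⟩ <;> simp only [Derivation.map_smul]
    exacts [ih a1, ih a2, ih a3]
lemma SBk.zcongr : ∀ {w v : Dat Γ → Fn Γ.ℓ}, SBk n s w → (∀ᶠ i in FF Γ, ZD (w i - v i)) → SBk n s v := by
  induction n with
  | zero =>
    rintro w v ⟨C, h⟩ h'
    refine ⟨C, ?_⟩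
    filter_upwards [h, h'] with i h1 h2 α a b hab
    rw [← h2.eq hab]; exact h1 α a b hab
  | succ n ih =>
    rintro w v ⟨a0, a1, a2, a3⟩ h'
    refine ⟨ih a0 h', ih a1 ?_, ih a2 ?_, ih a3 ?_⟩
    · exact h'.mono fun i hi => by have := hi.d0; rwa [map_sub] at this
    · exact h'.mono fun i hi => by have := hi.d1; rwa [map_sub] at this
    · exact h'.mono fun i hi => by have := hi.d2; rwa [map_sub] at this
lemma SBk.weaken (hst : s ≤ t) : ∀ {w : Dat Γ → Fn Γ.ℓ}, SBk n t w → SBk n s w := by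
  induction n with
  | zero =>
    rintro w ⟨C, h⟩
    refine ⟨|C|, ?_⟩
    filter_upwards [h, small one_pos] with i h1 h2 α a b hab
    have := i.hε
    refine (h1 α a b hab).trans ?_
    refine mul_le_mul (le_abs_self C) (pow_le_pow_of_le_one this.le h2.le hst) (by positivity) (abs_nonneg _)
  | succ n ih =>
    rintro w ⟨a0, a1, a2, a3⟩
    exact ⟨ih a0, ih a1, ih a2, ih a3⟩

lemma SB.add (h : SB s w) (h' : SB s v) : SB s (fun i => w i + v i) := fun n => (h n).add (h' n)
lemma SB.mul (h : SB s w) (h' : SB t v) : SB (s + t) (fun i => w i * v i) := fun n => (h n).mul (h' n)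
lemma SB.mul0 (h : SB 0 w) (h' : SB t v) : SB t (fun i => w i * v i) := by
  have := h.mul h'; rwa [zero_add] at this
lemma SB.epow (k : ℕ) (h : SB s w) : SB (s + k) (fun i => i.ε ^ k • w i) := fun n => (h n).epow k
lemma SB.csmul (c : ℝ) (h : SB s w) : SB s (fun i => c • w i) := fun n => (h n).csmul c
lemma SB.zcongr (h : SB s w) (h' : ∀ᶠ i in FF Γ, ZD (w i - v i)) : SB s v := fun n => (h n).zcongr h'
lemma SB.weaken (hst : s ≤ t) (h : SB t w) : SB s w := fun n => (h n).weaken hst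
lemma SB.congr (h : SB s w) (e : ∀ i, w i = v i) : SB s v := by
  have : w = v := funext e
  rwa [← this]
lemma SB.sub (h : SB s w) (h' : SB s v) : SB s (fun i => w i - v i) :=
  (h.add (h'.csmul (-1))).congr fun i => by simp [sub_eq_add_neg]
lemma SB.neg (h : SB s w) : SB s (fun i => - w i) := (h.csmul (-1)).congr fun i => by simp
lemma SB.d0 (h : SB s w) : SB s (fun i => d0 (w i)) := fun n => (h (n + 1)).2.1
lemma SB.d1 (h : SB s w) : SB s (fun i => d1 (w i)) := fun n => (h (n + 1)).2.2.1
lemma SB.d2 (h : SB s w) : SB s (fun i => d2 (w i)) := fun n => (h (n + 1)).2.2.2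

/-- a class of families with sup bounds closed under derivatives -/
lemma SB_of_class (P : (Dat Γ → Fn Γ.ℓ) → Prop)
    (hb : ∀ w, P w → SBk 0 s w)
    (h0 : ∀ w, P w → P (fun i => _root_.d0 (w i))) (h1 : ∀ w, P w → P (fun i => _root_.d1 (w i)))
    (h2 : ∀ w, P w → P (fun i => _root_.d2 (w i))) (hw : P w) : SB s w := by
  intro n
  induction n generalizing w with
  | zero => exact hb w hw
  | succ n ih => exact ⟨ih hw, ih (h0 w hw), ih (h1 w hw), ih (h2 w hw)⟩

lemma Fn_bound (hℓ : 0 < ℓ) (f : Fn ℓ) : ∃ C : ℝ, ∀ α a b : ℝ, a ^ 2 + b ^ 2 ≤ 1 → |ev (α, a, b) f| ≤ C := by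
  obtain ⟨C, hC⟩ := exists_bound f 0 ℓ
  refine ⟨C, fun α a b hab => ?_⟩
  have hp : Function.Periodic (fun α => ev (α, a, b) f) ℓ := fun α => f.per α a b
  obtain ⟨β, hβ, e⟩ := hp.exists_mem_Ico₀ hℓ α
  rw [e]
  exact hC β ⟨hβ.1, hβ.2.le⟩ (a, b) hab

lemma SB_const (f : Fn Γ.ℓ) : SB 0 (fun _ : Dat Γ => f) := by
  refine SB_of_class (fun w => ∃ f : Fn Γ.ℓ, w = fun _ => f) ?_ ?_ ?_ ?_ ⟨f, rfl⟩
  · rintro w ⟨f, rfl⟩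
    obtain ⟨C, hC⟩ := Fn_bound Γ.hℓ f
    exact ⟨C, Eventually.of_forall fun i α a b hab => by simpa using hC α a b hab⟩
  all_goals rintro w ⟨f, rfl⟩; exact ⟨_, rfl⟩

lemma SB.dT (h : SB s w) : SB s (fun i => dT (w i)) :=
  (((SB_const y1).mul0 h.d2).sub ((SB_const y2).mul0 h.d1)).congr fun i => (dT_def _).symm
lemma SB.dS (h : SB s w) : SB s (fun i => dS (w i)) :=
  (((SB_const y1).mul0 h.d1).add ((SB_const y2).mul0 h.d2)).congr fun i => (dS_def _).symm
lemma SB.DD (h : SB s w) : SB s (fun i => DD Γ (w i)) :=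
  (h.d0.sub ((SB_const (tt Γ)).mul0 h.dT)).congr fun i => (DD_def _).symm

/-- smooth substitute for `1/(1-t)` -/
def gq : ℝ → ℝ := fun t => (1 - t * smoothTransition (3 - 4 * t))⁻¹
lemma gq_den (t : ℝ) : 1 / 4 ≤ 1 - t * smoothTransition (3 - 4 * t) := by
  by_cases h : t ≤ 3 / 4
  · have h1 := smoothTransition.nonneg (3 - 4 * t)
    have h2 := smoothTransition.le_one (3 - 4 * t)
    rcases le_or_gt t 0 with h3 | h3 <;> nlinarith
  · rw [smoothTransition.zero_of_nonpos (by linarith)]; norm_num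
lemma gq_smooth : ContDiff ℝ (⊤ : ℕ∞) gq := by
  refine ContDiff.inv ?_ (fun t => by linarith [gq_den t])
  exact contDiff_const.sub (contDiff_id.mul (smoothTransition.contDiff.comp (by fun_prop)))
lemma gq_eq {t : ℝ} (h : t ≤ 1 / 2) : gq t * (1 - t) = 1 := by
  unfold gq
  rw [smoothTransition.one_of_one_le (by linarith), mul_one]
  exact inv_mul_cancel₀ (by linarith)

def qq (i : Dat Γ) : Fn Γ.ℓ := cpo gq gq_smooth (i.ε • (kp Γ * y1))

lemma SB_qq : SB 0 (qq : Dat Γ → Fn Γ.ℓ) := by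
  obtain ⟨K, hK⟩ := Fn_bound Γ.hℓ (kp Γ * y1)
  have key : ∀ n, ∀ (G : ℝ → ℝ) (hG : ContDiff ℝ (⊤ : ℕ∞) G),
      SBk n 0 (fun i : Dat Γ => cpo G hG (i.ε • (kp Γ * y1))) := by
    intro n
    induction n with
    | zero =>
      intro G hG
      obtain ⟨C, hC⟩ := (isCompact_Icc (a := (-1:ℝ)) (b := 1)).exists_bound_of_continuousOn hG.continuous.continuousOn
      refine ⟨C, ?_⟩
      filter_upwards [small (show 0 < (|K| + 1)⁻¹ by positivity)] with i hi α a b hab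
      rw [ev_cpo, pow_zero, mul_one]
      apply hC
      rw [Set.mem_Icc, ← abs_le, map_smul, smul_eq_mul, abs_mul, abs_of_pos i.hε]
      have h1 := hK α a b hab
      have h2 : i.ε * (|K| + 1) ≤ 1 := by
        rw [lt_inv_comm₀ i.hε (by positivity)] at hi
        have := mul_le_mul_of_nonneg_left hi.le i.hε.le
        rwa [mul_inv_cancel₀ i.hε.ne'] at this
      calc _ ≤ i.ε * (|K| + 1) := mul_le_mul_of_nonneg_left (by linarith [le_abs_self K]) i.hε.le
        _ ≤ 1 := h2
    | succ n ih =>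
      intro G hG
      refine ⟨ih G hG, ?_⟩
      have hd : ∀ e : P3, SBk n 0 (fun i : Dat Γ => dv e (cpo G hG (i.ε • (kp Γ * y1)))) := by
        intro e
        simp only [dv_cpo, Derivation.map_smul]
        have h1 := ((SB_const (dv e (kp Γ * y1))).epow 1 n).weaken (Nat.zero_le _)
        simp only [pow_one] at h1
        exact (ih _ (smooth_deriv hG)).mul h1
      exact ⟨hd _, hd _, hd _⟩
  exact fun n => key n gq gq_smooth

/-- eventually `q B = 1`, with `2/3 ≤ q ≤ 2` -/
lemma qq_spec : ∀ᶠ i in FF Γ, ZD (qq i * BB Γ i.ε - 1) ∧ ∀ α a b : ℝ, a ^ 2 + b ^ 2 ≤ 1 →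
    1 / 2 ≤ ev (α, a, b) (qq i) ∧ 1 / 2 ≤ ev (α, a, b) (BB Γ i.ε) := by
  obtain ⟨K, hK⟩ := Fn_bound Γ.hℓ (kp Γ * y1)
  filter_upwards [small (show 0 < (2 * (|K| + 1))⁻¹ by positivity)] with i hi
  have hs : ∀ α a b : ℝ, a ^ 2 + b ^ 2 ≤ 1 → |i.ε * ev (α, a, b) (kp Γ * y1)| ≤ 1 / 2 := by
    intro α a b hab
    rw [abs_mul, abs_of_pos i.hε]
    have h1 := hK α a b hab
    have h2 : i.ε * (2 * (|K| + 1)) ≤ 1 := by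
        rw [lt_inv_comm₀ i.hε (by positivity)] at hi
        have := mul_le_mul_of_nonneg_left hi.le i.hε.le
        rwa [mul_inv_cancel₀ i.hε.ne'] at this
    have := mul_le_mul_of_nonneg_left (show |ev (α, a, b) (kp Γ * y1)| ≤ |K| + 1 by linarith [le_abs_self K]) i.hε.le
    linarith
  constructor
  · intro α a b hab
    have h1 := abs_le.1 (hs α a b hab)
    have h2 := gq_eq (t := i.ε * ev (α, a, b) (kp Γ * y1)) h1.2
    simp only [map_sub, map_mul, map_one, qq, ev_cpo, BB, map_smul, smul_eq_mul] at h2 ⊢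
    linarith
  · intro α a b hab
    have h1 := abs_le.1 (hs α a b hab)
    have h2 := gq_eq (t := i.ε * ev (α, a, b) (kp Γ * y1)) h1.2
    simp only [map_sub, map_mul, map_one, qq, ev_cpo, BB, map_smul, smul_eq_mul] at h2 h1 ⊢
    constructor
    · by_contra hc
      push Not at hc
      nlinarith
    · linarith

end Gam
end

section

variable {ℓ : ℝ}

section Gam
variable {Γ : FramedCurve}

lemma II_mono (f g : Fn Γ.ℓ)
    (h : ∀ α a b : ℝ, a ^ 2 + b ^ 2 ≤ 1 → ev (α, a, b) f ≤ ev (α, a, b) g) : II f ≤ II g :=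
  II_mono' Γ.hℓ.le f g fun α => J_mono α f g (h α)
lemma II_sq_nonneg (f : Fn Γ.ℓ) : 0 ≤ II (f ^ 2) := by
  have := II_mono 0 (f ^ 2) (fun α a b _ => by rw [map_zero, map_pow]; positivity)
  simpa using this
lemma II_amgm (t : ℝ) (ht : 0 < t) (u v : Fn Γ.ℓ) : II (u * v) ≤ t * II (u ^ 2) + t⁻¹ * II (v ^ 2) := by
  have := II_mono (u * v) (t • u ^ 2 + t⁻¹ • v ^ 2) (fun α a b hab => by
    simp only [map_mul, map_add, map_pow, map_smul, smul_eq_mul]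
    set x := ev (α, a, b) u
    set y := ev (α, a, b) v
    have e : t * x ^ 2 + t⁻¹ * y ^ 2 - x * y = t⁻¹ * ((t * x - y / 2) ^ 2 + 3 / 4 * y ^ 2) := by
      field_simp; ring
    have : 0 ≤ t⁻¹ * ((t * x - y / 2) ^ 2 + 3 / 4 * y ^ 2) := by positivity
    linarith)
  simpa only [map_add, map_smul, smul_eq_mul] using this
lemma II_add_sq (u v : Fn Γ.ℓ) : II ((u + v) ^ 2) ≤ 2 * II (u ^ 2) + 2 * II (v ^ 2) := by
  have := II_mono ((u + v) ^ 2) ((2:ℝ) • u ^ 2 + (2:ℝ) • v ^ 2) (fun α a b hab => by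
    simp only [map_add, map_pow, map_smul, smul_eq_mul]
    nlinarith [sq_nonneg (ev (α, a, b) u - ev (α, a, b) v)])
  simpa only [map_add, map_smul, smul_eq_mul] using this
lemma II_smul_sq (c : ℝ) (u : Fn Γ.ℓ) : II ((c • u) ^ 2) = c ^ 2 * II (u ^ 2) := by
  rw [smul_pow, map_smul, smul_eq_mul]

/-- global Poincaré inequality -/
lemma gpoinc (Γ : FramedCurve) : ∃ C : ℝ, 0 ≤ C ∧ ∀ u : Fn Γ.ℓ, II u = 0 → NC u →
    II (u ^ 2) ≤ C * (II (DD Γ u ^ 2) + (II (d1 u ^ 2) + II (d2 u ^ 2)) + II (Lap u ^ 2)) := by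
  obtain ⟨C, hC, hP⟩ := poinc (ℓ := Γ.ℓ)
  have hℓ := Γ.hℓ
  have hpi := pi_pos
  refine ⟨C * (Γ.ℓ * (Γ.ℓ * π) + 1), by positivity, fun u hm hn => ?_⟩
  set K := Γ.ℓ * π * II (DD Γ u ^ 2) with hK
  have hK0 : 0 ≤ K := by have := II_sq_nonneg (DD Γ u); positivity
  have hd : ∫ x in (0:ℝ)..Γ.ℓ, (J x (d0 u)) ^ 2 ≤ π * II (DD Γ u ^ 2) := by
    rw [II_def, ← intervalIntegral.integral_const_mul]
    refine intervalIntegral.integral_mono_on hℓ.le (((J_cont _).pow 2).intervalIntegrable _ _)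
      (((J_cont _).const_smul π).intervalIntegrable _ _) (fun x _ => ?_)
    rw [← J_DD]; exact J_cs x _
  have hJ : ∀ t ∈ Set.Icc 0 Γ.ℓ, (J t u) ^ 2 ≤ K := by
    intro t ht
    have h1 : ∀ s ∈ Set.Icc 0 Γ.ℓ, |J t u - J s u| ≤ √K := by
      intro s hs
      apply Real.abs_le_sqrt
      refine (oneD (fun x => J_deriv u x) (J_cont _) hs ht).trans ?_
      rw [sub_zero, hK, mul_assoc]
      exact mul_le_mul_of_nonneg_left hd hℓ.le
    have h2 : ∫ s in (0:ℝ)..Γ.ℓ, (J t u - J s u) = Γ.ℓ * J t u := by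
      rw [intervalIntegral.integral_sub (by simp) ((J_cont u).intervalIntegrable _ _), ← II_def, hm]
      simp
    have h3 := intervalIntegral.norm_integral_le_of_norm_le_const (a := 0) (b := Γ.ℓ)
      (f := fun s => J t u - J s u) (C := √K) (fun s hs => by
        rw [Set.uIoc_of_le hℓ.le] at hs
        exact h1 s ⟨hs.1.le, hs.2⟩)
    rw [h2, Real.norm_eq_abs, abs_mul, sub_zero, abs_of_pos hℓ, mul_comm] at h3
    have h4 := le_of_mul_le_mul_right h3 hℓ
    calc _ = |J t u| ^ 2 := (sq_abs _).symm
      _ ≤ √K ^ 2 := pow_le_pow_left₀ (abs_nonneg _) h4 2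
      _ = K := Real.sq_sqrt hK0
  have h5 : II (u ^ 2) ≤ ∫ t in (0:ℝ)..Γ.ℓ, C * (K + J t (d1 u ^ 2 + d2 u ^ 2 + Lap u ^ 2)) := by
    rw [II_def]
    refine intervalIntegral.integral_mono_on hℓ.le ((J_cont _).intervalIntegrable _ _)
      ((continuous_const.mul (continuous_const.add (J_cont _))).intervalIntegrable _ _) (fun x hx => ?_)
    refine (hP x u).trans (mul_le_mul_of_nonneg_left (add_le_add (hJ x hx) ?_) hC)
    rw [GH, map_add, map_add]
    linarith [hess_le (α := x) (u := u) (Or.inr (hn x))]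
  rw [intervalIntegral.integral_const_mul, intervalIntegral.integral_add (by simp)
    ((J_cont _).intervalIntegrable _ _), ← II_def, map_add, map_add] at h5
  simp only [intervalIntegral.integral_const, sub_zero, smul_eq_mul] at h5
  refine h5.trans ?_
  rw [mul_assoc]
  refine mul_le_mul_of_nonneg_left ?_ hC
  have a1 := II_sq_nonneg (DD Γ u)
  have a2 := II_sq_nonneg (d1 u)
  have a3 := II_sq_nonneg (d2 u)
  have a4 := II_sq_nonneg (Lap u)
  have a5 : 0 ≤ Γ.ℓ * (Γ.ℓ * π) := by positivity
  rw [hK]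
  nlinarith [mul_nonneg a5 a2, mul_nonneg a5 a3, mul_nonneg a5 a4]

/-- slice energies are controlled by global energies -/
lemma J_sup (w : Fn Γ.ℓ) (α : ℝ) :
    Γ.ℓ * J α (w ^ 2) ≤ II (w ^ 2) + Γ.ℓ * (II (w ^ 2) + II (DD Γ w ^ 2)) := by
  have hℓ := Γ.hℓ
  have hp : Function.Periodic (fun α => J α (w ^ 2)) Γ.ℓ := fun α => J_per _ α
  obtain ⟨t, ht, e⟩ := hp.exists_mem_Ico₀ hℓ α
  rw [e]
  set K := II (w ^ 2) + II (DD Γ w ^ 2) with hK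
  have hb : ∀ x, |J x (d0 (w ^ 2))| ≤ J x (w ^ 2 + DD Γ w ^ 2) := by
    intro x
    rw [← J_DD, abs_le, ← map_neg]
    constructor
    · apply J_mono
      intro a b _
      rw [sq w, dmul]
      simp only [map_mul, map_add, map_pow, map_neg]
      nlinarith [sq_nonneg (ev (x, a, b) w + ev (x, a, b) (DD Γ w))]
    · apply J_mono
      intro a b _
      rw [sq w, dmul]
      simp only [map_mul, map_add, map_pow, map_neg]
      nlinarith [sq_nonneg (ev (x, a, b) w - ev (x, a, b) (DD Γ w))]
  have h1 : ∀ s ∈ Set.Icc 0 Γ.ℓ, J t (w ^ 2) - J s (w ^ 2) ≤ K := by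
    intro s hs
    have e1 := intervalIntegral.integral_eq_sub_of_hasDerivAt (a := s) (b := t)
      (fun x _ => J_deriv (w ^ 2) x) ((J_cont _).intervalIntegrable _ _)
    rw [← e1]
    refine (le_abs_self _).trans ?_
    rw [← Real.norm_eq_abs]
    refine (intervalIntegral.norm_integral_le_abs_integral_norm).trans ?_
    have h2 : |∫ x in s..t, ‖J x (d0 (w ^ 2))‖| ≤ |∫ x in (0:ℝ)..Γ.ℓ, ‖J x (d0 (w ^ 2))‖| := by
      apply intervalIntegral.abs_integral_mono_interval
      · rw [Set.uIoc_of_le hℓ.le]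
        intro x hx
        rw [Set.uIoc, Set.mem_Ioc] at hx
        exact ⟨lt_of_le_of_lt (le_min hs.1 ht.1) hx.1, hx.2.trans (max_le hs.2 ht.2.le)⟩
      · exact Eventually.of_forall fun x => norm_nonneg _
      · exact ((J_cont _).norm).intervalIntegrable _ _
    refine h2.trans ?_
    rw [abs_of_nonneg (intervalIntegral.integral_nonneg hℓ.le fun x _ => norm_nonneg _), hK, ← map_add, II_def]
    exact intervalIntegral.integral_mono_on hℓ.le (((J_cont _).norm).intervalIntegrable _ _)
      ((J_cont _).intervalIntegrable _ _) (fun x _ => hb x)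
  have h2 : ∫ s in (0:ℝ)..Γ.ℓ, (J t (w ^ 2) - J s (w ^ 2)) ≤ ∫ s in (0:ℝ)..Γ.ℓ, K :=
    intervalIntegral.integral_mono_on hℓ.le ((continuous_const.sub (J_cont _)).intervalIntegrable _ _)
      (by simp) h1
  rw [intervalIntegral.integral_sub (by simp) ((J_cont _).intervalIntegrable _ _), ← II_def] at h2
  simp only [intervalIntegral.integral_const, sub_zero, smul_eq_mul] at h2
  linarith

/-- iterated derivatives -/
def vv (j : ℕ) (i : Dat Γ) : Fn Γ.ℓ := (DD Γ)^[j] i.u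
lemma vv_succ (j : ℕ) (i : Dat Γ) : vv (j + 1) i = DD Γ (vv j i) := Function.iterate_succ_apply' _ _ _
lemma vv_zero (i : Dat Γ) : vv 0 i = i.u := rfl
lemma vv_NC (j : ℕ) (i : Dat Γ) : NC (vv j i) := by
  induction j with
  | zero => exact i.neu
  | succ j ih => rw [vv_succ]; exact ih.DD

def RR (i : Dat Γ) : Fn Γ.ℓ := i.ε ^ 3 • (qq i ^ 3 * Src Γ) + i.ε • (kp Γ * qq i * d1 i.u)
  - i.ε ^ 2 • (qq i * DD Γ (qq i * DD Γ i.u))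

lemma eqR : ∀ᶠ i in FF Γ, ZD (Lap i.u - RR i) := by
  filter_upwards [qq_spec] with i hi α a b hab
  have h1 := hi.1 α a b hab
  have h2 := hi.1.DD α a b hab
  have h3 := i.eqn α a b hab
  simp only [map_sub, dmul, RR] at h2
  simp only [map_sub, map_add, map_mul, map_smul, smul_eq_mul, map_pow, map_one, map_zero, dmul, RR, Derivation.map_one_eq_zero] at h1 h2 h3 ⊢
  set q := ev (α, a, b) (qq i)
  set B := ev (α, a, b) (BB Γ i.ε)
  set L := ev (α, a, b) (Lap i.u)
  set k := ev (α, a, b) (kp Γ)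
  set x := ev (α, a, b) (d1 i.u)
  set z2 := ev (α, a, b) (DD Γ (DD Γ i.u))
  set z1 := ev (α, a, b) (DD Γ i.u)
  set Db := ev (α, a, b) (DD Γ (BB Γ i.ε))
  set Dq := ev (α, a, b) (DD Γ (qq i))
  set S := ev (α, a, b) (Src Γ)
  have h4 : Dq = - q ^ 2 * Db := by linear_combination q * h2 - Dq * h1
  rw [h4]
  linear_combination q ^ 3 * h3 - (1 + q * B + q ^ 2 * B ^ 2) * L * h1
    + i.ε * k * x * q * (q * B + 1) * h1 - i.ε ^ 2 * z2 * q ^ 2 * h1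

lemma eqW : ∀ᶠ i in FF Γ, ZD (BB Γ i.ε * Lap i.u - i.ε • (kp Γ * d1 i.u)
    + i.ε ^ 2 • DD Γ (qq i * DD Γ i.u) - i.ε ^ 3 • (qq i ^ 2 * Src Γ)) := by
  filter_upwards [qq_spec, eqR] with i hi hR α a b hab
  have h1 := hi.1 α a b hab
  have h3 := hR α a b hab
  simp only [map_sub, map_add, map_mul, map_smul, smul_eq_mul, map_pow, map_one, dmul, RR] at h1 h3 ⊢
  set q := ev (α, a, b) (qq i)
  set B := ev (α, a, b) (BB Γ i.ε)
  set L := ev (α, a, b) (Lap i.u)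
  set k := ev (α, a, b) (kp Γ)
  set x := ev (α, a, b) (d1 i.u)
  set z2 := ev (α, a, b) (DD Γ (DD Γ i.u))
  set z1 := ev (α, a, b) (DD Γ i.u)
  set Dq := ev (α, a, b) (DD Γ (qq i))
  set S := ev (α, a, b) (Src Γ)
  linear_combination B * h3 + (i.ε ^ 3 * q ^ 2 * S + i.ε * k * x - i.ε ^ 2 * q * z2 - i.ε ^ 2 * z1 * Dq) * h1

/-- lower-order part -/
def lw (j : ℕ) (i : Dat Γ) : Fn Γ.ℓ := (DD Γ)^[j] (RR i) + i.ε ^ 2 • (qq i ^ 2 * vv (j + 2) i)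

inductive Sp (j : ℕ) : (Dat Γ → Fn Γ.ℓ) → Prop
  | g3 : Sp j (fun i => i.ε ^ 3 • (1 : Fn Γ.ℓ))
  | g1 (k : ℕ) : k ≤ j → Sp j (fun i => i.ε • d1 (vv k i))
  | g2 (k : ℕ) : k ≤ j → Sp j (fun i => i.ε • d2 (vv k i))
  | g0 (k : ℕ) : k ≤ j → Sp j (fun i => i.ε ^ 2 • vv (k + 1) i)
  | add (w v : Dat Γ → Fn Γ.ℓ) : Sp j w → Sp j v → Sp j (fun i => w i + v i)
  | mul (c w : Dat Γ → Fn Γ.ℓ) : SB 0 c → Sp j w → Sp j (fun i => c i * w i)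

lemma Sp.congr {j : ℕ} {w v : Dat Γ → Fn Γ.ℓ} (h : Sp j w) (e : ∀ i, w i = v i) : Sp j v := by
  have : w = v := funext e
  rwa [← this]

lemma Sp.weaken {j : ℕ} {w : Dat Γ → Fn Γ.ℓ} (h : Sp j w) : Sp (j + 1) w := by
  induction h with
  | g3 => exact Sp.g3
  | g1 k hk => exact Sp.g1 k (by omega)
  | g2 k hk => exact Sp.g2 k (by omega)
  | g0 k hk => exact Sp.g0 k (by omega)
  | add w v _ _ h1 h2 => exact Sp.add _ _ h1 h2
  | mul c w hc _ h => exact Sp.mul _ _ hc h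

lemma Sp.DD {j : ℕ} {w : Dat Γ → Fn Γ.ℓ} (h : Sp j w) : Sp (j + 1) (fun i => DD Γ (w i)) := by
  induction h with
  | g3 =>
    refine (Sp.mul _ _ (SB_const 0) Sp.g3).congr fun i => ?_
    simp
  | g1 k hk =>
    refine (Sp.add _ _ (Sp.g1 (k + 1) (by omega)) (Sp.mul _ _ (SB_const (tt Γ)) (Sp.g2 k (by omega)))).congr fun i => ?_
    rw [Derivation.map_smul, DD_d1, vv_succ]; simp
  | g2 k hk =>
    refine (Sp.add _ _ (Sp.g2 (k + 1) (by omega)) (Sp.mul _ _ (SB_const (-tt Γ)) (Sp.g1 k (by omega)))).congr fun i => ?_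
    rw [Derivation.map_smul, DD_d2, vv_succ]; simp [smul_sub, sub_eq_add_neg]
  | g0 k hk =>
    refine (Sp.g0 (k + 1) (by omega)).congr fun i => ?_
    rw [Derivation.map_smul, ← vv_succ]
  | add w v _ _ h1 h2 =>
    exact (Sp.add _ _ h1 h2).congr fun i => by rw [map_add]
  | mul c w hc hw h =>
    refine (Sp.add _ _ (Sp.mul _ _ hc h) (Sp.mul _ _ hc.DD hw.weaken)).congr fun i => ?_
    rw [dmul]; ring

lemma lw_Sp (j : ℕ) : Sp j (lw (Γ := Γ) j) := by
  induction j with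
  | zero =>
    refine (Sp.add _ _ (Sp.add _ _ (Sp.mul (fun i => qq i * (qq i * qq i) * Src Γ) _ ?_ Sp.g3)
      (Sp.mul (fun i => kp Γ * qq i) _ ?_ (Sp.g1 0 le_rfl)))
      (Sp.mul (fun i => - (qq i * DD Γ (qq i))) _ ?_ (Sp.g0 0 le_rfl))).congr fun i => ?_
    · exact ((SB_qq.mul0 (SB_qq.mul0 SB_qq)).mul0 (SB_const _))
    · exact (SB_const _).mul0 SB_qq
    · exact (SB_qq.mul0 SB_qq.DD).neg
    · simp only [lw, RR, vv_succ, vv_zero, dmul, Function.iterate_zero, id]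
      simp only [Algebra.smul_def]
      ring
  | succ j ih =>
    refine (Sp.add _ _ ih.DD (Sp.mul (fun i => - DD Γ (qq i * qq i)) _ (SB_qq.mul0 SB_qq).DD.neg
      (Sp.g0 (j + 1) le_rfl))).congr fun i => ?_
    simp only [lw, Function.iterate_succ_apply', map_add, Derivation.map_smul, dmul, vv_succ, sq]
    simp only [Algebra.smul_def]
    ring

/-- induction principle in terms of closure properties -/
lemma Sp.closure {j : ℕ} {w : Dat Γ → Fn Γ.ℓ} (Q : (Dat Γ → Fn Γ.ℓ) → Prop)
    (hadd : ∀ w v, Q w → Q v → Q (fun i => w i + v i))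
    (hmul : ∀ c w, SB 0 c → Q w → Q (fun i => c i * w i))
    (h3 : Q (fun i => i.ε ^ 3 • (1 : Fn Γ.ℓ)))
    (h1 : ∀ k ≤ j, Q (fun i => i.ε • d1 (vv k i))) (h2 : ∀ k ≤ j, Q (fun i => i.ε • d2 (vv k i)))
    (h0 : ∀ k ≤ j, Q (fun i => i.ε ^ 2 • vv (k + 1) i)) (h : Sp j w) : Q w := by
  induction h with
  | g3 => exact h3
  | g1 k hk => exact h1 k hk
  | g2 k hk => exact h2 k hk
  | g0 k hk => exact h0 k hk
  | add w v _ _ a1 a2 => exact hadd _ _ a1 a2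
  | mul c w hc _ a => exact hmul _ _ hc a

def EB (E : Dat Γ → ℝ) (w : Dat Γ → Fn Γ.ℓ) : Prop := ∃ C : ℝ, ∀ᶠ i in FF Γ, II (w i ^ 2) ≤ C * E i

lemma EB.add {E : Dat Γ → ℝ} {w v : Dat Γ → Fn Γ.ℓ} (h : EB E w) (h' : EB E v) : EB E (fun i => w i + v i) := by
  obtain ⟨C, h⟩ := h
  obtain ⟨C', h'⟩ := h'
  refine ⟨2 * C + 2 * C', ?_⟩
  filter_upwards [h, h'] with i h1 h2
  linarith [II_add_sq (w i) (v i)]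
lemma EB.mul {E : Dat Γ → ℝ} {c w : Dat Γ → Fn Γ.ℓ} (hc : SB 0 c) (h : EB E w) : EB E (fun i => c i * w i) := by
  obtain ⟨C, h⟩ := h
  obtain ⟨M, hM⟩ := hc 0
  refine ⟨M ^ 2 * C, ?_⟩
  filter_upwards [h, hM] with i h1 h2
  have := II_mono ((c i * w i) ^ 2) (M ^ 2 • w i ^ 2) (fun α a b hab => by
    have h3 := h2 α a b hab
    simp only [map_mul, map_pow, map_smul, smul_eq_mul, pow_zero, mul_one] at h3 ⊢
    rw [mul_pow]
    refine mul_le_mul_of_nonneg_right ?_ (sq_nonneg _)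
    rw [← sq_abs]
    exact pow_le_pow_left₀ (abs_nonneg _) h3 2)
  rw [map_smul, smul_eq_mul] at this
  nlinarith [sq_nonneg M]

lemma NB_of_EB (k : ℕ) {w : Dat Γ → Fn Γ.ℓ} (h : EB (fun i => i.ε ^ k) w) (h' : EB (fun i => i.ε ^ k) (fun i => DD Γ (w i))) :
    NB (FF Γ) Dat.a (fun i => i.ε ^ k) 0 w := by
  obtain ⟨C, h⟩ := h
  obtain ⟨C', h'⟩ := h'
  refine ⟨Γ.ℓ⁻¹ * (C + Γ.ℓ * (C + C')), ?_⟩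
  filter_upwards [h, h'] with i h1 h2
  rw [NN_zero, mul_assoc, ← div_eq_inv_mul, le_div_iff₀ Γ.hℓ, mul_comm]
  refine (J_sup (w i) i.a).trans ?_
  have := mul_le_mul_of_nonneg_left (add_le_add h1 h2) Γ.hℓ.le
  nlinarith

/-- gradient energy -/
def gE (u : Fn Γ.ℓ) : ℝ := II (d1 u ^ 2) + II (d2 u ^ 2)
lemma gE_nonneg (u : Fn Γ.ℓ) : 0 ≤ gE u := add_nonneg (II_sq_nonneg _) (II_sq_nonneg _)

lemma ZD_iter {w : Fn Γ.ℓ} (h : ZD w) (j : ℕ) : ZD ((DD Γ)^[j] w) := by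
  induction j with
  | zero => exact h
  | succ j ih => rw [Function.iterate_succ_apply']; exact ih.DD
lemma iter_sub (w v : Fn Γ.ℓ) (j : ℕ) : (DD Γ)^[j] (w - v) = (DD Γ)^[j] w - (DD Γ)^[j] v := by
  induction j with
  | zero => rfl
  | succ j ih => simp only [Function.iterate_succ_apply', ih, map_sub]
lemma Lap_vv (j : ℕ) (i : Dat Γ) : Lap (vv j i) = (DD Γ)^[j] (Lap i.u) := by
  induction j with
  | zero => rfl
  | succ j ih => rw [vv_succ, Function.iterate_succ_apply', ← DD_Lap, ih]

lemma Lap_vv_eq {i : Dat Γ} (h : ZD (Lap i.u - RR i)) (j : ℕ) :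
    ZD (Lap (vv j i) - (DD Γ)^[j] (RR i)) := by
  rw [Lap_vv, ← iter_sub]; exact ZD_iter h j

lemma estep (j : ℕ) : ∀ᶠ i in FF Γ, i.ε ^ 2 * gE (vv (j + 1) i) + i.ε ^ 4 / 8 * II (vv (j + 2) i ^ 2)
    ≤ 8 * II (lw j i ^ 2) := by
  filter_upwards [eqR, qq_spec] with i hR hq
  have hε := i.hε
  have e1 : gE (vv (j + 1) i) = - II (vv (j + 1) i * Lap (vv (j + 1) i)) := by
    rw [gE, ← map_add, ← map_neg]
    apply II_congr
    intro α
    rw [map_add, energy_bc (Or.inr (vv_NC (j + 1) i α)), map_neg]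
  have e2 : II (vv (j + 1) i * Lap (vv (j + 1) i)) = II (vv (j + 1) i * DD Γ ((DD Γ)^[j] (RR i))) := by
    apply II_congr
    intro α
    apply ZD.Jeq
    rw [← mul_sub]
    have := Lap_vv_eq hR (j + 1)
    rw [Function.iterate_succ_apply'] at this
    exact this.mul _
  have e3 : (DD Γ)^[j] (RR i) * DD Γ (vv (j + 1) i) = lw j i * vv (j + 2) i - i.ε ^ 2 • (qq i * vv (j + 2) i) ^ 2 := by
    rw [← vv_succ, lw]
    simp only [Algebra.smul_def]; ring
  rw [e2, II_parts, neg_neg, e3, map_sub, map_smul, smul_eq_mul] at e1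
  have h1 : 1 / 4 * II (vv (j + 2) i ^ 2) ≤ II ((qq i * vv (j + 2) i) ^ 2) := by
    have := II_mono (((1:ℝ)/4) • vv (j + 2) i ^ 2) ((qq i * vv (j + 2) i) ^ 2) (fun α a b hab => by
      have h3 := (hq.2 α a b hab).1
      simp only [map_mul, map_pow, map_smul, smul_eq_mul]
      rw [mul_pow]
      exact mul_le_mul_of_nonneg_right (by nlinarith) (sq_nonneg _))
    simpa only [map_smul, smul_eq_mul] using this
  have h2 := II_amgm (8 * (i.ε ^ 2)⁻¹) (by positivity) (lw j i) (vv (j + 2) i)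
  have h3 : i.ε ^ 2 * gE (vv (j + 1) i) = i.ε ^ 2 * II (lw j i * vv (j + 2) i) - i.ε ^ 4 * II ((qq i * vv (j + 2) i) ^ 2) := by
    rw [e1]; ring
  have h4 : i.ε ^ 2 * (8 * (i.ε ^ 2)⁻¹ * II (lw j i ^ 2) + (8 * (i.ε ^ 2)⁻¹)⁻¹ * II (vv (j + 2) i ^ 2))
      = 8 * II (lw j i ^ 2) + i.ε ^ 4 / 8 * II (vv (j + 2) i ^ 2) := by
    field_simp
  have h5 := mul_le_mul_of_nonneg_left h2 (show 0 ≤ i.ε ^ 2 by positivity)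
  have h6 := mul_le_mul_of_nonneg_left h1 (show 0 ≤ i.ε ^ 4 by positivity)
  rw [h4] at h5
  rw [h3]
  linarith

/-- basic weighted energy identity -/
lemma ezero : ∀ᶠ i in FF Γ, gE i.u + i.ε ^ 2 * II (DD Γ i.u ^ 2) ≤ 2 * (i.ε ^ 3 * II (- (qq i ^ 2 * Src Γ) * i.u)) := by
  filter_upwards [eqW, qq_spec] with i hW hq
  have hε := i.hε
  have e1 : ∀ α, J α (i.u * (BB Γ i.ε * Lap i.u - i.ε • (kp Γ * d1 i.u))) = - J α (BB Γ i.ε * (d1 i.u ^ 2 + d2 i.u ^ 2)) := by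
    intro α
    have h1 := energy_id α i.u (BB Γ i.ε * i.u)
    rw [Ci_CZ ((i.neu α).mul_left _), ← map_add] at h1
    have h2 : d1 (BB Γ i.ε * i.u) * d1 i.u + d2 (BB Γ i.ε * i.u) * d2 i.u + BB Γ i.ε * i.u * Lap i.u
      = i.u * (BB Γ i.ε * Lap i.u - i.ε • (kp Γ * d1 i.u)) + BB Γ i.ε * (d1 i.u ^ 2 + d2 i.u ^ 2) := by
      have hb1 : d1 (BB Γ i.ε) = - (i.ε • kp Γ) := by
        simp [BB]
      have hb2 : d2 (BB Γ i.ε) = 0 := by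
        simp [BB]
      rw [dmul, dmul, hb1, hb2]
      simp only [Algebra.smul_def]; ring
    rw [h2, map_add] at h1
    linarith
  have e2 : II (i.u * (BB Γ i.ε * Lap i.u - i.ε • (kp Γ * d1 i.u))) = - II (BB Γ i.ε * (d1 i.u ^ 2 + d2 i.u ^ 2)) := by
    rw [← map_neg]
    apply II_congr
    intro α; rw [e1, map_neg]
  have e3 : II (i.u * (BB Γ i.ε * Lap i.u - i.ε • (kp Γ * d1 i.u)
    + i.ε ^ 2 • DD Γ (qq i * DD Γ i.u) - i.ε ^ 3 • (qq i ^ 2 * Src Γ))) = 0 := by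
    have : II (0 : Fn Γ.ℓ) = 0 := map_zero _
    rw [← this]
    apply II_congr
    intro α
    apply ZD.Jeq
    rw [sub_zero]
    exact hW.mul _
  have e4 : i.u * (BB Γ i.ε * Lap i.u - i.ε • (kp Γ * d1 i.u)
    + i.ε ^ 2 • DD Γ (qq i * DD Γ i.u) - i.ε ^ 3 • (qq i ^ 2 * Src Γ)) =
     i.u * (BB Γ i.ε * Lap i.u - i.ε • (kp Γ * d1 i.u)) + i.ε ^ 2 • (i.u * DD Γ (qq i * DD Γ i.u))
      + i.ε ^ 3 • (- (qq i ^ 2 * Src Γ) * i.u) := by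
    simp only [Algebra.smul_def]; ring
  rw [e4, map_add, map_add, map_smul, map_smul, e2, II_parts, smul_eq_mul, smul_eq_mul] at e3
  have h1 : 1 / 2 * gE i.u ≤ II (BB Γ i.ε * (d1 i.u ^ 2 + d2 i.u ^ 2)) := by
    have := II_mono (((1:ℝ)/2) • (d1 i.u ^ 2 + d2 i.u ^ 2)) (BB Γ i.ε * (d1 i.u ^ 2 + d2 i.u ^ 2)) (fun α a b hab => by
      have h3 := (hq.2 α a b hab).2
      simp only [map_mul, map_pow, map_smul, smul_eq_mul, map_add]
      exact mul_le_mul_of_nonneg_right h3 (by positivity))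
    simpa only [map_smul, smul_eq_mul, map_add, gE] using this
  have h2 : 1 / 2 * II (DD Γ i.u ^ 2) ≤ II (qq i * DD Γ i.u * DD Γ i.u) := by
    have := II_mono (((1:ℝ)/2) • (DD Γ i.u ^ 2)) (qq i * DD Γ i.u * DD Γ i.u) (fun α a b hab => by
      have h3 := (hq.2 α a b hab).1
      simp only [map_mul, map_pow, map_smul, smul_eq_mul, map_add]
      nlinarith [sq_nonneg (ev (α, a, b) (DD Γ i.u))])
    simpa only [map_smul, smul_eq_mul] using this
  have h3 := mul_le_mul_of_nonneg_left h2 (show 0 ≤ i.ε ^ 2 by positivity)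
  linarith

end Gam
end

section

variable {ℓ : ℝ}

section Gam
variable {Γ : FramedCurve}

lemma EB.congr {E : Dat Γ → ℝ} {w v : Dat Γ → Fn Γ.ℓ} (h : EB E w) (e : ∀ i, w i = v i) : EB E v := by
  have : w = v := funext e
  rwa [← this]
lemma EB.zcongr {E : Dat Γ → ℝ} {w v : Dat Γ → Fn Γ.ℓ} (h : EB E w) (e : ∀ᶠ i in FF Γ, ZD (w i - v i)) : EB E v := by
  obtain ⟨C, h⟩ := h
  refine ⟨C, ?_⟩
  filter_upwards [h, e] with i h1 h2
  have : II (v i ^ 2) = II (w i ^ 2) := by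
    apply II_congr
    intro α
    apply J_congr
    intro a b hab
    rw [map_pow, map_pow, h2.eq hab]
  rw [this]; exact h1
lemma EB.sb {c : Dat Γ → Fn Γ.ℓ} (hc : SB 0 c) : EB (fun _ => 1) c := by
  have h1 : EB (fun _ => 1) (fun i : Dat Γ => (1 : Fn Γ.ℓ)) := ⟨II (1 ^ 2), Eventually.of_forall fun i => by rw [mul_one]⟩
  exact (EB.mul hc h1).congr fun i => by simp

lemma base : (∃ C : ℝ, ∀ᶠ i in FF Γ, gE i.u + i.ε ^ 2 * II (DD Γ i.u ^ 2) ≤ C * i.ε ^ 4) ∧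
    EB (fun i : Dat Γ => i.ε ^ 2) (fun i => i.u) := by
  set E : Dat Γ → ℝ := fun i => i.ε ^ 6 + i.ε ^ 2 * gE i.u + i.ε ^ 4 * II (DD Γ i.u ^ 2) with hE
  have hlw : EB E (lw 0) := by
    refine Sp.closure (EB E) (fun w v h h' => h.add h') (fun c w hc h => EB.mul hc h) ?_ ?_ ?_ ?_ (lw_Sp 0)
    · refine ⟨|II ((1 : Fn Γ.ℓ) ^ 2)|, Eventually.of_forall fun i => ?_⟩
      have hε := i.hε
      have := gE_nonneg i.u
      have := II_sq_nonneg (DD Γ i.u)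
      rw [II_smul_sq]
      have : (i.ε ^ 3) ^ 2 ≤ E i := by
        have h6 : (i.ε ^ 3) ^ 2 = i.ε ^ 6 := by ring
        rw [hE, h6]; simp only; nlinarith [mul_nonneg (sq_nonneg i.ε) (gE_nonneg i.u), mul_nonneg (show 0 ≤ i.ε ^ 4 by positivity) (II_sq_nonneg (DD Γ i.u))]
      rw [mul_comm]
      exact mul_le_mul (le_abs_self _) this (by positivity) (abs_nonneg _)
    · intro k hk
      obtain rfl : k = 0 := by omega
      refine ⟨1, Eventually.of_forall fun i => ?_⟩
      have hε := i.hε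
      rw [II_smul_sq, one_mul, vv_zero, hE]
      have h1 : II (d1 i.u ^ 2) ≤ gE i.u := le_add_of_nonneg_right (II_sq_nonneg _)
      have h2 := mul_le_mul_of_nonneg_left h1 (sq_nonneg i.ε)
      have h3 := mul_nonneg (show 0 ≤ i.ε ^ 4 by positivity) (II_sq_nonneg (DD Γ i.u))
      have h4 : 0 ≤ i.ε ^ 6 := by positivity
      simp only; linarith
    · intro k hk
      obtain rfl : k = 0 := by omega
      refine ⟨1, Eventually.of_forall fun i => ?_⟩
      have hε := i.hε
      rw [II_smul_sq, one_mul, vv_zero, hE]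
      have h1 : II (d2 i.u ^ 2) ≤ gE i.u := le_add_of_nonneg_left (II_sq_nonneg _)
      have h2 := mul_le_mul_of_nonneg_left h1 (sq_nonneg i.ε)
      have h3 := mul_nonneg (show 0 ≤ i.ε ^ 4 by positivity) (II_sq_nonneg (DD Γ i.u))
      have h4 : 0 ≤ i.ε ^ 6 := by positivity
      simp only; linarith
    · intro k hk
      obtain rfl : k = 0 := by omega
      refine ⟨1, Eventually.of_forall fun i => ?_⟩
      have hε := i.hε
      have h6 : (i.ε ^ 2) ^ 2 = i.ε ^ 4 := by ring
      rw [II_smul_sq, one_mul, vv_succ, vv_zero, hE, h6]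
      have h2 := mul_nonneg (sq_nonneg i.ε) (gE_nonneg i.u)
      have h4 : 0 ≤ i.ε ^ 6 := by positivity
      simp only; linarith
  have hv2 : EB E (fun i => i.ε ^ 2 • vv 2 i) := by
    obtain ⟨C, hC⟩ := hlw
    refine ⟨64 * C, ?_⟩
    filter_upwards [hC, estep 0] with i h1 h2
    have h6 : (i.ε ^ 2) ^ 2 = i.ε ^ 4 := by ring
    rw [II_smul_sq, h6]
    have := mul_nonneg (sq_nonneg i.ε) (gE_nonneg (vv (0 + 1) i))
    simp only [zero_add] at h2 this
    linarith
  have hLap : EB E (fun i => Lap i.u) := by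
    have h1 : EB E (fun i => RR i) := by
      refine (hlw.add (EB.mul (c := fun i => - (qq i * qq i)) (SB_qq.mul0 SB_qq).neg hv2)).congr fun i => ?_
      simp only [lw, Function.iterate_zero, id, Algebra.smul_def]; ring
    refine h1.zcongr (eqR.mono fun i hi => ?_)
    have := hi.smul (-1)
    rwa [neg_one_smul, neg_sub] at this
  obtain ⟨C2, hC2, hP⟩ := gpoinc Γ
  obtain ⟨C3, hC3⟩ := hLap
  obtain ⟨C4, hC4⟩ := EB.sb (Γ := Γ) (c := fun i => - (qq i ^ 2 * Src Γ)) (by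
    have := ((SB_qq (Γ := Γ).mul0 SB_qq).mul0 (SB_const (Src Γ))).neg
    simpa only [sq] using this)
  have hU : ∀ᶠ i in FF Γ, i.ε ^ 2 * II (i.u ^ 2) ≤ C2 * (1 + |C3|) * (gE i.u + i.ε ^ 2 * II (DD Γ i.u ^ 2)) + C2 * |C3| * i.ε ^ 4 := by
    filter_upwards [hC3, small one_pos] with i h1 h3
    have hε := i.hε
    have h4 := hP i.u i.mean i.neu
    have g0 := gE_nonneg i.u
    have d0 := II_sq_nonneg (DD Γ i.u)
    have hE0 : 0 ≤ E i := by simp only [hE]; positivity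
    have h5 : II (Lap i.u ^ 2) ≤ |C3| * E i := h1.trans (mul_le_mul_of_nonneg_right (le_abs_self _) hE0)
    have e2 : i.ε ^ 2 ≤ 1 := pow_le_one₀ hε.le h3.le
    have hEE : i.ε ^ 2 * E i ≤ i.ε ^ 4 + (gE i.u + i.ε ^ 2 * II (DD Γ i.u ^ 2)) := by
      simp only [hE]
      have a1 : i.ε ^ 2 * i.ε ^ 6 ≤ i.ε ^ 4 := by
        calc _ = i.ε ^ 4 * (i.ε ^ 2 * i.ε ^ 2) := by ring
          _ ≤ i.ε ^ 4 * (1 * 1) := by gcongr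
          _ = _ := by ring
      have a2 : i.ε ^ 2 * (i.ε ^ 2 * gE i.u) ≤ gE i.u := by
        calc _ = (i.ε ^ 2 * i.ε ^ 2) * gE i.u := by ring
          _ ≤ (1 * 1) * gE i.u := by gcongr
          _ = _ := by ring
      have a3 : i.ε ^ 2 * (i.ε ^ 4 * II (DD Γ i.u ^ 2)) ≤ i.ε ^ 2 * II (DD Γ i.u ^ 2) := by
        calc _ = (i.ε ^ 2 * i.ε ^ 2) * (i.ε ^ 2 * II (DD Γ i.u ^ 2)) := by ring
          _ ≤ (1 * 1) * (i.ε ^ 2 * II (DD Γ i.u ^ 2)) := by gcongr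
          _ = _ := by ring
      linarith
    have h6 : i.ε ^ 2 * gE i.u ≤ gE i.u := by nlinarith
    calc i.ε ^ 2 * II (i.u ^ 2) ≤ i.ε ^ 2 * (C2 * (II (DD Γ i.u ^ 2) + gE i.u + |C3| * E i)) := by
          apply mul_le_mul_of_nonneg_left _ (sq_nonneg _)
          refine h4.trans (mul_le_mul_of_nonneg_left ?_ hC2)
          rw [gE]; linarith
      _ = C2 * (i.ε ^ 2 * II (DD Γ i.u ^ 2) + i.ε ^ 2 * gE i.u + |C3| * (i.ε ^ 2 * E i)) := by ring
      _ ≤ C2 * (i.ε ^ 2 * II (DD Γ i.u ^ 2) + gE i.u + |C3| * (i.ε ^ 4 + (gE i.u + i.ε ^ 2 * II (DD Γ i.u ^ 2)))) := by gcongr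
      _ = _ := by ring
  set A := C2 * (1 + |C3|) with hA
  have hA0 : 0 ≤ A := by positivity
  set η := (4 * (A + 1))⁻¹ with hη
  have hη0 : 0 < η := by positivity
  have hηA : η * A ≤ 1 / 4 := by
    rw [hη, ← div_eq_inv_mul, div_le_iff₀ (by positivity)]; linarith
  have hfin : ∀ᶠ i in FF Γ, gE i.u + i.ε ^ 2 * II (DD Γ i.u ^ 2) ≤ (4 * η * (C2 * |C3|) + 4 * η⁻¹ * C4) * i.ε ^ 4 := by
    filter_upwards [hU, ezero, hC4] with i h1 h2 h3
    have hε := i.hε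
    have h4 := II_amgm (η⁻¹ * i.ε) (by positivity) (- (qq i ^ 2 * Src Γ)) i.u
    have h5 : i.ε ^ 3 * II (- (qq i ^ 2 * Src Γ) * i.u) ≤ η⁻¹ * i.ε ^ 4 * C4 + η * (i.ε ^ 2 * II (i.u ^ 2)) := by
      calc _ ≤ i.ε ^ 3 * (η⁻¹ * i.ε * II ((- (qq i ^ 2 * Src Γ)) ^ 2) + (η⁻¹ * i.ε)⁻¹ * II (i.u ^ 2)) :=
            mul_le_mul_of_nonneg_left h4 (by positivity)
        _ = η⁻¹ * i.ε ^ 4 * II ((- (qq i ^ 2 * Src Γ)) ^ 2) + η * (i.ε ^ 2 * II (i.u ^ 2)) := by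
            field_simp
        _ ≤ η⁻¹ * i.ε ^ 4 * C4 + η * (i.ε ^ 2 * II (i.u ^ 2)) := by
            gcongr; simpa using h3
    have h6 := mul_le_mul_of_nonneg_left h1 hη0.le
    set X := gE i.u + i.ε ^ 2 * II (DD Γ i.u ^ 2) with hX
    have hX0 : 0 ≤ X := by
      have g0 := gE_nonneg i.u
      have d0 := II_sq_nonneg (DD Γ i.u)
      positivity
    have h7 : η * A * X ≤ 1 / 4 * X := mul_le_mul_of_nonneg_right hηA hX0
    nlinarith
  refine ⟨⟨_, hfin⟩, ?_⟩
  obtain ⟨K, hK⟩ : ∃ K, K = (4 * η * (C2 * |C3|) + 4 * η⁻¹ * C4) := ⟨_, rfl⟩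
  rw [← hK] at hfin
  refine ⟨A * K + C2 * |C3|, ?_⟩
  filter_upwards [hfin, hU] with i h1 h2
  have hε := i.hε
  have h3 := mul_le_mul_of_nonneg_left h1 hA0
  have h4 : i.ε ^ 2 * II (i.u ^ 2) ≤ i.ε ^ 2 * ((A * K + C2 * |C3|) * i.ε ^ 2) := by nlinarith
  exact le_of_mul_le_mul_left h4 (by positivity)


lemma estruct (j : ℕ) : (∀ k ≤ j, EB (fun i : Dat Γ => i.ε ^ 4) (fun i => d1 (vv k i)) ∧ EB (fun i : Dat Γ => i.ε ^ 4) (fun i => d2 (vv k i)))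
    ∧ ∀ k ≤ j + 1, EB (fun i : Dat Γ => i.ε ^ 2) (vv k) := by
  induction j with
  | zero =>
    obtain ⟨⟨C, hC⟩, hu⟩ := base (Γ := Γ)
    refine ⟨?_, ?_⟩
    · intro k hk
      obtain rfl : k = 0 := by omega
      constructor
      · refine ⟨C, hC.mono fun i hi => ?_⟩
        have := II_sq_nonneg (d2 i.u)
        have := mul_nonneg (sq_nonneg i.ε) (II_sq_nonneg (DD Γ i.u))
        rw [gE] at hi; simp only [vv_zero]; linarith
      · refine ⟨C, hC.mono fun i hi => ?_⟩
        have := II_sq_nonneg (d1 i.u)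
        have := mul_nonneg (sq_nonneg i.ε) (II_sq_nonneg (DD Γ i.u))
        rw [gE] at hi; simp only [vv_zero]; linarith
    · intro k hk
      rcases (show k = 0 ∨ k = 1 by omega) with rfl | rfl
      · exact hu
      · refine ⟨C, hC.mono fun i hi => ?_⟩
        have hε := i.hε
        rw [vv_succ, vv_zero]
        have h1 : i.ε ^ 2 * II (DD Γ i.u ^ 2) ≤ i.ε ^ 2 * (C * i.ε ^ 2) := by
          have := gE_nonneg i.u
          calc _ ≤ C * i.ε ^ 4 := by linarith
            _ = _ := by ring
        exact le_of_mul_le_mul_left h1 (by positivity)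
  | succ j ih =>
    obtain ⟨ih1, ih2⟩ := ih
    have hlw : EB (fun i : Dat Γ => i.ε ^ 6) (lw j) := by
      refine Sp.closure (EB _) (fun w v h h' => h.add h') (fun c w hc h => EB.mul hc h) ?_ ?_ ?_ ?_ (lw_Sp j)
      · exact ⟨II ((1 : Fn Γ.ℓ) ^ 2), Eventually.of_forall fun i => by rw [II_smul_sq, ← pow_mul, mul_comm]⟩
      · intro k hk
        obtain ⟨C, hC⟩ := (ih1 k hk).1
        refine ⟨C, hC.mono fun i hi => ?_⟩
        rw [II_smul_sq]
        calc _ ≤ i.ε ^ 2 * (C * i.ε ^ 4) := mul_le_mul_of_nonneg_left hi (sq_nonneg _)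
          _ = _ := by ring
      · intro k hk
        obtain ⟨C, hC⟩ := (ih1 k hk).2
        refine ⟨C, hC.mono fun i hi => ?_⟩
        rw [II_smul_sq]
        calc _ ≤ i.ε ^ 2 * (C * i.ε ^ 4) := mul_le_mul_of_nonneg_left hi (sq_nonneg _)
          _ = _ := by ring
      · intro k hk
        obtain ⟨C, hC⟩ := ih2 (k + 1) (by omega)
        refine ⟨C, hC.mono fun i hi => ?_⟩
        rw [II_smul_sq]
        calc _ ≤ (i.ε ^ 2) ^ 2 * (C * i.ε ^ 2) := mul_le_mul_of_nonneg_left hi (sq_nonneg _)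
          _ = _ := by ring
    obtain ⟨C, hC⟩ := hlw
    have hg : ∀ᶠ i in FF Γ, gE (vv (j + 1) i) ≤ 8 * C * i.ε ^ 4 := by
      filter_upwards [hC, estep j] with i h1 h2
      have hε := i.hε
      have h3 : 0 ≤ i.ε ^ 4 / 8 * II (vv (j + 2) i ^ 2) := mul_nonneg (by positivity) (II_sq_nonneg _)
      have h4 : i.ε ^ 2 * gE (vv (j + 1) i) ≤ i.ε ^ 2 * (8 * C * i.ε ^ 4) := by
        calc _ ≤ 8 * (C * i.ε ^ 6) := by linarith
          _ = _ := by ring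
      exact le_of_mul_le_mul_left h4 (by positivity)
    refine ⟨?_, ?_⟩
    · intro k hk
      rcases (show k ≤ j ∨ k = j + 1 by omega) with hk | rfl
      · exact ih1 k hk
      · constructor
        · exact ⟨8 * C, hg.mono fun i hi => (le_add_of_nonneg_right (II_sq_nonneg _)).trans hi⟩
        · exact ⟨8 * C, hg.mono fun i hi => (le_add_of_nonneg_left (II_sq_nonneg _)).trans hi⟩
    · intro k hk
      rcases (show k ≤ j + 1 ∨ k = j + 2 by omega) with hk | rfl
      · exact ih2 k hk
      · refine ⟨64 * C, ?_⟩
        filter_upwards [hC, estep j] with i h1 h2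
        have hε := i.hε
        have h3 : 0 ≤ i.ε ^ 2 * gE (vv (j + 1) i) := mul_nonneg (by positivity) (gE_nonneg _)
        have h4 : i.ε ^ 4 * II (vv (j + 2) i ^ 2) ≤ i.ε ^ 4 * (64 * C * i.ε ^ 2) := by
          calc _ ≤ 64 * (C * i.ε ^ 6) := by linarith
            _ = _ := by ring
        exact le_of_mul_le_mul_left h4 (by positivity)

abbrev NBe (k m : ℕ) (w : Dat Γ → Fn Γ.ℓ) : Prop := NB (FF Γ) Dat.a (fun i => i.ε ^ k) m w

lemma SB_Bd {c : Dat Γ → Fn Γ.ℓ} (hc : SB 0 c) (m : ℕ) : ∃ M : ℝ, ∀ᶠ i in FF Γ, Bd m M i.a (c i) := by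
  have mono : ∀ (m : ℕ) (M M' α : ℝ) (q : Fn Γ.ℓ), M ≤ M' → Bd m M α q → Bd m M' α q := by
    intro m
    induction m with
    | zero => intro M M' α q hM h a b hab; exact (h a b hab).trans hM
    | succ m ih => intro M M' α q hM h; exact ⟨ih _ _ _ _ hM h.1, ih _ _ _ _ hM h.2.1, ih _ _ _ _ hM h.2.2⟩
  induction m generalizing c with
  | zero =>
    obtain ⟨M, hM⟩ := hc 0
    exact ⟨M, hM.mono fun i hi a b hab => by simpa using hi i.a a b hab⟩
  | succ m ih =>
    obtain ⟨M0, h0⟩ := ih hc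
    obtain ⟨M1, h1⟩ := ih hc.d1
    obtain ⟨M2, h2⟩ := ih hc.d2
    refine ⟨max M0 (max M1 M2), ?_⟩
    filter_upwards [h0, h1, h2] with i a0 a1 a2
    exact ⟨mono _ _ _ _ _ (by simp) a0, mono _ _ _ _ _ (by simp) a1, mono _ _ _ _ _ (by simp) a2⟩

lemma NBe.mulc {k m : ℕ} {c w : Dat Γ → Fn Γ.ℓ} (hc : SB 0 c) (h : NBe k m w) : NBe k m (fun i => c i * w i) := by
  obtain ⟨M, hM⟩ := SB_Bd hc m
  exact NB.mul_of_bd hM h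
lemma NBe.epow {k m : ℕ} (r : ℕ) {w : Dat Γ → Fn Γ.ℓ} (h : NBe k m w) : NBe k m (fun i => i.ε ^ r • w i) := by
  obtain ⟨C, h⟩ := h
  refine ⟨C, ?_⟩
  filter_upwards [h, small one_pos] with i h1 h2
  have hε := i.hε
  rw [NN_smul]
  have : (i.ε ^ r) ^ 2 ≤ 1 := pow_le_one₀ (by positivity) (pow_le_one₀ hε.le h2.le)
  have := NN_nonneg m i.a (w i)
  nlinarith
lemma NBe.zcongr {k m : ℕ} {w v : Dat Γ → Fn Γ.ℓ} (h : NBe k m w) (e : ∀ᶠ i in FF Γ, ZD (w i - v i)) : NBe k m v := by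
  obtain ⟨C, h⟩ := h
  refine ⟨2 * C, ?_⟩
  filter_upwards [h, e] with i h1 h2
  have := NN_sub m i.a (w i) (w i - v i)
  rw [sub_sub_cancel, NN_ZS m (h2 i.a)] at this
  linarith

lemma NB_one (j : ℕ) : NBe 2 1 (vv (Γ := Γ) j) := by
  have hv : ∀ k, EB (fun i : Dat Γ => i.ε ^ 2) (vv k) := fun k => (estruct k).2 k (by omega)
  have hw : ∀ w : Dat Γ → Fn Γ.ℓ, EB (fun i : Dat Γ => i.ε ^ 4) w → EB (fun i : Dat Γ => i.ε ^ 2) w := by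
    rintro w ⟨C, h⟩
    refine ⟨|C|, ?_⟩
    filter_upwards [h, small one_pos] with i h1 h2
    have hε := i.hε
    refine h1.trans (mul_le_mul (le_abs_self C) (pow_le_pow_of_le_one hε.le h2.le (by norm_num)) (by positivity) (abs_nonneg _))
  have h1 : ∀ k, EB (fun i : Dat Γ => i.ε ^ 2) (fun i => d1 (vv k i)) := fun k => hw _ ((estruct k).1 k le_rfl).1
  have h2 : ∀ k, EB (fun i : Dat Γ => i.ε ^ 2) (fun i => d2 (vv k i)) := fun k => hw _ ((estruct k).1 k le_rfl).2
  refine NB.succ ?_ ?_ ?_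
  · exact NB_of_EB 2 (hv j) ((hv (j + 1)).congr fun i => vv_succ j i)
  · refine NB_of_EB 2 (h1 j) (((h1 (j + 1)).add (EB.mul (SB_const (tt Γ)) (h2 j))).congr fun i => ?_)
    rw [DD_d1, vv_succ]
  · refine NB_of_EB 2 (h2 j) (((h2 (j + 1)).add (EB.mul (SB_const (-tt Γ)) (h1 j))).congr fun i => ?_)
    rw [DD_d2, vv_succ]; ring

lemma NB_all (m : ℕ) : ∀ j, NBe 2 (m + 1) (vv (Γ := Γ) j) := by
  induction m with
  | zero => exact NB_one
  | succ m ih =>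
    intro j
    have hv : ∀ k, NBe 2 m (vv (Γ := Γ) k) := fun k => NB.mono (Nat.le_succ m) (ih k)
    have hone : NBe 2 m (fun i : Dat Γ => i.ε • (1 : Fn Γ.ℓ)) := by
      have hBd := Bd_const (ℓ := Γ.ℓ) m
      obtain ⟨C, hC, hC'⟩ := NN_mul (ℓ := Γ.ℓ) m
      have : ∀ m : ℕ, ∀ α, NN (ℓ := Γ.ℓ) m α 1 = π := by
        intro m α
        induction m with
        | zero => rw [NN_zero, one_pow, J_one]
        | succ m ih =>
          rw [NN_succ, ih]
          have : ∀ m, NN (ℓ := Γ.ℓ) m α 0 = 0 := fun m => NN_ZS m (fun a b _ => map_zero _)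
          simp [this]
      refine ⟨π, Eventually.of_forall fun i => ?_⟩
      rw [NN_smul, this, mul_comm]
    have hlw : NBe 2 m (lw (Γ := Γ) j) := by
      refine Sp.closure (NBe 2 m) (fun w v h h' => h.add h') (fun c w hc h => NBe.mulc hc h) ?_ ?_ ?_ ?_ (lw_Sp j)
      · exact (NBe.epow 2 hone).congr fun i => by rw [smul_smul]; ring_nf
      · intro k hk
        simpa only [pow_one] using NBe.epow 1 (NB.d1 (ih k))
      · intro k hk
        simpa only [pow_one] using NBe.epow 1 (NB.d2 (ih k))
      · intro k hk
        exact NBe.epow 2 (hv (k + 1))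
    have hL : NBe 2 m (fun i : Dat Γ => Lap (vv j i)) := by
      have h1 : NBe 2 m (fun i : Dat Γ => (DD Γ)^[j] (RR i)) := by
        refine (hlw.sub (NBe.epow 2 (NBe.mulc (SB_qq.mul0 SB_qq) (hv (j + 2))))).congr fun i => ?_
        simp only [lw, sq]; ring
      refine h1.zcongr (eqR.mono fun i hi => ?_)
      have := (Lap_vv_eq hi j).smul (-1)
      rwa [neg_one_smul, neg_sub] at this
    obtain ⟨C, hC⟩ := reg (ℓ := Γ.ℓ) m
    obtain ⟨C1, h1⟩ := hL
    obtain ⟨C2, h2⟩ := NB.mono (Nat.zero_le _) (hv j)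
    refine ⟨|C| * (C1 + C2), ?_⟩
    filter_upwards [h1, h2] with i a1 a2
    refine (hC i.a _ (Or.inr (vv_NC j i i.a))).trans ?_
    rw [mul_assoc, add_mul]
    have n1 := NN_nonneg m i.a (Lap (vv j i))
    have n2 := NN_nonneg 0 i.a (vv j i)
    calc _ ≤ |C| * (NN m i.a (Lap (vv j i)) + NN 0 i.a (vv j i)) := mul_le_mul_of_nonneg_right (le_abs_self _) (by positivity)
      _ ≤ _ := mul_le_mul_of_nonneg_left (add_le_add a1 a2) (abs_nonneg _)

/-- the class of derivatives of the solution family -/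
inductive Wc : (Dat Γ → Fn Γ.ℓ) → Prop
  | base (j : ℕ) : Wc (vv j)
  | add (w v : Dat Γ → Fn Γ.ℓ) : Wc w → Wc v → Wc (fun i => w i + v i)
  | mul (c w : Dat Γ → Fn Γ.ℓ) : SB 0 c → Wc w → Wc (fun i => c i * w i)
  | d1 (w : Dat Γ → Fn Γ.ℓ) : Wc w → Wc (fun i => _root_.d1 (w i))
  | d2 (w : Dat Γ → Fn Γ.ℓ) : Wc w → Wc (fun i => _root_.d2 (w i))
lemma Wc.congr {w v : Dat Γ → Fn Γ.ℓ} (h : Wc w) (e : ∀ i, w i = v i) : Wc v := by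
  have : w = v := funext e
  rwa [← this]
lemma Wc.DD {w : Dat Γ → Fn Γ.ℓ} (h : Wc w) : Wc (fun i => DD Γ (w i)) := by
  induction h with
  | base j => exact (Wc.base (j + 1)).congr fun i => vv_succ j i
  | add w v _ _ h1 h2 => exact (Wc.add _ _ h1 h2).congr fun i => by rw [map_add]
  | mul c w hc hw h =>
    refine (Wc.add _ _ (Wc.mul _ _ hc h) (Wc.mul _ _ hc.DD hw)).congr fun i => ?_
    rw [dmul]; ring
  | d1 w hw h =>
    exact (Wc.add _ _ (Wc.d1 _ h) (Wc.mul _ _ (SB_const (tt Γ)) (Wc.d2 _ hw))).congr fun i => (DD_d1 _).symm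
  | d2 w hw h =>
    refine (Wc.add _ _ (Wc.d2 _ h) (Wc.mul _ _ (SB_const (-tt Γ)) (Wc.d1 _ hw))).congr fun i => ?_
    rw [DD_d2]; ring
lemma Wc.d0 {w : Dat Γ → Fn Γ.ℓ} (h : Wc w) : Wc (fun i => d0 (w i)) := by
  refine (Wc.add _ _ h.DD (Wc.add _ _ (Wc.mul _ _ (SB_const (tt Γ * y1)) (Wc.d2 _ h))
    (Wc.mul _ _ (SB_const (-(tt Γ * y2))) (Wc.d1 _ h)))).congr fun i => ?_
  rw [d0_eq, dT_def]; ring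
lemma Wc.nb {w : Dat Γ → Fn Γ.ℓ} (h : Wc w) : ∀ m, NBe 2 m w := by
  induction h with
  | base j => exact fun m => NB.mono (Nat.le_succ m) (NB_all m j)
  | add w v _ _ h1 h2 => exact fun m => (h1 m).add (h2 m)
  | mul c w hc hw h => exact fun m => NBe.mulc hc (h m)
  | d1 w hw h => exact fun m => NB.d1 (h (m + 1))
  | d2 w hw h => exact fun m => NB.d2 (h (m + 1))

end Gam
end

section

variable {ℓ : ℝ}

section Gam
variable {Γ : FramedCurve}

/-- change the marked slice -/
def Dat.at (i : Dat Γ) (α : ℝ) : Dat Γ := { i with a := α }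
lemma ev_at {p : Dat Γ → Prop} (h : ∀ᶠ i in FF Γ, p i) : ∀ᶠ i in FF Γ, ∀ α, p (i.at α) := by
  rw [FF, eventually_comap] at *
  exact h.mono fun x hx i hi α => hx (i.at α) hi
def AI (w : Dat Γ → Fn Γ.ℓ) : Prop := ∀ i α, w (i.at α) = w i

abbrev dz (j : ℕ) (w : Dat Γ → Fn Γ.ℓ) : Dat Γ → Fn Γ.ℓ := fun i => (⇑(d0 (ℓ := Γ.ℓ)))^[j] (w i)

lemma it_succ (j : ℕ) (u : Fn ℓ) : (⇑(d0 (ℓ := ℓ)))^[j + 1] u = d0 ((⇑d0)^[j] u) := Function.iterate_succ_apply' _ _ _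
lemma it_d1 (j : ℕ) (u : Fn ℓ) : (⇑(d0 (ℓ := ℓ)))^[j] (d1 u) = d1 ((⇑d0)^[j] u) := by
  induction j with
  | zero => rfl
  | succ j ih => rw [it_succ, it_succ, ih, d10]
lemma it_d2 (j : ℕ) (u : Fn ℓ) : (⇑(d0 (ℓ := ℓ)))^[j] (d2 u) = d2 ((⇑d0)^[j] u) := by
  induction j with
  | zero => rfl
  | succ j ih => rw [it_succ, it_succ, ih, d20]
lemma it_Lap (j : ℕ) (u : Fn ℓ) : (⇑(d0 (ℓ := ℓ)))^[j] (Lap u) = Lap ((⇑d0)^[j] u) := by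
  induction j with
  | zero => rfl
  | succ j ih => rw [it_succ, it_succ, ih, d0_Lap]
lemma it_dT (j : ℕ) (u : Fn ℓ) : (⇑(d0 (ℓ := ℓ)))^[j] (dT u) = dT ((⇑d0)^[j] u) := by
  induction j with
  | zero => rfl
  | succ j ih => rw [it_succ, it_succ, ih, d0_dT]
lemma it_NC (j : ℕ) {u : Fn ℓ} (h : NC u) : NC ((⇑(d0 (ℓ := ℓ)))^[j] u) := by
  induction j with
  | zero => exact h
  | succ j ih => rw [it_succ]; exact ih.d0
lemma SB.it {s : ℕ} {w : Dat Γ → Fn Γ.ℓ} (h : SB s w) (j : ℕ) : SB s (dz j w) := by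
  induction j with
  | zero => exact h
  | succ j ih => exact ih.d0.congr fun i => (it_succ j _).symm

lemma sup_of_NB {s : ℕ} {w : Dat Γ → Fn Γ.ℓ} (ha : AI w) (h : NBe (2 * s) 2 w) : SBk 0 s w := by
  obtain ⟨C, h⟩ := h
  obtain ⟨K, hK, hs⟩ := sob (ℓ := Γ.ℓ)
  refine ⟨√(K * |C|), ?_⟩
  filter_upwards [ev_at h] with i hi α a b hab
  have hε := i.hε
  have h1 := hi α
  rw [ha i α] at h1
  have h2 : NN 2 α (w i) ≤ |C| * i.ε ^ (2 * s) := h1.trans (mul_le_mul_of_nonneg_right (le_abs_self _) (by have : 0 < (i.at α).ε := hε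
                                                                                                           positivity))
  apply abs_le_of_sq_le_sq _ (by positivity)
  rw [mul_pow, Real.sq_sqrt (by positivity), ← pow_mul]
  calc _ ≤ K * NN 2 α (w i) := hs α _ a b hab
    _ ≤ K * (|C| * i.ε ^ (2 * s)) := mul_le_mul_of_nonneg_left h2 hK
    _ = _ := by rw [mul_comm s 2]; ring

lemma SB_of_NB {s : ℕ} {w : Dat Γ → Fn Γ.ℓ} (ha : AI w) (h : ∀ j m, NBe (2 * s) m (dz j w)) : SB s w := by
  refine SB_of_class (fun w => AI w ∧ ∀ j m, NBe (2 * s) m (dz j w)) ?_ ?_ ?_ ?_ ⟨ha, h⟩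
  · rintro w ⟨ha, h⟩
    exact sup_of_NB ha (h 0 2)
  · rintro w ⟨ha, h⟩
    exact ⟨fun i α => by simp only [ha i α], fun j m => (h (j + 1) m).congr fun i => Function.iterate_succ_apply _ _ _⟩
  · rintro w ⟨ha, h⟩
    exact ⟨fun i α => by simp only [ha i α], fun j m => (NB.d1 (h j (m + 1))).congr fun i => (it_d1 j _).symm⟩
  · rintro w ⟨ha, h⟩
    exact ⟨fun i α => by simp only [ha i α], fun j m => (NB.d2 (h j (m + 1))).congr fun i => (it_d2 j _).symm⟩

lemma J_abs {f : Fn ℓ} {α C : ℝ} (h : ∀ a b : ℝ, a ^ 2 + b ^ 2 ≤ 1 → |ev (α, a, b) f| ≤ C) : |J α f| ≤ π * C := by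
  have h1 := J_mono α f (C • 1) (fun a b hab => by simpa using (abs_le.1 (h a b hab)).2)
  have h2 := J_mono α ((-C) • 1) f (fun a b hab => by simpa using (abs_le.1 (h a b hab)).1)
  rw [map_smul, J_one, smul_eq_mul] at h1 h2
  exact abs_le.2 ⟨by linarith, by linarith⟩

lemma SB.nb {s : ℕ} {w : Dat Γ → Fn Γ.ℓ} (h : SB s w) (m : ℕ) : NBe (2 * s) m w := by
  induction m generalizing w with
  | zero =>
    obtain ⟨C, h⟩ := h 0
    refine ⟨π * C ^ 2, h.mono fun i hi => ?_⟩
    rw [NN_zero]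
    have := J_abs (f := w i ^ 2) (α := i.a) (C := (C * i.ε ^ s) ^ 2) fun a b hab => by
      rw [map_pow, abs_pow]
      exact pow_le_pow_left₀ (abs_nonneg _) (hi _ _ _ hab) 2
    refine (le_abs_self _).trans (this.trans (le_of_eq ?_))
    ring
  | succ m ih => exact NB.succ (ih h) (ih h.d1) (ih h.d2)

lemma osc_nb {s : ℕ} {w : Dat Γ → Fn Γ.ℓ} (hn : ∀ i, NC (w i)) (h : SB s (fun i => Lap (w i))) (m : ℕ) :
    NBe (2 * s) (m + 2) (fun i => w i - (ev (i.a, 1, 0) (w i)) • (1 : Fn Γ.ℓ)) := by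
  obtain ⟨C, hC⟩ := neu_reg (ℓ := Γ.ℓ) m
  obtain ⟨C', h'⟩ := h.nb m
  refine ⟨|C| * C', h'.mono fun i hi => ?_⟩
  refine (hC i.a (w i) (hn i _)).trans ?_
  rw [mul_assoc]
  exact mul_le_mul (le_abs_self _) hi (NN_nonneg _ _ _) (abs_nonneg _)

lemma SB_grad {s : ℕ} {w : Dat Γ → Fn Γ.ℓ} (ha : AI w) (hn : ∀ i, NC (w i)) (h : SB s (fun i => Lap (w i))) :
    SB s (fun i => d1 (w i)) ∧ SB s (fun i => d2 (w i)) := by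
  have key : ∀ j m, NBe (2 * s) (m + 2) (fun i => dz j w i - (ev (i.a, 1, 0) (dz j w i)) • (1 : Fn Γ.ℓ)) := fun j m =>
    osc_nb (fun i => it_NC j (hn i)) ((h.it j).congr fun i => it_Lap j _) m
  constructor
  · refine SB_of_NB (fun i α => by simp only [ha i α]) fun j m => ?_
    refine (NB.mono (Nat.le_succ m) (NB.d1 (key j m))).congr fun i => ?_
    simp [it_d1]
  · refine SB_of_NB (fun i α => by simp only [ha i α]) fun j m => ?_
    refine (NB.mono (Nat.le_succ m) (NB.d2 (key j m))).congr fun i => ?_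
    simp [it_d2]

lemma osc {s : ℕ} {w : Dat Γ → Fn Γ.ℓ} (ha : AI w) (hn : ∀ i, NC (w i)) (h : SB s (fun i => Lap (w i))) :
    ∃ C : ℝ, ∀ᶠ i in FF Γ, ∀ α a b : ℝ, a ^ 2 + b ^ 2 ≤ 1 → |ev (α, a, b) (w i) - ev (α, 1, 0) (w i)| ≤ C * i.ε ^ s := by
  obtain ⟨C, h⟩ := osc_nb hn h 0
  obtain ⟨K, hK, hs⟩ := sob (ℓ := Γ.ℓ)
  refine ⟨√(K * |C|), ?_⟩
  filter_upwards [ev_at h] with i hi α a b hab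
  have hε := i.hε
  have h1 := hi α
  rw [ha i α] at h1
  have h2 : NN 2 α (w i - (ev (α, 1, 0) (w i)) • (1 : Fn Γ.ℓ)) ≤ |C| * i.ε ^ (2 * s) :=
    h1.trans (mul_le_mul_of_nonneg_right (le_abs_self _) (by have : 0 < (i.at α).ε := hε
                                                             positivity))
  apply abs_le_of_sq_le_sq _ (by positivity)
  rw [mul_pow, Real.sq_sqrt (by positivity), ← pow_mul]
  calc _ = (ev (α, a, b) (w i - (ev (α, 1, 0) (w i)) • (1 : Fn Γ.ℓ))) ^ 2 := by simp
    _ ≤ K * NN 2 α (w i - (ev (α, 1, 0) (w i)) • (1 : Fn Γ.ℓ)) := hs α _ a b hab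
    _ ≤ K * (|C| * i.ε ^ (2 * s)) := mul_le_mul_of_nonneg_left h2 hK
    _ = _ := by rw [mul_comm s 2]; ring

lemma SB_of_sup {s : ℕ} {w : Dat Γ → Fn Γ.ℓ} (h1 : SB s (fun i => d1 (w i))) (h2 : SB s (fun i => d2 (w i)))
    (h : ∀ j, SBk 0 s (dz j w)) : SB s w := by
  refine SB_of_class (fun v => SB s v ∨ ∃ j, v = dz j w) ?_ ?_ ?_ ?_ (Or.inr ⟨0, rfl⟩)
  · rintro v (hv | ⟨j, rfl⟩)
    exacts [hv 0, h j]
  · rintro v (hv | ⟨j, rfl⟩)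
    exacts [Or.inl hv.d0, Or.inr ⟨j + 1, funext fun i => (it_succ j _).symm⟩]
  · rintro v (hv | ⟨j, rfl⟩)
    exacts [Or.inl hv.d1, Or.inl ((h1.it j).congr fun i => it_d1 j _)]
  · rintro v (hv | ⟨j, rfl⟩)
    exacts [Or.inl hv.d2, Or.inl ((h2.it j).congr fun i => it_d2 j _)]

/-- the solution family -/
def psi (i : Dat Γ) : Fn Γ.ℓ := i.u
lemma AI_psi : AI (psi (Γ := Γ)) := fun _ _ => rfl

lemma SB1_psi : SB 1 (psi (Γ := Γ)) := by
  refine SB_of_NB AI_psi fun j m => ?_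
  have : Wc (dz j (psi (Γ := Γ))) := by
    induction j with
    | zero => exact Wc.base 0
    | succ j ih => exact ih.d0.congr fun i => (it_succ j _).symm
  exact this.nb m

lemma SB_Lap_of' {s : ℕ} (hp : SB 1 (psi (Γ := Γ))) (h1 : SB s (fun i : Dat Γ => d1 (psi i))) (hs : s ≤ 2) :
    SB (s + 1) (fun i : Dat Γ => Lap (psi i)) := by
  have a1 : SB 3 (fun i : Dat Γ => i.ε ^ 3 • (qq i * (qq i * qq i) * Src Γ)) := by
    simpa using (((SB_qq (Γ := Γ)).mul0 (SB_qq.mul0 SB_qq)).mul0 (SB_const (Src Γ))).epow 3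
  have a2 : SB (s + 1) (fun i : Dat Γ => i.ε ^ 1 • (kp Γ * qq i * d1 (psi i))) :=
    (((SB_const (kp Γ)).mul0 SB_qq).mul0 h1).epow 1
  have a3 : SB 3 (fun i : Dat Γ => i.ε ^ 2 • (qq i * DD Γ (qq i * DD Γ (psi i)))) :=
    (SB_qq.mul0 (SB.DD (SB_qq.mul0 hp.DD))).epow 2
  have : SB (s + 1) (fun i : Dat Γ => RR i) := by
    refine (((a1.weaken (by omega)).add a2).sub (a3.weaken (by omega))).congr fun i => ?_
    rw [RR, psi, pow_one]; ring
  refine this.zcongr (eqR.mono fun i hi => ?_)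
  have := hi.smul (-1)
  rwa [neg_one_smul, neg_sub] at this

lemma SB3 : SB 3 (fun i : Dat Γ => Lap (psi i)) ∧ SB 3 (fun i : Dat Γ => d1 (psi i)) ∧ SB 3 (fun i : Dat Γ => d2 (psi i)) := by
  have hn : ∀ i : Dat Γ, NC (psi i) := fun i => i.neu
  have h1 := SB_Lap_of' (Γ := Γ) SB1_psi SB1_psi.d1 (by norm_num)
  have h2 := SB_grad AI_psi hn h1
  have h3 := SB_Lap_of' (Γ := Γ) SB1_psi h2.1 (by norm_num)
  exact ⟨h3, SB_grad AI_psi hn h3⟩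

lemma J_mean (hℓ : 0 < ℓ) {w : Fn ℓ} (hw : II w = 0) {K : ℝ} (h : ∀ α, |J α (d0 w)| ≤ K) (α : ℝ) : |J α w| ≤ ℓ * K := by
  have hp : Function.Periodic (fun α => J α w) ℓ := fun α => J_per w α
  have h0 : ∫ β in α..(α + ℓ), J β w = 0 := by
    rw [hp.intervalIntegral_add_eq α 0, zero_add]; exact hw
  have hK : 0 ≤ K := (abs_nonneg _).trans (h 0)
  have hd : ∀ β ∈ Set.uIoc α (α + ℓ), ‖J α w - J β w‖ ≤ K * ℓ := by
    intro β hβ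
    rw [Set.uIoc_of_le (by linarith)] at hβ
    have := Convex.norm_image_sub_le_of_norm_hasDerivWithin_le (f := fun α => J α w) (f' := fun α => J α (d0 w)) (C := K) (s := Set.univ)
      (fun x _ => (J_deriv w x).hasDerivWithinAt) (fun x _ => h x) convex_univ (Set.mem_univ β) (Set.mem_univ α)
    refine this.trans (mul_le_mul_of_nonneg_left ?_ hK)
    rw [Real.norm_eq_abs, abs_le]; constructor <;> linarith [hβ.1, hβ.2]
  have h1 := intervalIntegral.norm_integral_le_of_norm_le_const hd
  rw [intervalIntegral.integral_sub (by simp) ((J_cont w).intervalIntegrable _ _), h0, sub_zero,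
    intervalIntegral.integral_const, smul_eq_mul, add_sub_cancel_left, Real.norm_eq_abs, abs_mul, abs_of_pos hℓ] at h1
  have : ℓ * |J α w| ≤ ℓ * (ℓ * K) := by linarith
  exact le_of_mul_le_mul_left this hℓ

lemma J_it {u v : Fn ℓ} (h : ∀ α, J α u = J α v) (j : ℕ) : ∀ α, J α ((⇑d0)^[j] u) = J α ((⇑d0)^[j] v) := by
  induction j with
  | zero => exact h
  | succ j ih =>
    intro α
    rw [it_succ, it_succ]
    have h1 := J_deriv ((⇑d0)^[j] u) α
    rw [show (fun α => J α ((⇑d0)^[j] u)) = fun α => J α ((⇑d0)^[j] v) from funext ih] at h1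
    exact h1.unique (J_deriv _ α)

lemma J_Src (α : ℝ) : J α (Src Γ) = 0 := by
  have : Src Γ = dT (-(tt Γ * kp Γ * y1) - d0 (kp Γ) * y2) := by
    simp only [dT_def, map_sub, map_neg, dmul, d1_kp, d2_kp, d1_tt, d2_tt, d1_dkp, d2_dkp, d1_y1, d1_y2, d2_y1, d2_y2, Src]; ring
  rw [this, J_dT]

lemma SB_q1 : SB 1 (fun i : Dat Γ => qq i - 1) := by
  have h : SB (0 + 1) (fun i : Dat Γ => i.ε ^ 1 • (kp Γ * y1 * qq i)) := ((SB_const _).mul0 SB_qq).epow 1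
  refine h.zcongr (qq_spec.mono fun i hi => ?_)
  have := hi.1.smul (-1)
  convert this using 1
  rw [BB, pow_one]
  simp only [Algebra.smul_def]; simp; ring

def XX (i : Dat Γ) : Fn Γ.ℓ := i.ε • ((qq i ^ 2 - 1) * Src Γ) - d0 ((qq i - 1) * DD Γ (psi i))

lemma SB_XX : SB 2 (XX (Γ := Γ)) := by
  have h1 : SB (1 + 1) (fun i : Dat Γ => i.ε ^ 1 • ((qq i - 1) * ((qq i + 1) * Src Γ))) := by
    have := (SB_q1.mul (((SB_qq (Γ := Γ)).add (SB_const 1)).mul0 (SB_const (Src Γ)))).epow 1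
    simpa using this
  have h2 : SB (1 + 1) (fun i : Dat Γ => (qq i - 1) * DD Γ (psi i)) := SB_q1.mul SB1_psi.DD
  exact (h1.sub h2.d0).congr fun i => by rw [XX, pow_one]; congr 2; ring

lemma J_XX : ∀ᶠ i in FF Γ, ∀ α, J α (d0 (d0 (psi i))) = J α (XX i) := by
  filter_upwards [eqW] with i hi α
  have hε := i.hε
  have h1 : J α (BB Γ i.ε * Lap i.u - i.ε • (kp Γ * d1 i.u)) = 0 := by
    have h2 := J_div α (BB Γ i.ε * d1 i.u) (BB Γ i.ε * d2 i.u)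
    have e1 : d1 (BB Γ i.ε * d1 i.u) + d2 (BB Γ i.ε * d2 i.u) = BB Γ i.ε * Lap i.u - i.ε • (kp Γ * d1 i.u) := by
      simp only [BB, Lap, dmul, map_sub, Derivation.map_one_eq_zero, Derivation.map_smul, d1_kp, d2_kp, d1_y1, d2_y1]
      simp only [Algebra.smul_def]; ring
    have e2 : y1 * (BB Γ i.ε * d1 i.u) + y2 * (BB Γ i.ε * d2 i.u) = BB Γ i.ε * dS i.u := by rw [dS_def]; ring
    rw [e1, e2] at h2
    rw [h2]
    exact Ci_CZ ((i.neu α).mul_left _)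
  have h3 := ZD.Jeq hi α
  rw [map_add, h1, zero_add, map_smul, map_smul, J_DD] at h3
  have h4 : J α (d0 (qq i * DD Γ i.u)) = i.ε * J α (qq i ^ 2 * Src Γ) := by
    have : i.ε ^ 2 * J α (d0 (qq i * DD Γ i.u)) = i.ε ^ 2 * (i.ε * J α (qq i ^ 2 * Src Γ)) := by
      simp only [smul_eq_mul] at h3; rw [h3]; ring
    exact mul_left_cancel₀ (by positivity) this
  have h5 : J α (d0 (DD Γ i.u)) = J α (d0 (d0 i.u)) := by
    exact J_it (fun α => J_DD α i.u) 1 α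
  rw [XX, map_sub, map_smul, sub_mul, sub_mul, map_sub, map_sub, map_sub, one_mul, one_mul, J_Src, psi, h4, h5, smul_eq_mul]
  ring

lemma SB2_psi : SB 2 (psi (Γ := Γ)) := by
  have hℓ := Γ.hℓ
  have hJ2 : ∀ j, ∃ C : ℝ, ∀ᶠ i in FF Γ, ∀ α, |J α (dz (j + 2) psi i)| ≤ C * i.ε ^ 2 := by
    intro j
    obtain ⟨C, hC⟩ := (SB_XX (Γ := Γ).it j) 0
    refine ⟨π * C, ?_⟩
    filter_upwards [hC, J_XX] with i h1 h2 α
    have h3 := J_it h2 j α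
    have h4 : dz (j + 2) psi i = (⇑d0)^[j] (d0 (d0 (psi i))) := by
      rw [dz, Function.iterate_add_apply]; rfl
    rw [h4, h3, mul_assoc]
    exact J_abs (fun a b hab => h1 α a b hab)
  have hJ1 : ∃ C : ℝ, ∀ᶠ i in FF Γ, ∀ α, |J α (dz 1 psi i)| ≤ C * i.ε ^ 2 := by
    obtain ⟨C, hC⟩ := hJ2 0
    refine ⟨Γ.ℓ * C, hC.mono fun i hi α => ?_⟩
    rw [mul_assoc]
    exact J_mean hℓ (II_d0 _) hi α
  have hJ0 : ∃ C : ℝ, ∀ᶠ i in FF Γ, ∀ α, |J α (dz 0 psi i)| ≤ C * i.ε ^ 2 := by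
    obtain ⟨C, hC⟩ := hJ1
    refine ⟨Γ.ℓ * C, hC.mono fun i hi α => ?_⟩
    rw [mul_assoc]
    exact J_mean hℓ i.mean hi α
  have hJ : ∀ j, ∃ C : ℝ, ∀ᶠ i in FF Γ, ∀ α, |J α (dz j psi i)| ≤ C * i.ε ^ 2 := by
    intro j
    match j with
    | 0 => exact hJ0
    | 1 => exact hJ1
    | j + 2 => exact hJ2 j
  obtain ⟨hL, h1, h2⟩ := SB3 (Γ := Γ)
  refine SB_of_sup (h1.weaken (by norm_num)) (h2.weaken (by norm_num)) fun j => ?_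
  obtain ⟨C, hC⟩ := hJ j
  obtain ⟨C', hC'⟩ := osc (s := 2) (w := dz j psi) (fun i α => by simp only [dz, AI_psi i α]) (fun i : Dat Γ => it_NC j i.neu)
    (((hL.weaken (by norm_num)).it j).congr fun i => it_Lap j _)
  refine ⟨C / π + 2 * C', ?_⟩
  filter_upwards [hC, hC'] with i a1 a2 α a b hab
  set W := dz j psi i with hW
  have hp := pi_pos
  have b1 := J_abs (f := W - (ev (α, 1, 0) W) • 1) (α := α) (C := C' * i.ε ^ 2) fun a b hab => by
    simpa using a2 α a b hab
  rw [map_sub, map_smul, J_one, smul_eq_mul] at b1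
  have b2 : |ev (α, 1, 0) W| ≤ C / π * i.ε ^ 2 + C' * i.ε ^ 2 := by
    have b3 : |ev (α, 1, 0) W * π| ≤ C * i.ε ^ 2 + π * (C' * i.ε ^ 2) := by
      calc _ = |J α W - (J α W - ev (α, 1, 0) W * π)| := by ring_nf
        _ ≤ |J α W| + |J α W - ev (α, 1, 0) W * π| := abs_sub _ _
        _ ≤ _ := add_le_add (a1 α) b1
    rw [abs_mul, abs_of_pos hp, ← le_div_iff₀ hp] at b3
    refine b3.trans (le_of_eq ?_)
    field_simp
  calc _ = |(ev (α, a, b) W - ev (α, 1, 0) W) + ev (α, 1, 0) W| := by ring_nf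
    _ ≤ |ev (α, a, b) W - ev (α, 1, 0) W| + |ev (α, 1, 0) W| := abs_add_le _ _
    _ ≤ C' * i.ε ^ 2 + (C / π * i.ε ^ 2 + C' * i.ε ^ 2) := add_le_add (a2 α a b hab) b2
    _ = _ := by ring

end Gam
end

section

variable {ℓ : ℝ}

section Gam
variable {Γ : FramedCurve}

def R2 : Fn ℓ := y1 ^ 2 + y2 ^ 2
def Qd (Γ : FramedCurve) : Fn Γ.ℓ := (2:ℝ) • (tt Γ * kp Γ ^ 2 * y1 * y2) - kp Γ * d0 (kp Γ) * (y1 ^ 2 - y2 ^ 2)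
def f0 (Γ : FramedCurve) : Fn Γ.ℓ := (8⁻¹ : ℝ) • ((R2 - (3:ℝ) • 1) * Src Γ)
def f1 (Γ : FramedCurve) : Fn Γ.ℓ := (13 / 96 : ℝ) • ((R2 - (2:ℝ) • 1) * Qd Γ)

lemma d1_Src : d1 (Src Γ) = - d0 (kp Γ) := by
  simp only [Src, map_sub, dmul, d1_kp, d1_tt, d1_dkp, d1_y1, d1_y2]; ring
lemma d2_Src : d2 (Src Γ) = tt Γ * kp Γ := by
  simp only [Src, map_sub, dmul, d2_kp, d2_tt, d2_dkp, d2_y1, d2_y2]; ring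
lemma d1_R2 : d1 (R2 : Fn ℓ) = (2:ℝ) • y1 := by
  simp only [R2, sq, map_add, dmul, d1_y1, d1_y2, two_smul]; ring
lemma d2_R2 : d2 (R2 : Fn ℓ) = (2:ℝ) • y2 := by
  simp only [R2, sq, map_add, dmul, d2_y1, d2_y2, two_smul]; ring
lemma d1_Qd : d1 (Qd Γ) = (2:ℝ) • (tt Γ * kp Γ ^ 2 * y2) - (2:ℝ) • (kp Γ * d0 (kp Γ) * y1) := by
  simp only [Qd, sq, map_sub, dmul, d1_kp, d1_tt, d1_dkp, d1_y1, d1_y2, Derivation.map_smul]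
  simp only [Algebra.smul_def, map_ofNat]; ring
lemma d2_Qd : d2 (Qd Γ) = (2:ℝ) • (tt Γ * kp Γ ^ 2 * y1) + (2:ℝ) • (kp Γ * d0 (kp Γ) * y2) := by
  simp only [Qd, sq, map_sub, dmul, d2_kp, d2_tt, d2_dkp, d2_y1, d2_y2, Derivation.map_smul]
  simp only [Algebra.smul_def, map_ofNat]; ring
lemma Lap_f0 : Lap (f0 Γ) = Src Γ := by
  apply Fn.ext'
  intro p
  simp only [f0, Lap, dmul, Derivation.map_smul, map_sub, map_add, map_neg, d1_Src, d2_Src, d1_R2, d2_R2, Derivation.map_one_eq_zero, smul_zero, d1_y1, d2_y2, d2_tt, d2_kp, d1_dkp]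
  simp only [Src, R2, map_mul, map_add, map_sub, map_neg, map_smul, map_pow, smul_eq_mul, map_one, map_zero]
  ring
lemma Lap_Qd : Lap (Qd Γ) = 0 := by
  simp only [Lap, d1_Qd, d2_Qd, sq, Derivation.map_smul, map_add, map_sub, dmul, d1_tt, d1_kp, d1_dkp, d2_tt, d2_kp, d2_dkp, d1_y1, d1_y2, d2_y1, d2_y2, two_smul]
  ring
lemma Lap_f1 : Lap (f1 Γ) = (13 / 8 : ℝ) • Qd Γ := by
  have h : Lap ((R2 - (2:ℝ) • 1 : Fn Γ.ℓ)) = (4:ℝ) • 1 := by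
    apply Fn.ext'; intro p
    simp only [Lap, map_sub, d1_R2, d2_R2, Derivation.map_smul, Derivation.map_one_eq_zero, smul_zero, d1_y1, d2_y2, sub_zero, map_add, map_smul, map_one, smul_eq_mul]
    norm_num
  rw [f1, Lap_smul, Lap_mul, Lap_Qd, h]
  apply Fn.ext'; intro p
  simp only [map_sub, d1_R2, d2_R2, Derivation.map_smul, Derivation.map_one_eq_zero, smul_zero, sub_zero, d1_Qd, d2_Qd]
  simp only [Qd, map_mul, map_add, map_sub, map_neg, map_smul, map_pow, smul_eq_mul, map_one, map_zero, map_ofNat]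
  ring
lemma NC_f0 : NC (f0 Γ) := by
  intro α θ
  have hc := Real.sin_sq_add_cos_sq θ
  have : dS (f0 Γ) = (3 / 8 : ℝ) • ((R2 - 1) * Src Γ) := by
    apply Fn.ext'; intro p
    simp only [f0, dS_def, dmul, Derivation.map_smul, map_sub, map_add, map_neg, d1_Src, d2_Src, d1_R2, d2_R2, Derivation.map_one_eq_zero, smul_zero]
    simp only [Src, R2, map_mul, map_add, map_sub, map_neg, map_smul, map_pow, smul_eq_mul, map_one, map_zero]
    ring
  rw [this]
  have h2 : ev (α, cos θ, sin θ) (R2 - 1 : Fn Γ.ℓ) = 0 := by simp [R2]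
  rw [map_smul, map_mul, h2]; simp
lemma NC_f1 : NC (f1 Γ) := by
  intro α θ
  have : dS (f1 Γ) = (13 / 24 : ℝ) • ((R2 - 1) * Qd Γ) := by
    apply Fn.ext'; intro p
    simp only [f1, dS_def, dmul, Derivation.map_smul, map_sub, map_add, map_neg, d1_Qd, d2_Qd, d1_R2, d2_R2, Derivation.map_one_eq_zero, smul_zero]
    simp only [Qd, R2, map_mul, map_add, map_sub, map_neg, map_smul, map_pow, smul_eq_mul, map_one, map_zero]
    ring
  rw [this]
  have h2 : ev (α, cos θ, sin θ) (R2 - 1 : Fn Γ.ℓ) = 0 := by simp [R2]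
  rw [map_smul, map_mul, h2]; simp
lemma NC.smul {u : Fn ℓ} (c : ℝ) (h : NC u) : NC (c • u) := by
  intro α θ
  rw [Derivation.map_smul, map_smul, h α θ, smul_zero]

def w0 (i : Dat Γ) : Fn Γ.ℓ := psi i - i.ε ^ 3 • f0 Γ
def w1 (i : Dat Γ) : Fn Γ.ℓ := psi i - i.ε ^ 3 • f0 Γ - i.ε ^ 4 • f1 Γ

lemma Lap_w0 : SB 4 (fun i : Dat Γ => Lap (w0 i)) := by
  obtain ⟨_, h1, _⟩ := SB3 (Γ := Γ)
  have a1 : SB (1 + 3) (fun i : Dat Γ => i.ε ^ 3 • ((qq i - 1) * ((qq i * qq i + qq i + 1) * Src Γ))) := by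
    have := (SB_q1.mul ((((SB_qq (Γ := Γ).mul0 SB_qq).add SB_qq).add (SB_const 1)).mul0 (SB_const (Src Γ)))).epow 3
    simpa using this
  have a2 : SB (3 + 1) (fun i : Dat Γ => i.ε ^ 1 • (kp Γ * qq i * d1 (psi i))) :=
    (((SB_const (kp Γ)).mul0 SB_qq).mul0 h1).epow 1
  have a3 : SB (2 + 2) (fun i : Dat Γ => i.ε ^ 2 • (qq i * DD Γ (qq i * DD Γ (psi i)))) :=
    (SB_qq.mul0 (SB.DD (SB_qq.mul0 SB2_psi.DD))).epow 2
  refine ((a1.add a2).sub a3).zcongr (eqR.mono fun i hi => ?_)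
  have := hi.smul (-1)
  convert this using 1
  rw [w0, Lap_sub, Lap_smul, Lap_f0, RR, psi]
  simp only [Algebra.smul_def, map_pow, map_neg, map_one]; ring

lemma AI_w0 : AI (w0 (Γ := Γ)) := fun _ _ => rfl
lemma AI_w1 : AI (w1 (Γ := Γ)) := fun _ _ => rfl
lemma NC_w0 (i : Dat Γ) : NC (w0 i) := NC.sub i.neu (NC_f0.smul _)
lemma NC_w1 (i : Dat Γ) : NC (w1 i) := NC.sub (NC_w0 i) (NC_f1.smul _)

lemma SB4_w0 : SB 4 (fun i : Dat Γ => d1 (w0 i)) ∧ SB 4 (fun i : Dat Γ => d2 (w0 i)) :=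
  SB_grad AI_w0 NC_w0 Lap_w0

lemma SB3_dT : SB 3 (fun i : Dat Γ => dT (psi i)) := by
  obtain ⟨_, h1, h2⟩ := SB3 (Γ := Γ)
  exact (((SB_const y1).mul0 h2).sub ((SB_const y2).mul0 h1)).congr fun i => (dT_def _).symm

lemma Zid : dT ((3:ℝ) • (kp Γ * y1 * Src Γ) + kp Γ * d1 (f0 Γ) - (13 / 8 : ℝ) • Qd Γ) = 0 := by
  have : (3:ℝ) • (kp Γ * y1 * Src Γ) + kp Γ * d1 (f0 Γ) - (13 / 8 : ℝ) • Qd Γ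
      = kp Γ * d0 (kp Γ) * (- (7 / 4 : ℝ) • R2 + (3 / 8 : ℝ) • 1) := by
    apply Fn.ext'; intro p
    simp only [f0, dmul, Derivation.map_smul, map_sub, map_add, map_neg, d1_Src, d1_R2, Derivation.map_one_eq_zero, smul_zero]
    simp only [Src, Qd, R2, map_mul, map_add, map_sub, map_neg, map_smul, map_pow, smul_eq_mul, map_one, map_zero]
    ring
  rw [this, dT_def]
  simp only [dmul, map_add, map_neg, neg_smul, Derivation.map_smul, d1_R2, d2_R2, d1_kp, d2_kp, d1_dkp, d2_dkp, Derivation.map_one_eq_zero, smul_zero]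
  simp only [Algebra.smul_def]; ring

lemma Lap_w1 : SB 5 (fun i : Dat Γ => Lap (dT (w1 i))) := by
  obtain ⟨_, h1, _⟩ := SB3 (Γ := Γ)
  have q1 := SB_q1 (Γ := Γ)
  have q0 := SB_qq (Γ := Γ)
  -- (q - 1 - ε κ y₁) = O(ε²)
  have b1 : SB 2 (fun i : Dat Γ => qq i - 1 - i.ε • (kp Γ * y1)) := by
    have h : SB (1 + 1) (fun i : Dat Γ => i.ε ^ 1 • (kp Γ * y1 * (qq i - 1))) := ((SB_const _).mul0 q1).epow 1
    refine h.zcongr (qq_spec.mono fun i hi => ?_)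
    have := hi.1.smul (-1)
    convert this using 1
    rw [BB, pow_one]
    simp only [Algebra.smul_def]; simp; ring
  have a1 : SB (2 + 3) (fun i : Dat Γ => i.ε ^ 3 • ((3:ℝ) • ((qq i - 1 - i.ε • (kp Γ * y1)) * Src Γ)
      + (qq i - 1) * (qq i - 1) * ((qq i + (2:ℝ) • 1) * Src Γ))) := by
    have c1 : SB 2 (fun i : Dat Γ => (3:ℝ) • ((qq i - 1 - i.ε • (kp Γ * y1)) * Src Γ)) :=
      (b1.mul (SB_const (Src Γ))).csmul 3
    have c2 : SB 2 (fun i : Dat Γ => (qq i - 1) * (qq i - 1) * ((qq i + (2:ℝ) • 1) * Src Γ)) :=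
      (q1.mul q1).mul ((q0.add (SB_const _)).mul0 (SB_const (Src Γ)))
    exact (c1.add c2).epow 3
  have a2 : SB (4 + 1) (fun i : Dat Γ => i.ε ^ 1 • (kp Γ * (qq i - 1) * d1 (psi i) + kp Γ * d1 (w0 i))) := by
    have c1 : SB 4 (fun i : Dat Γ => kp Γ * (qq i - 1) * d1 (psi i)) :=
      (((SB_const (kp Γ)).mul0 q1).mul h1)
    exact (c1.add ((SB_const (kp Γ)).mul0 SB4_w0.1)).epow 1
  have a3 : SB (3 + 2) (fun i : Dat Γ => i.ε ^ 2 • ((qq i - 1) * DD Γ (qq i * DD Γ (psi i)) + DD Γ ((qq i - 1) * DD Γ (psi i)))) := by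
    have c1 : SB 3 (fun i : Dat Γ => (qq i - 1) * DD Γ (qq i * DD Γ (psi i))) := q1.mul (SB.DD (q0.mul0 SB2_psi.DD))
    have c2 : SB 3 (fun i : Dat Γ => (qq i - 1) * DD Γ (psi i)) := q1.mul SB2_psi.DD
    exact (c1.add c2.DD).epow 2
  have a4 : SB (3 + 2) (fun i : Dat Γ => i.ε ^ 2 • DD Γ (DD Γ (dT (psi i)))) := (SB3_dT.DD.DD).epow 2
  refine ((((a1.add a2).sub a3).dT).sub a4).zcongr (eqR.mono fun i hi => ?_)
  have h5 : DD Γ (DD Γ (dT (psi i))) = dT (DD Γ (DD Γ (psi i))) := by rw [DD_dT, DD_dT]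
  have h6 : Lap (dT (w1 i)) = dT (Lap (psi i) - i.ε ^ 3 • Src Γ - i.ε ^ 4 • ((13 / 8 : ℝ) • Qd Γ)
      + i.ε ^ 4 • ((13 / 8 : ℝ) • Qd Γ - (3:ℝ) • (kp Γ * y1 * Src Γ) - kp Γ * d1 (f0 Γ))) := by
    rw [Lap_dT, w1, Lap_sub, Lap_sub, Lap_smul, Lap_smul, Lap_f0, Lap_f1]
    conv_rhs => rw [map_add, Derivation.map_smul (D := dT) (r := i.ε ^ 4) (a := (13 / 8 : ℝ) • Qd Γ - (3:ℝ) • (kp Γ * y1 * Src Γ) - kp Γ * d1 (f0 Γ))]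
    have := Zid (Γ := Γ)
    have e : (13 / 8 : ℝ) • Qd Γ - (3:ℝ) • (kp Γ * y1 * Src Γ) - kp Γ * d1 (f0 Γ) = - ((3:ℝ) • (kp Γ * y1 * Src Γ) + kp Γ * d1 (f0 Γ) - (13 / 8 : ℝ) • Qd Γ) := by ring
    rw [e, map_neg, this]; simp
  rw [h6, h5, ← Derivation.map_smul, ← map_sub, ← map_sub]
  have h7 := (hi.smul (-1)).dT
  convert h7 using 2
  have e8 : (qq i - 1) * DD Γ (psi i) = qq i * DD Γ (psi i) - DD Γ (psi i) := by ring
  rw [e8, map_sub (DD Γ)]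
  rw [RR, w0, psi, map_sub d1, Derivation.map_smul]
  simp only [Algebra.smul_def, map_pow, map_neg, map_one, map_ofNat]; ring

lemma SB5_w1 : SB 5 (fun i : Dat Γ => dT (w1 i)) := by
  have hA : AI (fun i : Dat Γ => dT (w1 i)) := fun _ _ => rfl
  have hN : ∀ i : Dat Γ, NC (dT (w1 i)) := fun i => (NC_w1 i).dT
  obtain ⟨h1, h2⟩ := SB_grad hA hN Lap_w1
  refine SB_of_sup h1 h2 fun j => ?_
  obtain ⟨C', hC'⟩ := osc (s := 5) (w := dz j (fun i : Dat Γ => dT (w1 i))) (fun i α => rfl) (fun i : Dat Γ => it_NC j (hN i))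
    ((Lap_w1.it j).congr fun i => it_Lap j _)
  refine ⟨2 * C', hC'.mono fun i hi α a b hab => ?_⟩
  have h0 : ev (α, 0, 0) (dz j (fun i : Dat Γ => dT (w1 i)) i) = 0 := by
    show ev (α,0,0) ((⇑d0)^[j] (dT (w1 i))) = 0
    rw [it_dT, dT_def]; simp
  have e1 := hi α 0 0 (by norm_num)
  have e2 := hi α a b hab
  rw [h0, zero_sub, abs_neg] at e1
  set x := ev (α, a, b) (dz j (fun i : Dat Γ => dT (w1 i)) i)
  set y := ev (α, 1, 0) (dz j (fun i : Dat Γ => dT (w1 i)) i)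
  calc |x| = |(x - y) + y| := by ring_nf
    _ ≤ |x - y| + |y| := abs_add_le _ _
    _ ≤ _ := by linarith

end Gam
end

section

variable {ℓ : ℝ}

lemma fderiv_split (u : Fn ℓ) : fderiv ℝ u.1 = fun q =>
    (ContinuousLinearMap.toSpanSingleton ℝ (ContinuousLinearMap.fst ℝ ℝ (ℝ × ℝ))) ((d0 u).1 q)
    + ((ContinuousLinearMap.toSpanSingleton ℝ ((ContinuousLinearMap.fst ℝ ℝ ℝ).comp (ContinuousLinearMap.snd ℝ ℝ (ℝ × ℝ)))) ((d1 u).1 q)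
    + (ContinuousLinearMap.toSpanSingleton ℝ ((ContinuousLinearMap.snd ℝ ℝ ℝ).comp (ContinuousLinearMap.snd ℝ ℝ (ℝ × ℝ)))) ((d2 u).1 q)) := by
  funext q
  ext
  · show fderiv ℝ u.1 q (1, 0) = _
    have : (d0 u).1 q = fderiv ℝ u.1 q (1, 0) := rfl
    simp [this]
  · show fderiv ℝ u.1 q (0, (1, 0)) = _
    have : (d1 u).1 q = fderiv ℝ u.1 q (0, 1, 0) := rfl
    simp [this]
  · show fderiv ℝ u.1 q (0, (0, 1)) = _
    have : (d2 u).1 q = fderiv ℝ u.1 q (0, 0, 1) := rfl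
    simp [this]

lemma norm_tss {L : P3 →L[ℝ] ℝ} (hL : ‖L‖ ≤ 1) (v : Fn ℓ) (n : ℕ) (p : P3) :
    ‖iteratedFDeriv ℝ n (⇑(ContinuousLinearMap.toSpanSingleton ℝ L) ∘ v.1) p‖ ≤ ‖iteratedFDeriv ℝ n v.1 p‖ := by
  refine (ContinuousLinearMap.norm_iteratedFDeriv_comp_left _ (N := (⊤ : ℕ∞)) v.smooth.contDiffAt
    (WithTop.coe_le_coe.2 le_top)).trans ?_
  rw [ContinuousLinearMap.norm_toSpanSingleton]
  exact mul_le_of_le_one_left (norm_nonneg _) hL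

lemma norm_it (n : ℕ) (u : Fn ℓ) (p : P3) : ‖iteratedFDeriv ℝ (n + 1) u.1 p‖ ≤
    ‖iteratedFDeriv ℝ n (d0 u).1 p‖ + (‖iteratedFDeriv ℝ n (d1 u).1 p‖ + ‖iteratedFDeriv ℝ n (d2 u).1 p‖) := by
  have hs : ∀ (L : P3 →L[ℝ] ℝ) (v : Fn ℓ), ContDiff ℝ n (⇑(ContinuousLinearMap.toSpanSingleton ℝ L) ∘ v.1) :=
    fun L v => (ContinuousLinearMap.contDiff _).comp (v.smooth.of_le (WithTop.coe_le_coe.2 le_top))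
  have h1 : ‖ContinuousLinearMap.fst ℝ ℝ (ℝ × ℝ)‖ ≤ 1 := ContinuousLinearMap.norm_fst_le ..
  have h2 : ‖(ContinuousLinearMap.fst ℝ ℝ ℝ).comp (ContinuousLinearMap.snd ℝ ℝ (ℝ × ℝ))‖ ≤ 1 :=
    (ContinuousLinearMap.opNorm_comp_le _ _).trans (mul_le_one₀ (ContinuousLinearMap.norm_fst_le ..) (norm_nonneg _) (ContinuousLinearMap.norm_snd_le ..))
  have h3 : ‖(ContinuousLinearMap.snd ℝ ℝ ℝ).comp (ContinuousLinearMap.snd ℝ ℝ (ℝ × ℝ))‖ ≤ 1 :=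
    (ContinuousLinearMap.opNorm_comp_le _ _).trans (mul_le_one₀ (ContinuousLinearMap.norm_snd_le ..) (norm_nonneg _) (ContinuousLinearMap.norm_snd_le ..))
  rw [← norm_iteratedFDeriv_fderiv, fderiv_split]
  have e : ∀ f g : P3 → (P3 →L[ℝ] ℝ), ContDiff ℝ n f → ContDiff ℝ n g →
      ‖iteratedFDeriv ℝ n (f + g) p‖ ≤ ‖iteratedFDeriv ℝ n f p‖ + ‖iteratedFDeriv ℝ n g p‖ := by
    intro f g hf hg
    rw [iteratedFDeriv_add_apply hf.contDiffAt hg.contDiffAt]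
    exact norm_add_le _ _
  refine (e _ _ (hs _ _) ((hs _ _).add (hs _ _))).trans (add_le_add (norm_tss h1 _ _ _) ?_)
  exact (e _ _ (hs _ _) (hs _ _)).trans (add_le_add (norm_tss h2 _ _ _) (norm_tss h3 _ _ _))

section Gam
variable {Γ : FramedCurve}

lemma FDB {s : ℕ} : ∀ (n : ℕ) {w : Dat Γ → Fn Γ.ℓ}, SBk n s w →
    ∃ C : ℝ, ∀ᶠ i in FF Γ, ∀ p ∈ domC, ∀ j ≤ n, ‖iteratedFDeriv ℝ j (w i).1 p‖ ≤ C * i.ε ^ s := by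
  intro n
  induction n with
  | zero =>
    rintro w ⟨C, hC⟩
    refine ⟨C, hC.mono fun i hi p hp j hj => ?_⟩
    obtain rfl : j = 0 := by omega
    rw [norm_iteratedFDeriv_zero]
    exact hi p.1 p.2.1 p.2.2 hp
  | succ n ih =>
    rintro w ⟨h, h0, h1, h2⟩
    obtain ⟨C, hC⟩ := ih h
    obtain ⟨C0, hC0⟩ := ih h0
    obtain ⟨C1, hC1⟩ := ih h1
    obtain ⟨C2, hC2⟩ := ih h2
    refine ⟨max C (C0 + (C1 + C2)), ?_⟩
    filter_upwards [hC, hC0, hC1, hC2] with i a a0 a1 a2 p hp j hj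
    have he : 0 ≤ i.ε ^ s := pow_nonneg i.hε.le _
    rcases Nat.lt_or_ge n j with hnj | hnj
    · obtain rfl : j = n + 1 := by omega
      refine (norm_it n (w i) p).trans ?_
      have := mul_le_mul_of_nonneg_right (le_max_right C (C0 + (C1 + C2))) he
      linarith [a0 p hp n le_rfl, a1 p hp n le_rfl, a2 p hp n le_rfl]
    · have := mul_le_mul_of_nonneg_right (le_max_left C (C0 + (C1 + C2))) he
      linarith [a p hp j hnj]

lemma FF_ev {P : Dat Γ → Prop} (h : ∀ᶠ i in FF Γ, P i) : ∃ ε₀ > 0, ∀ i : Dat Γ, i.ε < ε₀ → P i := by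
  rw [FF, eventually_comap, Metric.eventually_nhds_iff] at h
  obtain ⟨e, he, h⟩ := h
  refine ⟨e, he, fun i hi => h (y := i.ε) ?_ i rfl⟩
  rw [Real.dist_eq, sub_zero, abs_of_pos i.hε]; exact hi

lemma ev_kp (p : P3) : ev p (kp Γ) = Γ.κ p.1 := rfl
lemma ev_tt (p : P3) : ev p (tt Γ) = Γ.τ p.1 := rfl
lemma ev_dkp (p : P3) : ev p (d0 (kp Γ)) = deriv Γ.κ p.1 := by rw [kp, d0_ofA]; rfl
lemma phi0_eq (ε : ℝ) : phi0 Γ ε = (ε ^ 3 • f0 Γ : Fn Γ.ℓ).1 := by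
  funext p
  show _ = ev p (ε ^ 3 • f0 Γ : Fn Γ.ℓ)
  simp only [f0, Src, R2, map_mul, map_add, map_sub, map_neg, map_smul, map_pow, smul_eq_mul, map_one, ev_dkp, ev_y1, ev_y2, ev_kp, ev_tt, phi0]
  ring
lemma phi1_eq (ε : ℝ) : phi1 Γ ε = (ε ^ 4 • f1 Γ : Fn Γ.ℓ).1 := by
  funext p
  show _ = ev p (ε ^ 4 • f1 Γ : Fn Γ.ℓ)
  simp only [f1, Qd, R2, map_mul, map_add, map_sub, map_neg, map_smul, map_pow, smul_eq_mul, map_one, ev_dkp, ev_y1, ev_y2, ev_kp, ev_tt, phi1]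
  ring

end Gam
end

section

variable {ℓ : ℝ}
section Gam
variable {Γ : FramedCurve} {ε : ℝ}

def XT (Γ : FramedCurve) (ε : ℝ) : P3 → E3 := fun p => tubeCoord Γ ε p.1 (p.2.1, p.2.2)

lemma sm_γ : ContDiff ℝ (⊤ : ℕ∞) Γ.γ := contDiff_iff_contDiffAt.2 fun t => (Γ.analytic_γ t).contDiffAt
lemma sm_γ' : ContDiff ℝ (⊤ : ℕ∞) (deriv Γ.γ) :=
  (contDiff_infty_iff_deriv.1 (sm_γ (Γ := Γ))).2

lemma XT_smooth : ContDiff ℝ (⊤ : ℕ∞) (XT Γ ε) := by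
  have h0 := sm_γ (Γ := Γ)
  have h1 := Γ.smooth_e₁
  have h2 := Γ.smooth_e₂
  unfold XT tubeCoord
  fun_prop

lemma XT_per (p : P3) : XT Γ ε (p.1 + Γ.ℓ, p.2.1, p.2.2) = XT Γ ε p := by
  simp only [XT, tubeCoord, Γ.periodic_γ p.1, Γ.periodic_e₁ p.1, Γ.periodic_e₂ p.1]

lemma hd_γ (t : ℝ) : HasDerivAt Γ.γ (deriv Γ.γ t) t := (sm_γ.differentiable (by simp) t).hasDerivAt
lemma hd_γ' (t : ℝ) : HasDerivAt (deriv Γ.γ) (Γ.κ t • Γ.e₁ t) t := by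
  rw [← Γ.frenet₁]; exact (sm_γ'.differentiable (by simp) t).hasDerivAt
lemma hd_e₁ (t : ℝ) : HasDerivAt Γ.e₁ (Γ.τ t • Γ.e₂ t - Γ.κ t • deriv Γ.γ t) t := by
  rw [← Γ.frenet₂]; exact (Γ.smooth_e₁.differentiable (by simp) t).hasDerivAt
lemma hd_e₂ (t : ℝ) : HasDerivAt Γ.e₂ (-(Γ.τ t) • Γ.e₁ t) t := by
  rw [← Γ.frenet₃]; exact (Γ.smooth_e₂.differentiable (by simp) t).hasDerivAt

/-- derivative of a function of the slow variable -/
lemma hf_slow {E : Type*} [NormedAddCommGroup E] [NormedSpace ℝ E] {f : ℝ → E} {f' : E} {p : P3} (h : HasDerivAt f f' p.1) :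
    HasFDerivAt (fun q : P3 => f q.1) ((ContinuousLinearMap.fst ℝ ℝ (ℝ × ℝ)).smulRight f') p := by
  have := h.hasFDerivAt.comp p (hasFDerivAt_fst (𝕜 := ℝ) (p := p))
  have e : (ContinuousLinearMap.fst ℝ ℝ (ℝ × ℝ)).smulRight f' =
    (ContinuousLinearMap.toSpanSingleton ℝ f').comp (ContinuousLinearMap.fst ℝ ℝ (ℝ × ℝ)) := by
    ext <;> simp
  rw [e]; exact this

lemma hf_y1 (p : P3) : HasFDerivAt (fun q : P3 => q.2.1) ((ContinuousLinearMap.fst ℝ ℝ ℝ).comp (ContinuousLinearMap.snd ℝ ℝ (ℝ × ℝ))) p :=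
  ((ContinuousLinearMap.fst ℝ ℝ ℝ).comp (ContinuousLinearMap.snd ℝ ℝ (ℝ × ℝ))).hasFDerivAt
lemma hf_y2 (p : P3) : HasFDerivAt (fun q : P3 => q.2.2) ((ContinuousLinearMap.snd ℝ ℝ ℝ).comp (ContinuousLinearMap.snd ℝ ℝ (ℝ × ℝ))) p :=
  ((ContinuousLinearMap.snd ℝ ℝ ℝ).comp (ContinuousLinearMap.snd ℝ ℝ (ℝ × ℝ))).hasFDerivAt

lemma XT_fderiv (p e : P3) : fderiv ℝ (XT Γ ε) p e =
    e.1 • ((1 - ε * Γ.κ p.1 * p.2.1) • deriv Γ.γ p.1 + (ε * Γ.τ p.1) • (p.2.1 • Γ.e₂ p.1 - p.2.2 • Γ.e₁ p.1))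
    + (ε * e.2.1) • Γ.e₁ p.1 + (ε * e.2.2) • Γ.e₂ p.1 := by
  have h := ((hf_slow (hd_γ (Γ := Γ) p.1)).add (((hf_y1 p).const_mul ε).smul (hf_slow (hd_e₁ (Γ := Γ) p.1)))).add
    (((hf_y2 p).const_mul ε).smul (hf_slow (hd_e₂ (Γ := Γ) p.1)))
  have h' : HasFDerivAt (XT Γ ε) _ p := h
  rw [h'.fderiv]
  simp
  module

/-- the direction of the horizontal derivative -/
def eD (Γ : FramedCurve) (p : P3) : P3 := (1, Γ.τ p.1 * p.2.2, - (Γ.τ p.1 * p.2.1))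

lemma XT_eD (p : P3) : fderiv ℝ (XT Γ ε) p (eD Γ p) = (1 - ε * Γ.κ p.1 * p.2.1) • deriv Γ.γ p.1 := by
  rw [XT_fderiv]; simp only [eD]; module
lemma XT_d1 (p : P3) : fderiv ℝ (XT Γ ε) p (0, 1, 0) = ε • Γ.e₁ p.1 := by
  rw [XT_fderiv]; simp
lemma XT_d2 (p : P3) : fderiv ℝ (XT Γ ε) p (0, 0, 1) = ε • Γ.e₂ p.1 := by
  rw [XT_fderiv]; simp

lemma ev_DD (p : P3) (u : Fn Γ.ℓ) : ev p (DD Γ u) = fderiv ℝ u.1 p (eD Γ p) := by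
  have : eD Γ p = (1, 0, 0) + ((Γ.τ p.1 * p.2.2) • ((0, 1, 0) : P3) + (-(Γ.τ p.1 * p.2.1)) • ((0, 0, 1) : P3)) := by
    ext <;> simp [eD]
  rw [this, map_add, map_add, map_smul, map_smul, DD_def, dT_def]
  simp only [map_sub, map_mul, ev_tt, ev_y1, ev_y2, d0, d1, d2, ev_dv, smul_eq_mul]; ring

lemma XT_dist (hε : 0 < ε) (p : P3) : dist (XT Γ ε p) (Γ.γ p.1) ^ 2 = ε ^ 2 * (p.2.1 ^ 2 + p.2.2 ^ 2) := by
  have h : XT Γ ε p - Γ.γ p.1 = (ε * p.2.1) • Γ.e₁ p.1 + (ε * p.2.2) • Γ.e₂ p.1 := by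
    simp only [XT, tubeCoord]; abel
  rw [dist_eq_norm, h, norm_add_sq_real, norm_smul, norm_smul, Γ.unit_e₁, Γ.unit_e₂, real_inner_smul_left,
    real_inner_smul_right, Γ.orth₁₂, Real.norm_eq_abs, Real.norm_eq_abs, mul_pow, mul_pow, sq_abs, sq_abs]
  ring

lemma tube_mem (hε : 0 < ε) {p : P3} (hp : p.2.1 ^ 2 + p.2.2 ^ 2 < 1) : XT Γ ε p ∈ TubeSet Γ ε := by
  refine Metric.mem_thickening_iff.2 ⟨Γ.γ p.1, Set.mem_range_self _, ?_⟩
  refine lt_of_pow_lt_pow_left₀ 2 hε.le ?_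
  rw [XT_dist hε]
  nlinarith [pow_pos hε 2]
lemma tube_cmem (hε : 0 < ε) {p : P3} (hp : p.2.1 ^ 2 + p.2.2 ^ 2 ≤ 1) : XT Γ ε p ∈ closure (TubeSet Γ ε) := by
  rw [TubeSet, closure_thickening hε]
  refine Metric.mem_cthickening_of_dist_le _ (Γ.γ p.1) _ _ (Set.mem_range_self _) ?_
  refine le_of_sq_le_sq ?_ hε.le
  rw [XT_dist hε]
  nlinarith [pow_pos hε 2]

lemma lap_frame {Ψ : E3 → ℝ} {x : E3} (hd : DifferentiableAt ℝ (fderiv ℝ Ψ) x) (t : ℝ) : lap3 Ψ x =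
    fderiv ℝ (fderiv ℝ Ψ) x (deriv Γ.γ t) (deriv Γ.γ t) + fderiv ℝ (fderiv ℝ Ψ) x (Γ.e₁ t) (Γ.e₁ t)
    + fderiv ℝ (fderiv ℝ Ψ) x (Γ.e₂ t) (Γ.e₂ t) := by
  have h1 : lap3 Ψ x = Laplacian.laplacian Ψ x := by
    rw [InnerProductSpace.laplacian_eq_iteratedFDeriv_orthonormalBasis Ψ (EuclideanSpace.basisFun (Fin 3) ℝ)]
    unfold lap3
    refine Finset.sum_congr rfl fun i _ => ?_
    rw [iteratedFDeriv_two_apply]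
    show fderiv ℝ (fun z => fderiv ℝ Ψ z (EuclideanSpace.single i 1)) x _ = _
    rw [fderiv_clm_apply hd (differentiableAt_const _)]
    simp
  have hon : Orthonormal ℝ ![deriv Γ.γ t, Γ.e₁ t, Γ.e₂ t] := by
    constructor
    · intro i; fin_cases i <;> simp [Γ.unit_speed, Γ.unit_e₁, Γ.unit_e₂]
    · intro i j hij
      have a := Γ.orth₀₁ t
      have b := Γ.orth₀₂ t
      have c := Γ.orth₁₂ t
      fin_cases i <;> fin_cases j <;> first | exact absurd rfl hij | (simp; first | exact a | exact b | exact c | (rw [real_inner_comm]; first | exact a | exact b | exact c))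
  have hs : ⊤ ≤ Submodule.span ℝ (Set.range ![deriv Γ.γ t, Γ.e₁ t, Γ.e₂ t]) := by
    rw [hon.linearIndependent.span_eq_top_of_card_eq_finrank (by simp)]
  rw [h1, InnerProductSpace.laplacian_eq_iteratedFDeriv_orthonormalBasis Ψ (OrthonormalBasis.mk hon hs)]
  simp [Fin.sum_univ_three, iteratedFDeriv_two_apply]

end Gam
end

section

variable {ℓ : ℝ}
section Gam
variable {Γ : FramedCurve} {ε : ℝ}

lemma dom_ext (hε : 0 < ε) {Ω : Set E3} (hΩ : IsOpen Ω) (hc : closure (TubeSet Γ ε) ⊆ Ω) :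
    ∃ s : ℝ, 1 < s ∧ ∀ p : P3, p.2.1 ^ 2 + p.2.2 ^ 2 ≤ s ^ 2 → XT Γ ε p ∈ Ω := by
  have hK : IsCompact ((Set.Icc 0 Γ.ℓ) ×ˢ dsk : Set P3) := isCompact_Icc.prod dsk_compact
  have hU : IsOpen (XT Γ ε ⁻¹' Ω) := hΩ.preimage XT_smooth.continuous
  have hKU : ((Set.Icc 0 Γ.ℓ) ×ˢ dsk : Set P3) ⊆ XT Γ ε ⁻¹' Ω := by
    rintro p ⟨_, hp⟩
    exact hc (tube_cmem hε hp)
  obtain ⟨δ, hδ, h⟩ := hK.exists_thickening_subset_open hU hKU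
  refine ⟨1 + δ / 2, by linarith, ?_⟩
  rintro ⟨α, a, b⟩ hp
  replace hp : a ^ 2 + b ^ 2 ≤ (1 + δ / 2) ^ 2 := hp
  have hper : Function.Periodic (fun α => XT Γ ε (α, a, b)) Γ.ℓ := fun α => XT_per (α, a, b)
  obtain ⟨β, hβ, e⟩ := hper.exists_mem_Ico₀ Γ.hℓ α
  rw [e]
  apply h
  set s := 1 + δ / 2 with hs
  have hs0 : 0 < s := by positivity
  have hr : (a / s) ^ 2 + (b / s) ^ 2 ≤ 1 := by
    rw [div_pow, div_pow, ← add_div]; exact (div_le_one (by positivity)).2 hp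
  refine Metric.mem_thickening_iff.2 ⟨(β, a / s, b / s), ⟨⟨hβ.1, hβ.2.le⟩, hr⟩, ?_⟩
  have h1 : ∀ x : ℝ, x ^ 2 ≤ 1 → |s * x - x| < δ := by
    intro x hx
    have : s * x - x = δ / 2 * x := by rw [hs]; ring
    rw [this, abs_mul, abs_of_pos (by positivity : 0 < δ / 2)]
    have := (sq_le_one_iff_abs_le_one x).1 hx
    nlinarith [abs_nonneg x]
  have ea : a = s * (a / s) := by field_simp
  have eb : b = s * (b / s) := by field_simp
  rw [Prod.dist_eq, Prod.dist_eq]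
  simp only [dist_self, Real.dist_eq]
  refine max_lt hδ (max_lt ?_ ?_)
  · have := h1 (a / s) (by nlinarith [sq_nonneg (b / s)])
    rwa [← ea] at this
  · have := h1 (b / s) (by nlinarith [sq_nonneg (a / s)])
    rwa [← eb] at this

lemma ext_exists (hε : 0 < ε) {Ω : Set E3} (hΩ : IsOpen Ω) (hc : closure (TubeSet Γ ε) ⊆ Ω) {Ψ : E3 → ℝ}
    (hΨ : ContDiffOn ℝ (⊤ : ℕ∞) Ψ Ω) :
    ∃ u : Fn Γ.ℓ, ∀ p ∈ domC, u.1 =ᶠ[𝓝 p] pullT Γ ε Ψ := by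
  obtain ⟨s, hs, h⟩ := dom_ext hε hΩ hc
  have hs2 : 0 < s ^ 2 - 1 := by nlinarith
  let χ : P3 → ℝ := fun p => Real.smoothTransition (2 * (s ^ 2 - (p.2.1 ^ 2 + p.2.2 ^ 2)) / (s ^ 2 - 1))
  have hχ : ContDiff ℝ (⊤ : ℕ∞) χ := by
    refine Real.smoothTransition.contDiff.comp ?_
    fun_prop
  refine ⟨⟨fun p => χ p * pullT Γ ε Ψ p, ?_, ?_⟩, ?_⟩
  · rw [contDiff_iff_contDiffAt]
    intro p
    by_cases hp : XT Γ ε p ∈ Ω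
    · have h1 : ContDiffAt ℝ (⊤ : ℕ∞) Ψ (XT Γ ε p) := hΨ.contDiffAt (hΩ.mem_nhds hp)
      exact hχ.contDiffAt.mul (h1.comp p XT_smooth.contDiffAt)
    · have hp' : s ^ 2 < p.2.1 ^ 2 + p.2.2 ^ 2 := by
        by_contra hcon; exact hp (h p (not_lt.1 hcon))
      have ho : ∀ᶠ q : P3 in 𝓝 p, s ^ 2 < q.2.1 ^ 2 + q.2.2 ^ 2 :=
        (isOpen_lt (by fun_prop : Continuous fun q : P3 => s ^ 2) (by fun_prop : Continuous fun q : P3 => q.2.1 ^ 2 + q.2.2 ^ 2)).mem_nhds hp'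
      refine (contDiffAt_const (c := (0:ℝ))).congr_of_eventuallyEq (ho.mono fun q hq => ?_)
      have : χ q = 0 := Real.smoothTransition.zero_of_nonpos
        (div_nonpos_of_nonpos_of_nonneg (by linarith) hs2.le)
      simp [this]
  · intro p
    have : pullT Γ ε Ψ (p.1 + Γ.ℓ, p.2.1, p.2.2) = pullT Γ ε Ψ p := congrArg Ψ (XT_per p)
    simp only [this]; rfl
  · intro p hp
    have hp' : p.2.1 ^ 2 + p.2.2 ^ 2 < (s ^ 2 + 1) / 2 := by
      have : p.2.1 ^ 2 + p.2.2 ^ 2 ≤ 1 := hp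
      linarith
    have ho : ∀ᶠ q : P3 in 𝓝 p, q.2.1 ^ 2 + q.2.2 ^ 2 < (s ^ 2 + 1) / 2 :=
      (isOpen_lt (by fun_prop : Continuous fun q : P3 => q.2.1 ^ 2 + q.2.2 ^ 2) (by fun_prop : Continuous fun q : P3 => (s ^ 2 + 1) / 2)).mem_nhds hp'
    refine ho.mono fun q hq => ?_
    have : χ q = 1 := Real.smoothTransition.one_of_one_le (by rw [le_div_iff₀ hs2]; linarith)
    simp [this]

section Clc
variable {Ω : Set E3} {Ψ : E3 → ℝ}

/-- derivative of `q ↦ dΨ(X q)(V q)` -/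
lemma dG (hΩ : IsOpen Ω) (hΨ : ContDiffOn ℝ (⊤ : ℕ∞) Ψ Ω) {p : P3} (hp : XT Γ ε p ∈ Ω)
    {v : Fn Γ.ℓ} {V : P3 → E3} {V' : P3 →L[ℝ] E3} (hV : HasFDerivAt V V' p)
    (h : v.1 =ᶠ[𝓝 p] fun q => fderiv ℝ Ψ (XT Γ ε q) (V q)) (e : P3) :
    fderiv ℝ v.1 p e = fderiv ℝ (fderiv ℝ Ψ) (XT Γ ε p) (fderiv ℝ (XT Γ ε) p e) (V p)
      + fderiv ℝ Ψ (XT Γ ε p) (V' e) := by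
  have h2 : DifferentiableAt ℝ (fderiv ℝ Ψ) (XT Γ ε p) :=
    ((hΨ.contDiffAt (hΩ.mem_nhds hp)).fderiv_right (m := (⊤ : ℕ∞)) (by simp)).differentiableAt (by simp)
  have hX : HasFDerivAt (XT Γ ε) (fderiv ℝ (XT Γ ε) p) p := (XT_smooth.differentiable (by simp) p).hasFDerivAt
  have := (h2.hasFDerivAt.comp p hX).clm_apply hV
  rw [h.fderiv_eq]
  rw [show (fun q => fderiv ℝ Ψ (XT Γ ε q) (V q)) = fun q => ((fderiv ℝ Ψ) ∘ XT Γ ε) q (V q) from rfl, this.fderiv]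
  simp; ring

lemma dΨ (hΩ : IsOpen Ω) (hΨ : ContDiffOn ℝ (⊤ : ℕ∞) Ψ Ω) {p : P3} (hp : XT Γ ε p ∈ Ω)
    {u : Fn Γ.ℓ} (h : u.1 =ᶠ[𝓝 p] pullT Γ ε Ψ) (e : P3) :
    fderiv ℝ u.1 p e = fderiv ℝ Ψ (XT Γ ε p) (fderiv ℝ (XT Γ ε) p e) := by
  have h2 : DifferentiableAt ℝ Ψ (XT Γ ε p) :=
    (hΨ.contDiffAt (hΩ.mem_nhds hp)).differentiableAt (by simp)
  have hX : HasFDerivAt (XT Γ ε) (fderiv ℝ (XT Γ ε) p) p := (XT_smooth.differentiable (by simp) p).hasFDerivAt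
  have := h2.hasFDerivAt.comp p hX
  rw [h.fderiv_eq, show pullT Γ ε Ψ = Ψ ∘ XT Γ ε from rfl, this.fderiv]
  rfl

lemma eqn_pt (hε : 0 < ε) (hΩ : IsOpen Ω) (hc : closure (TubeSet Γ ε) ⊆ Ω) (hΨ : ContDiffOn ℝ (⊤ : ℕ∞) Ψ Ω)
    {u : Fn Γ.ℓ} (h : ∀ p ∈ domC, u.1 =ᶠ[𝓝 p] pullT Γ ε Ψ) {p : P3} (hp : p.2.1 ^ 2 + p.2.2 ^ 2 < 1)
    (hB : 1 - ε * Γ.κ p.1 * p.2.1 ≠ 0) (hl : lap3 Ψ (XT Γ ε p) = rhoSrc Γ ε p) :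
    ev p (BB Γ ε ^ 3 * Lap u - ε • (kp Γ * BB Γ ε ^ 2 * d1 u)
    + ε ^ 2 • (BB Γ ε * DD Γ (DD Γ u) - DD Γ (BB Γ ε) * DD Γ u) - ε ^ 3 • Src Γ) = 0 := by
  have hO : ∀ᶠ q : P3 in 𝓝 p, q.2.1 ^ 2 + q.2.2 ^ 2 < 1 :=
    (isOpen_lt (by fun_prop : Continuous fun q : P3 => q.2.1 ^ 2 + q.2.2 ^ 2) (by fun_prop : Continuous fun q : P3 => (1:ℝ))).mem_nhds hp
  have hm : ∀ q : P3, q.2.1 ^ 2 + q.2.2 ^ 2 < 1 → XT Γ ε q ∈ Ω := fun q hq => hc (tube_cmem hε hq.le)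
  have hD : ∀ᶠ q : P3 in 𝓝 p, ∀ e, fderiv ℝ u.1 q e = fderiv ℝ Ψ (XT Γ ε q) (fderiv ℝ (XT Γ ε) q e) :=
    hO.mono fun q hq e => dΨ hΩ hΨ (hm q hq) (h q hq.le) e
  have hx := hm p hp
  set G := fderiv ℝ Ψ (XT Γ ε p) with hG
  set H := fderiv ℝ (fderiv ℝ Ψ) (XT Γ ε p) with hH
  have hd2 : DifferentiableAt ℝ (fderiv ℝ Ψ) (XT Γ ε p) :=
    ((hΨ.contDiffAt (hΩ.mem_nhds hx)).fderiv_right (m := (⊤ : ℕ∞)) (by simp)).differentiableAt (by simp)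
  have hlap := lap_frame (Γ := Γ) hd2 p.1
  rw [hl, ← hH] at hlap
  -- first derivatives
  have a1 : ev p (d1 u) = ε * G (Γ.e₁ p.1) := by
    have := hD.self_of_nhds (0, 1, 0)
    rw [XT_d1, map_smul, smul_eq_mul] at this
    exact this
  have a2 : ev p (DD Γ u) = (1 - ε * Γ.κ p.1 * p.2.1) * G (deriv Γ.γ p.1) := by
    rw [ev_DD, hD.self_of_nhds, XT_eD, map_smul, smul_eq_mul]
  -- second derivatives
  have b1 : ev p (d1 (d1 u)) = ε ^ 2 * H (Γ.e₁ p.1) (Γ.e₁ p.1) := by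
    have hv : (d1 u).1 =ᶠ[𝓝 p] fun q => fderiv ℝ Ψ (XT Γ ε q) (ε • Γ.e₁ q.1) :=
      hD.mono fun q hq => by
        have := hq (0, 1, 0)
        rw [XT_d1] at this; exact this
    have := dG hΩ hΨ hx ((hf_slow (hd_e₁ (Γ := Γ) p.1)).const_smul ε) hv (0, 1, 0)
    rw [XT_d1] at this
    refine Eq.trans this ?_
    simp; ring
  have b2 : ev p (d2 (d2 u)) = ε ^ 2 * H (Γ.e₂ p.1) (Γ.e₂ p.1) := by
    have hv : (d2 u).1 =ᶠ[𝓝 p] fun q => fderiv ℝ Ψ (XT Γ ε q) (ε • Γ.e₂ q.1) :=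
      hD.mono fun q hq => by
        have := hq (0, 0, 1)
        rw [XT_d2] at this; exact this
    have := dG hΩ hΨ hx ((hf_slow (hd_e₂ (Γ := Γ) p.1)).const_smul ε) hv (0, 0, 1)
    rw [XT_d2] at this
    refine Eq.trans this ?_
    simp; ring
  have b0 : ev p (DD Γ (DD Γ u)) = (1 - ε * Γ.κ p.1 * p.2.1) ^ 2 * H (deriv Γ.γ p.1) (deriv Γ.γ p.1)
      + (ev p (DD Γ (BB Γ ε)) * G (deriv Γ.γ p.1) + (1 - ε * Γ.κ p.1 * p.2.1) * Γ.κ p.1 * G (Γ.e₁ p.1)) := by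
    have hBv : ∀ q : P3, (BB Γ ε).1 q = 1 - ε * Γ.κ q.1 * q.2.1 := by
      intro q
      show ev q (BB Γ ε) = _
      simp only [BB, map_sub, map_one, map_smul, map_mul, ev_kp, ev_y1, smul_eq_mul]; ring
    have hv : (DD Γ u).1 =ᶠ[𝓝 p] fun q => fderiv ℝ Ψ (XT Γ ε q) ((BB Γ ε).1 q • deriv Γ.γ q.1) :=
      hD.mono fun q hq => by
        show ev q (DD Γ u) = _
        rw [ev_DD, hq, XT_eD]
        simp only [hBv]
    have := dG hΩ hΨ hx (((BB Γ ε).diff p).hasFDerivAt.smul (hf_slow (hd_γ' (Γ := Γ) p.1))) hv (eD Γ p)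
    rw [ev_DD, this, XT_eD, ev_DD, ← hH, ← hG, hBv]
    simp [hBv, eD]
    ring
  have hBB : ev p (BB Γ ε) = 1 - ε * Γ.κ p.1 * p.2.1 := by
    simp only [BB, map_sub, map_one, map_smul, map_mul, ev_kp, ev_y1, smul_eq_mul]; ring
  have hS : ev p (Src Γ) = Γ.τ p.1 * Γ.κ p.1 * p.2.2 - deriv Γ.κ p.1 * p.2.1 := by
    simp only [Src, map_sub, map_mul, ev_kp, ev_tt, ev_dkp, ev_y1, ev_y2]
  simp only [map_sub, map_add, map_mul, map_smul, map_pow, smul_eq_mul, Lap, a1, a2, b0, b1, b2, hBB, ev_kp, hS]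
  simp only [rhoSrc] at hlap
  set B := 1 - ε * Γ.κ p.1 * p.2.1
  set S := Γ.τ p.1 * Γ.κ p.1 * p.2.2 - deriv Γ.κ p.1 * p.2.1
  have h3 : ε ^ 2 * B ^ 3 * (ε * (B ^ 3)⁻¹ * S) = ε ^ 3 * S := by
    field_simp
  rw [hlap] at h3
  linear_combination h3

lemma mean_II {u : Fn ℓ} (hℓ : 0 < ℓ) : ∫ p in domP ℓ, u.1 p = II u := by
  have hi : IntegrableOn u.1 (domP ℓ) := by
    refine (u.cont.continuousOn.integrableOn_compact (isCompact_Icc.prod dsk_compact : IsCompact ((Set.Icc 0 ℓ) ×ˢ dsk))).mono_set ?_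
    exact Set.prod_mono Set.Ioc_subset_Icc_self le_rfl
  rw [II_def, intervalIntegral.integral_of_le hℓ.le]
  rw [domP, Measure.volume_eq_prod, setIntegral_prod _ hi]
  rfl

lemma dat_exists (hε : 0 < ε) {Ρ : E3 → ℝ} (hN : NeumannSol Γ ε Ψ Ρ)
    (hR : ∀ (α : ℝ) (y : ℝ × ℝ), y.1 ^ 2 + y.2 ^ 2 ≤ 1 → Ρ (tubeCoord Γ ε α y) = rhoSrc Γ ε (α, y.1, y.2))
    (hB : ∀ p ∈ domC, 1 - ε * Γ.κ p.1 * p.2.1 ≠ 0) :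
    ∃ i : Dat Γ, i.ε = ε ∧ ∀ p ∈ domC, i.u.1 =ᶠ[𝓝 p] pullT Γ ε Ψ := by
  obtain ⟨⟨Ω, hΩ, hc, hΨ, _⟩, hl, hn, hm⟩ := hN
  obtain ⟨u, hu⟩ := ext_exists hε hΩ hc hΨ
  refine ⟨⟨ε, hε, 0, u, fun α => ZS_of_open fun a b hab => ?_, fun α θ => ?_, ?_⟩, rfl, hu⟩
  · refine eqn_pt hε hΩ hc hΨ hu hab (hB (α, a, b) hab.le) ?_
    rw [hl _ (tube_mem hε hab)]
    exact hR α (a, b) hab.le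
  · have hp : ((α, cos θ, sin θ) : P3) ∈ domC := by simp [domC]
    have hx : XT Γ ε (α, cos θ, sin θ) ∈ Ω := hc (tube_cmem hε hp)
    have h1 : ev (α, cos θ, sin θ) (d1 u) = _ := dΨ hΩ hΨ hx (hu _ hp) (0, 1, 0)
    have h2 : ev (α, cos θ, sin θ) (d2 u) = _ := dΨ hΩ hΨ hx (hu _ hp) (0, 0, 1)
    have h3 := hn α θ
    rw [XT_d1, map_smul, smul_eq_mul] at h1
    rw [XT_d2, map_smul, smul_eq_mul] at h2
    rw [map_add, map_smul, map_smul, smul_eq_mul, smul_eq_mul] at h3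
    rw [dS_def, map_add, map_mul, map_mul, h1, h2]
    simp only [ev_y1, ev_y2]
    have : XT Γ ε (α, cos θ, sin θ) = tubeCoord Γ ε α (cos θ, sin θ) := rfl
    rw [this]
    linear_combination ε * h3
  · rw [← mean_II Γ.hℓ, ← hm]
    refine setIntegral_congr_fun (measurableSet_Ioc.prod dsk_meas) fun p hp => ?_
    exact (hu p hp.2).self_of_nhds

end Clc
end Gam
end

section

variable {ℓ : ℝ}
section Gam
variable {Γ : FramedCurve}

lemma bound_of_SB {s : ℕ} {w : Dat Γ → Fn Γ.ℓ} (h : SB s w) (k : ℕ) : ∃ C > (0:ℝ), ∃ ε₀ > (0:ℝ), ∀ i : Dat Γ, i.ε < ε₀ →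
    ∀ j ≤ k, ∀ p ∈ domC, ∀ f : P3 → ℝ, f =ᶠ[𝓝 p] (w i).1 → ‖iteratedFDeriv ℝ j f p‖ ≤ C * i.ε ^ s := by
  obtain ⟨C, hC⟩ := FDB k (h k)
  obtain ⟨e, he, h⟩ := FF_ev hC
  refine ⟨max C 1, by positivity, e, he, fun i hi j hj p hp f hf => ?_⟩
  have e1 : iteratedFDeriv ℝ j f p = iteratedFDeriv ℝ j (w i).1 p := (hf.iteratedFDeriv ℝ j).self_of_nhds
  rw [e1]
  exact (h i hi p hp j hj).trans (mul_le_mul_of_nonneg_right (le_max_left _ _) (pow_nonneg i.hε.le _))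

lemma B_ne : ∃ ε₀ > (0:ℝ), ∀ ε : ℝ, 0 < ε → ε < ε₀ → ∀ p ∈ domC, 1 - ε * Γ.κ p.1 * p.2.1 ≠ 0 := by
  obtain ⟨C, hC⟩ := Fn_bound Γ.hℓ (kp Γ * y1)
  have hM : 0 < max C 1 := by positivity
  refine ⟨1 / max C 1, by positivity, fun ε h0 h1 p hp h => ?_⟩
  have h2 := hC p.1 p.2.1 p.2.2 hp
  rw [map_mul, ev_kp, ev_y1] at h2
  simp only at h2
  rw [lt_div_iff₀ hM] at h1
  have h3 := (le_abs_self _).trans (h2.trans (le_max_left C 1))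
  have h4 := mul_le_mul_of_nonneg_left h3 h0.le
  linarith

/-- transfer of a local identity to first derivatives -/
lemma fd_ev {f : P3 → ℝ} {u : Fn Γ.ℓ} {p : P3} (h : u.1 =ᶠ[𝓝 p] f) :
    ∀ᶠ q in 𝓝 p, ∀ e, fderiv ℝ f q e = fderiv ℝ u.1 q e :=
  h.eventuallyEq_nhds.mono fun q hq e => by rw [hq.fderiv_eq]

end Gam

end

/-- **Asymptotics of the harmonic potential** (Theorem 4.12).  Let `ψ` be the
zero-mean Neumann solution of `Δψ = ρ` with `ρ = εB⁻³r(τκ sin θ − κ′ cos θ)`.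
Then `ψ = O(ε²)`, `D_yψ = D_yφ₀ + O(ε⁴)` and `∂_θψ = ∂_θφ₀ + ∂_θφ₁ + O(ε⁵)`,
where `O(εⁿ)` is measured in every `C^k` norm on `𝕊¹_ℓ × 𝔻²`. -/
theorem harmonic_potential_asymptotics
    (Γ : FramedCurve) (k : ℕ) :
    ∃ C > (0 : ℝ), ∃ ε₀ > (0 : ℝ), ∀ ε : ℝ, 0 < ε → ε < ε₀ →
      ∀ Ψ Ρ : E3 → ℝ, NeumannSol Γ ε Ψ Ρ →
        (∀ (α : ℝ) (y : ℝ × ℝ), y.1 ^ 2 + y.2 ^ 2 ≤ 1 →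
          Ρ (tubeCoord Γ ε α y) = rhoSrc Γ ε (α, y.1, y.2)) →
        ∀ j ≤ k, ∀ p ∈ domC,
          -- `ψ = O(ε²)`
          ‖iteratedFDeriv ℝ j (pullT Γ ε Ψ) p‖ ≤ C * ε ^ 2 ∧
          -- `D_y ψ = D_y φ₀ + O(ε⁴)`
          ‖iteratedFDeriv ℝ j
            (fun q => pd1 (pullT Γ ε Ψ) q - pd1 (phi0 Γ ε) q) p‖ ≤ C * ε ^ 4 ∧
          ‖iteratedFDeriv ℝ j
            (fun q => pd2 (pullT Γ ε Ψ) q - pd2 (phi0 Γ ε) q) p‖ ≤ C * ε ^ 4 ∧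
          -- `∂_θ ψ = ∂_θ φ₀ + ∂_θ φ₁ + O(ε⁵)`
          ‖iteratedFDeriv ℝ j
            (fun q => thetaD (pullT Γ ε Ψ) q - thetaD (phi0 Γ ε) q -
              thetaD (phi1 Γ ε) q) p‖ ≤ C * ε ^ 5 := by
  obtain ⟨C1, hC1, e1, he1, H1⟩ := bound_of_SB (SB2_psi (Γ := Γ)) k
  obtain ⟨C2, hC2, e2, he2, H2⟩ := bound_of_SB (SB4_w0 (Γ := Γ)).1 k
  obtain ⟨C3, hC3, e3, he3, H3⟩ := bound_of_SB (SB4_w0 (Γ := Γ)).2 k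
  obtain ⟨C4, hC4, e4, he4, H4⟩ := bound_of_SB (SB5_w1 (Γ := Γ)) k
  obtain ⟨e5, he5, H5⟩ := B_ne (Γ := Γ)
  refine ⟨C1 + C2 + C3 + C4, by positivity, min e1 (min e2 (min e3 (min e4 e5))), by positivity, ?_⟩
  intro ε hε hlt Ψ Ρ hN hR j hj p hp
  simp only [lt_min_iff] at hlt
  obtain ⟨l1, l2, l3, l4, l5⟩ := hlt
  obtain ⟨i, rfl, hi⟩ := dat_exists hε hN hR (H5 ε hε l5)
  have hf := fd_ev (hi p hp)
  have hw0 : ∀ (q e : P3), ev q (dv e (w0 i)) = fderiv ℝ i.u.1 q e - fderiv ℝ (phi0 Γ i.ε) q e := by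
    intro q e
    rw [phi0_eq, w0, map_sub, map_sub]; rfl
  have hw1 : ∀ (q e : P3), ev q (dv e (w1 i)) = fderiv ℝ i.u.1 q e - fderiv ℝ (phi0 Γ i.ε) q e - fderiv ℝ (phi1 Γ i.ε) q e := by
    intro q e
    rw [phi0_eq, phi1_eq, w1, map_sub, map_sub, map_sub, map_sub]; rfl
  refine ⟨?_, ?_, ?_, ?_⟩
  · refine (H1 i l1 j hj p hp _ (hi p hp).symm).trans ?_
    exact mul_le_mul_of_nonneg_right (by linarith) (by positivity)
  · refine (H2 i l2 j hj p hp _ (hf.mono fun q hq => ?_)).trans ?_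
    · show _ = ev q (dv (0, 1, 0) (w0 i))
      rw [hw0, pd1, pd1, hq]
    · exact mul_le_mul_of_nonneg_right (by linarith) (by positivity)
  · refine (H3 i l3 j hj p hp _ (hf.mono fun q hq => ?_)).trans ?_
    · show _ = ev q (dv (0, 0, 1) (w0 i))
      rw [hw0, pd2, pd2, hq]
    · exact mul_le_mul_of_nonneg_right (by linarith) (by positivity)
  · refine (H4 i l4 j hj p hp _ (hf.mono fun q hq => ?_)).trans ?_
    · show _ = ev q (dT (w1 i))
      rw [dT_def, map_sub, map_mul, map_mul, d1, d2, hw1, hw1, thetaD, thetaD, thetaD, hq, hq, ev_y1, ev_y2]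
      ring
    · exact mul_le_mul_of_nonneg_right (by linarith) (by positivity)
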